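/- arXiv:1604.05836 — 3 statements merged into one kernel-verified Lean document; each statement's English description precedes it below -/
import Mathlib

section
/- Let T be a negative definite even integral lattice such that the discriminant group discr T is 3-elementary (i.e., an F₃-vector space). Then T contains a finite index sublattice T' isomorphic to T̄*(3) for some even lattice T̄ whose discriminant form is ⟨(2/3)r⟩^m with r = ±1, 0 ≤ m ≤ 2, and 2mr ≡ σ(T) (mod 8), where σ is the signature. -/
open scoped BigOperators

variable {V : Type*} [AddCommGroup V] [Module ℚ V]

/-- The dual lattice `T^♯` of a lattice `T` in a rational quadratic space `(V, B)`:
all vectors pairing integrally with `T`. -/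
def dualLat (B : V →ₗ[ℚ] V →ₗ[ℚ] ℚ) (T : Submodule ℤ V) : Submodule ℤ V where
  carrier := {x | ∀ y ∈ T, ∃ n : ℤ, B x y = (n : ℚ)}
  add_mem' := by
    intro a b ha hb y hy
    obtain ⟨m, hm⟩ := ha y hy
    obtain ⟨n, hn⟩ := hb y hy
    exact ⟨m + n, by rw [map_add, LinearMap.add_apply, hm, hn]; push_cast; ring⟩
  zero_mem' := by
    intro y hy
    exact ⟨0, by simp⟩
  smul_mem' := by
    intro c x hx y hy
    obtain ⟨n, hn⟩ := hx y hy
    refine ⟨c * n, ?_⟩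
    rw [map_zsmul, LinearMap.smul_apply, hn, zsmul_eq_mul]
    push_cast; ring

section helpers
open Complex Filter Topology

lemma ofReal_pos_mul_cpow (x : ℝ) (hx : 0 < x) (z s : ℂ) (hz : z ≠ 0) :
    ((x : ℂ) * z) ^ s = (x : ℂ) ^ s * z ^ s := by
  have hx' : (x : ℂ) ≠ 0 := by exact_mod_cast hx.ne'
  rw [cpow_def_of_ne_zero (mul_ne_zero hx' hz), cpow_def_of_ne_zero hx', cpow_def_of_ne_zero hz,
    Complex.log_ofReal_mul hx hz, ← Complex.exp_add, Complex.ofReal_log hx.le]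
  ring_nf

lemma theta_inv (τ : ℂ) (hτ : 0 < τ.im) :
    jacobiTheta (-1 / τ) = (-I * τ) ^ (1 / 2 : ℂ) * jacobiTheta τ := by
  have := jacobiTheta_S_smul ⟨τ, hτ⟩
  rw [UpperHalfPlane.modular_S_smul] at this
  rw [show -1 / τ = (-τ)⁻¹ by rw [neg_div, one_div, inv_neg]]
  exact this

lemma theta_add_even (a : ℕ) (τ : ℂ) : jacobiTheta (2 * a + τ) = jacobiTheta τ := by
  induction a with
  | zero => simp
  | succ n ih =>
    rw [← ih, ← jacobiTheta_two_add (2 * n + τ)]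
    congr 1; push_cast; ring

lemma theta_split (a : ℕ) (ha : 0 < a) (t : ℝ) (ht : 0 < t) :
    jacobiTheta (1 / (2 * a : ℂ) + I * t) =
      ∑ k : Fin (2 * a), cexp (Real.pi * I * (k : ℂ) ^ 2 / (2 * a)) *
        (HurwitzZeta.evenKernel (((k : ℝ) / (2 * a) : ℝ) : UnitAddCircle) ((2 * a) ^ 2 * t) : ℂ) := by
  have hN : NeZero (2 * a) := ⟨by omega⟩
  have ha' : (a : ℂ) ≠ 0 := by exact_mod_cast ha.ne'
  have haR : (a : ℝ) ≠ 0 := by exact_mod_cast ha.ne'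
  have hτ : 0 < (1 / (2 * a : ℂ) + I * t).im := by
    have : (1 / (2 * a : ℂ)) = ((1 / (2 * a) : ℝ) : ℂ) := by push_cast; rfl
    rw [this]; simp [ht]
  have hs := (hasSum_jacobiTheta₂_term 0 hτ)
  rw [← jacobiTheta_eq_jacobiTheta₂] at hs
  have hs2 := (Equiv.hasSum_iff ((Int.divModEquiv (2 * a)).trans (Equiv.prodComm _ _)).symm).2 hs
  refine (hs2.prod_fiberwise fun k => ?_).unique (hasSum_fintype _)
  have hpos : (0 : ℝ) < (2 * a) ^ 2 * t := by positivity
  have h3 := (hasSum_ofReal.mpr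
    (HurwitzZeta.hasSum_int_evenKernel ((k : ℝ) / (2 * a)) hpos)).mul_left
      (cexp (Real.pi * I * (k : ℂ) ^ 2 / (2 * a)))
  refine h3.congr_fun fun n => ?_
  simp only [Function.comp, jacobiTheta₂_term]
  rw [ofReal_exp, ← Complex.exp_add, Complex.exp_eq_exp_iff_exists_int]
  refine ⟨n * k + a * n ^ 2, ?_⟩
  simp [Int.divModEquiv]
  field_simp
  ring_nf
  simp only [I_sq]
  ring

lemma gauss_one (a : ℕ) (ha : 0 < a) :
    ∃ s : ℝ, 0 < s ∧ ∑ k : Fin (2 * a), cexp (Real.pi * I * (k : ℂ) ^ 2 / (2 * a)) =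
      s * cexp (Real.pi * I / 4) := by
  have ha' : (a : ℂ) ≠ 0 := by exact_mod_cast ha.ne'
  have haR : (0 : ℝ) < a := by exact_mod_cast ha
  set G := ∑ k : Fin (2 * a), cexp (Real.pi * I * (k : ℂ) ^ 2 / (2 * a)) with hG
  -- the exact identity, u = 1/(N² t)
  have key : ∀ u : ℝ, 0 < u → jacobiTheta (I * u - 1 / (2 * a)) =
      (1 / (1 + I / (2 * a * u))) ^ (1 / 2 : ℂ) *
      (-I * (1 / (2 * a : ℂ) + I / ((2 * a) ^ 2 * u))) ^ (1 / 2 : ℂ) *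
      ∑ k : Fin (2 * a), cexp (Real.pi * I * (k : ℂ) ^ 2 / (2 * a)) *
        (HurwitzZeta.cosKernel (((k : ℝ) / (2 * a) : ℝ) : UnitAddCircle) u : ℂ) := by
    intro u hu
    have hu' : (u : ℂ) ≠ 0 := by exact_mod_cast hu.ne'
    set t : ℝ := 1 / ((2 * a) ^ 2 * u) with htdef
    have ht : 0 < t := by positivity
    have htC : (I / ((2 * a) ^ 2 * u) : ℂ) = I * t := by rw [htdef]; push_cast; ring
    have hτ : 0 < (1 / (2 * a : ℂ) + I * t).im := by
      have : (1 / (2 * a : ℂ)) = ((1 / (2 * a) : ℝ) : ℂ) := by push_cast; rfl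
      rw [this]; simp [ht]
    have hτ0 : (1 / (2 * a : ℂ) + I * t) ≠ 0 := by
      intro h; rw [h] at hτ; simp at hτ
    set τ : ℂ := 1 / (2 * a : ℂ) + I * t with hτdef
    have hS : 0 < (-1 / τ).im := by
      rw [neg_div, neg_im, one_div, inv_im]
      have := normSq_pos.2 hτ0
      rw [neg_div, neg_neg]; positivity
    set τ' : ℂ := 2 * a + -1 / τ with hτ'
    have hτ'im : 0 < τ'.im := by
      rw [hτ', add_im]
      have : (2 * (a : ℂ)).im = 0 := by simp
      rw [this, zero_add]; exact hS
    have hτ'0 : τ' ≠ 0 := by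
      intro h; rw [h] at hτ'im; simp at hτ'im
    have h1 : (1 + I / (2 * a * u)) = 2 * a * τ := by
      rw [hτdef, ← htC]; field_simp
    have h1' : (1 + I / (2 * a * u)) ≠ 0 := by
      rw [h1]; exact mul_ne_zero (mul_ne_zero two_ne_zero ha') hτ0
    have h2 : -I * τ' = ((1 / u : ℝ) : ℂ) * (1 / (1 + I / (2 * a * u))) := by
      rw [h1, hτ']
      have : τ = 1 / (2 * a : ℂ) + I / ((2 * a) ^ 2 * u) := by rw [htC]
      field_simp
      rw [this]
      push_cast
      field_simp
      ring_nf
      simp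
    have h3 : -1 / τ' = I * u - 1 / (2 * a) := by
      have h4 : τ' = I * (((1 / u : ℝ) : ℂ) * (1 / (1 + I / (2 * a * u)))) := by
        rw [← h2, ← mul_assoc]; simp
      rw [h4]
      push_cast
      field_simp
      linear_combination (-2 * a * u : ℂ) * I_sq
    rw [← h3, theta_inv τ' hτ'im, hτ', theta_add_even, ← hτ', theta_inv τ hτ, htC, ← hτdef, h2,
      ofReal_pos_mul_cpow _ (by positivity) _ _ (one_div_ne_zero h1'), hτdef, theta_split a ha t ht]
    rw [← hτdef, Finset.mul_sum, Finset.mul_sum, Finset.mul_sum]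
    refine Finset.sum_congr rfl fun k _ => ?_
    rw [HurwitzZeta.evenKernel_functional_equation]
    have h5 : 1 / ((2 * a) ^ 2 * t) = u := by rw [htdef]; field_simp
    have h6 : ((2 * a) ^ 2 * t) = 1 / u := by rw [← h5]; simp
    rw [h5, h6]
    push_cast [ofReal_cpow (one_div_pos.2 hu).le]
    have h7 : ((1 / u : ℂ)) ^ (1 / 2 : ℂ) ≠ 0 := by
      rw [Ne, cpow_eq_zero_iff]; simp [hu']
    field_simp
  have lim1 : Tendsto (fun u : ℝ => jacobiTheta (I * u - 1 / (2 * a))) atTop (𝓝 1) := by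
    have him : ∀ u : ℝ, (I * u - 1 / (2 * a) : ℂ).im = u := by
      intro u
      have : (1 / (2 * a : ℂ)) = ((1 / (2 * a) : ℝ) : ℂ) := by push_cast; rfl
      rw [this]; simp
    have h1 : Tendsto (fun u : ℝ => (I * u - 1 / (2 * a) : ℂ)) atTop (comap im atTop) := by
      rw [tendsto_comap_iff]
      refine tendsto_id.congr fun u => (him u).symm
    have h2 := isBigO_at_im_infty_jacobiTheta_sub_one.comp_tendsto h1
    have h3 : Tendsto (fun u : ℝ => Real.exp (-Real.pi * u)) atTop (𝓝 0) := by
      apply Real.tendsto_exp_atBot.comp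
      exact tendsto_id.const_mul_atTop_of_neg (by simp [Real.pi_pos])
    have h4 := h2.trans_tendsto (h3.congr fun u => by simp only [Function.comp, him])
    have := h4.add_const 1
    simpa [Function.comp_def] using this
  have limI : ∀ c : ℂ, Tendsto (fun u : ℝ => c / (u : ℂ)) atTop (𝓝 0) := by
    intro c
    have : Tendsto (fun u : ℝ => ((u⁻¹ : ℝ) : ℂ)) atTop (𝓝 ((0 : ℝ) : ℂ)) :=
      (continuous_ofReal.tendsto 0).comp tendsto_inv_atTop_zero
    have := this.const_mul c
    simpa [div_eq_mul_inv] using this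
  have lim2 : Tendsto (fun u : ℝ => (1 / (1 + I / (2 * a * u)) : ℂ) ^ (1 / 2 : ℂ)) atTop (𝓝 1) := by
    have h : Tendsto (fun u : ℝ => (1 / (1 + I / (2 * a * u)) : ℂ)) atTop (𝓝 1) := by
      have := ((limI (I / (2 * a))).const_add 1).inv₀ (by simp)
      simpa [div_div] using this
    have := h.cpow (tendsto_const_nhds (x := (1 / 2 : ℂ))) (by simp)
    simpa using this
  have lim3 : Tendsto (fun u : ℝ => (-I * (1 / (2 * a : ℂ) + I / ((2 * a) ^ 2 * u))) ^ (1 / 2 : ℂ))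
      atTop (𝓝 ((-I * (1 / (2 * a : ℂ))) ^ (1 / 2 : ℂ))) := by
    have h : Tendsto (fun u : ℝ => (-I * (1 / (2 * a : ℂ) + I / ((2 * a) ^ 2 * u)))) atTop
        (𝓝 (-I * (1 / (2 * a : ℂ)))) := by
      have := ((limI (I / (2 * a) ^ 2)).const_add (1 / (2 * a : ℂ))).const_mul (-I)
      simpa [div_div] using this
    refine h.cpow tendsto_const_nhds ?_
    right
    have : (1 / (2 * a : ℂ)) = ((1 / (2 * a) : ℝ) : ℂ) := by push_cast; rfl
    rw [this]; simp; exact ha.ne'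
  have lim4 : Tendsto (fun u : ℝ => ∑ k : Fin (2 * a), cexp (Real.pi * I * (k : ℂ) ^ 2 / (2 * a)) *
        (HurwitzZeta.cosKernel (((k : ℝ) / (2 * a) : ℝ) : UnitAddCircle) u : ℂ)) atTop (𝓝 G) := by
    rw [hG]
    refine tendsto_finsetSum _ fun k _ => ?_
    obtain ⟨p, hp, hO⟩ := HurwitzZeta.isBigO_atTop_cosKernel_sub
      (((k : ℝ) / (2 * a) : ℝ) : UnitAddCircle)
    have h3 : Tendsto (fun u : ℝ => Real.exp (-p * u)) atTop (𝓝 0) := by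
      apply Real.tendsto_exp_atBot.comp
      exact tendsto_id.const_mul_atTop_of_neg (by simp [hp])
    have h4 := (hO.trans_tendsto h3).add_const 1
    simp only [sub_add_cancel, zero_add] at h4
    have h5 := ((continuous_ofReal.tendsto 1).comp h4).const_mul
      (cexp (Real.pi * I * (k : ℂ) ^ 2 / (2 * a)))
    simpa using h5
  have heq := tendsto_nhds_unique lim1 (((lim2.mul lim3).mul lim4).congr' (by
    filter_upwards [eventually_gt_atTop 0] with u hu
    exact (key u hu).symm))
  have h8 : (-I * (1 / (2 * a : ℂ))) = ((1 / (2 * a) : ℝ) : ℂ) * (-I) := by push_cast; ring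
  rw [one_mul, h8, ofReal_pos_mul_cpow _ (by positivity) _ _ (by simp)] at heq
  have h9 : (-I) ^ (1 / 2 : ℂ) = cexp (-(Real.pi * I / 4)) := by
    rw [cpow_def_of_ne_zero (by simp), log_neg_I]
    congr 1; ring
  have h10 : (((1 / (2 * a) : ℝ) : ℂ)) ^ (1 / 2 : ℂ) = (((1 / (2 * a) : ℝ) ^ (1 / 2 : ℝ) : ℝ) : ℂ) := by
    rw [ofReal_cpow (by positivity)]; simp
  have hpos : 0 < (1 / (2 * a) : ℝ) ^ (1 / 2 : ℝ) := by positivity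
  rw [h9, h10] at heq
  set v := (1 / (2 * a) : ℝ) ^ (1 / 2 : ℝ)
  refine ⟨v⁻¹, by positivity, ?_⟩
  have hv : (v : ℂ) ≠ 0 := by exact_mod_cast hpos.ne'
  rw [Complex.exp_neg] at heq
  have he := Complex.exp_ne_zero (Real.pi * I / 4)
  push_cast
  field_simp at heq ⊢
  linear_combination -heq

open Classical in
lemma sum_reduce {A : Type*} [AddCommGroup A] [Fintype A] (f : A → ℂ) (hf : ∀ x, f x ≠ 0)
    (H : AddSubgroup A)
    (hbil : ∀ x, ∀ h ∈ H, ∀ h' ∈ H, f (x + (h + h')) * f x = f (x + h) * f (x + h')) :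
    ∑ x, f x = ∑ x with (∀ h ∈ H, f (x + h) = f x), f x := by
  let χ : A → AddChar H ℂ := fun x =>
    { toFun := fun h => f (x + h) / f x
      map_zero_eq_one' := by simp [hf]
      map_add_eq_mul' := by
        intro h h'
        have := hbil x h h.2 h' h'.2
        have h0 := hf x
        push_cast
        field_simp
        exact this }
  have hχ : ∀ x, χ x = 0 ↔ ∀ h ∈ H, f (x + h) = f x := by
    intro x
    constructor
    · intro h0 h hh
      have : χ x ⟨h, hh⟩ = 1 := by rw [h0]; rfl
      have h1 : f (x + h) / f x = 1 := this
      rwa [div_eq_one_iff_eq (hf x)] at h1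
    · intro h0
      ext h
      change f (x + h) / f x = 1
      rw [h0 h h.2, div_self (hf x)]
  have hc : (Fintype.card H : ℂ) ≠ 0 := by exact_mod_cast Fintype.card_ne_zero
  have h1 : (Fintype.card H : ℂ) * ∑ x, f x = ∑ x, ∑ h : H, f (x + h) := by
    rw [Finset.sum_comm, ← nsmul_eq_mul, ← Finset.card_univ, ← Finset.sum_const]
    refine Finset.sum_congr rfl fun h _ => ?_
    exact (Equiv.sum_comp (Equiv.addRight (h : A)) f).symm
  have h2 : ∀ x, ∑ h : H, f (x + h) =
      (Fintype.card H : ℂ) * if (∀ h ∈ H, f (x + h) = f x) then f x else 0 := by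
    intro x
    have : ∑ h : H, f (x + h) = f x * ∑ h : H, χ x h := by
      rw [Finset.mul_sum]
      refine Finset.sum_congr rfl fun h _ => ?_
      change f (x + h) = f x * (f (x + h) / f x)
      rw [mul_div_cancel₀ _ (hf x)]
    rw [this, AddChar.sum_eq_ite]
    by_cases hx : ∀ h ∈ H, f (x + h) = f x
    · rw [if_pos ((hχ x).2 hx), if_pos hx, mul_comm]
    · rw [if_neg (fun h => hx ((hχ x).1 h)), if_neg hx]; simp
  rw [Finset.sum_congr rfl (fun x _ => h2 x), ← Finset.mul_sum] at h1
  rw [mul_left_cancel₀ hc h1, Finset.sum_filter]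

lemma sum_reduce' {A C : Type*} [AddCommGroup A] [Fintype A] [Fintype C] (f : A → ℂ)
    (hf : ∀ x, f x ≠ 0) (H : AddSubgroup A)
    (hbil : ∀ x, ∀ h ∈ H, ∀ h' ∈ H, f (x + (h + h')) * f x = f (x + h) * f (x + h'))
    (s : C → A) (hs : ∀ c, ∀ h ∈ H, f (s c + h) = f (s c))
    (hinj : ∀ c c', s c - s c' ∈ H → c = c')
    (hsurj : ∀ x, (∀ h ∈ H, f (x + h) = f x) → ∃ c, x - s c ∈ H) :
    ∃ k : ℕ, 0 < k ∧ ∑ x, f x = k * ∑ c, f (s c) := by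
  classical
  refine ⟨Fintype.card H, Fintype.card_pos, ?_⟩
  rw [sum_reduce f hf H hbil]
  have : (Fintype.card H : ℂ) * ∑ c, f (s c) = ∑ p : C × H, f (s p.1 + p.2) := by
    rw [Fintype.sum_prod_type, Finset.mul_sum]
    refine Finset.sum_congr rfl fun c _ => ?_
    rw [Finset.sum_congr rfl (fun h _ => hs c (h : H) h.2)]
    simp
  rw [this]
  symm
  refine Finset.sum_bij (fun p _ => s p.1 + p.2) ?_ ?_ ?_ ?_
  · rintro ⟨c, h⟩ -
    simp only [Finset.mem_filter, Finset.mem_univ, true_and]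
    intro h' hh'
    rw [hs c h h.2, add_assoc, hs c _ (H.add_mem h.2 hh')]
  · rintro ⟨c, h⟩ - ⟨c', h'⟩ - heq
    simp only at heq
    have h1 : c = c' := by
      apply hinj
      have : s c - s c' = h' - h := by
        rw [sub_eq_sub_iff_add_eq_add, heq, add_comm]
      rw [this]; exact H.sub_mem h'.2 h.2
    subst h1
    have := add_left_cancel heq
    simp [Subtype.ext this]
  · intro x hx
    simp only [Finset.mem_filter, Finset.mem_univ, true_and] at hx
    obtain ⟨c, hc⟩ := hsurj x hx
    exact ⟨(c, ⟨_, hc⟩), Finset.mem_univ _, by simp⟩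
  · intros; rfl

/-- The one dimensional Gaussian on `ZMod N`. -/
noncomputable def gz (N : ℕ) (x : ZMod N) : ℂ := cexp (Real.pi * I * (x.val : ℂ) ^ 2 / N)

lemma gz_intCast (a : ℕ) (ha : 0 < a) (k : ℤ) :
    gz (2 * a) (k : ZMod (2 * a)) = cexp (Real.pi * I * (k : ℂ) ^ 2 / (2 * a)) := by
  have : NeZero (2 * a) := ⟨by omega⟩
  have ha' : (a : ℂ) ≠ 0 := by exact_mod_cast ha.ne'
  have h1 : (((k : ZMod (2 * a)).val : ℤ)) = k % (2 * a : ℕ) := ZMod.val_intCast k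
  have h2 : k = (2 * a) * (k / (2 * a : ℕ)) + (k : ZMod (2 * a)).val := by
    rw [h1]; have := Int.mul_ediv_add_emod k (2 * a : ℕ); push_cast at *; exact this.symm
  set v := (k : ZMod (2 * a)).val
  set d := k / (2 * a : ℕ)
  have h3 : (k : ℂ) = 2 * a * d + v := by rw [h2]; push_cast; ring
  unfold gz
  rw [h3, Complex.exp_eq_exp_iff_exists_int]
  refine ⟨-(a * d ^ 2 + d * v), ?_⟩
  push_cast
  field_simp
  ring

lemma gz_sum (a : ℕ) (ha : 0 < a) [NeZero (2 * a)] :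
    ∃ s : ℝ, 0 < s ∧ ∑ k : ZMod (2 * a), gz (2 * a) k = s * cexp (Real.pi * I / 4) := by
  obtain ⟨s, hs, h⟩ := gauss_one a ha
  refine ⟨s, hs, ?_⟩
  rw [← h]
  symm
  refine Fintype.sum_equiv (ZMod.finEquiv (2 * a)).toEquiv _ _ fun k => ?_
  unfold gz
  have : ((ZMod.finEquiv (2 * a)) k).val = (k : ℕ) := by
    obtain ⟨n, hn⟩ : ∃ n, 2 * a = n + 1 := ⟨2 * a - 1, by omega⟩
    revert k
    generalize 2 * a = N at *
    subst hn
    intro k; rfl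
  simp only [RingEquiv.toEquiv_eq_coe, EquivLike.coe_coe, this]
  push_cast; rfl

lemma gauss_three (r : ℤ) (hr : r = 1 ∨ r = -1) :
    ∑ c : Fin 3, cexp (Real.pi * I * (2 * r / 3) * (c : ℂ) ^ 2) =
      (√3 : ℝ) * cexp (Real.pi * I * r / 2) := by
  have h4 : cexp (Real.pi * I * (2 * r / 3) * 2 ^ 2) = cexp (Real.pi * I * (2 * r / 3)) := by
    rw [Complex.exp_eq_exp_iff_exists_int]
    exact ⟨r, by ring⟩
  have e1 : cexp (Real.pi * I * (2 / 3)) = -1 / 2 + (√3 : ℝ) / 2 * I := by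
    rw [show Real.pi * I * (2 / 3) = ((2 * Real.pi / 3 : ℝ) : ℂ) * I by push_cast; ring, exp_mul_I,
      ← ofReal_cos, ← ofReal_sin,
      show 2 * Real.pi / 3 = Real.pi - Real.pi / 3 by ring, Real.cos_pi_sub, Real.sin_pi_sub,
      Real.cos_pi_div_three, Real.sin_pi_div_three]
    push_cast; ring
  have e2 : cexp (-(Real.pi * I * (2 / 3))) = -1 / 2 - (√3 : ℝ) / 2 * I := by
    rw [show -(Real.pi * I * (2 / 3)) = ((-(2 * Real.pi / 3) : ℝ) : ℂ) * I by push_cast; ring,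
      exp_mul_I, ← ofReal_cos, ← ofReal_sin, Real.cos_neg, Real.sin_neg,
      show 2 * Real.pi / 3 = Real.pi - Real.pi / 3 by ring, Real.cos_pi_sub, Real.sin_pi_sub,
      Real.cos_pi_div_three, Real.sin_pi_div_three]
    push_cast; ring
  have e3 : cexp (Real.pi * I / 2) = I := by
    rw [show Real.pi * I / 2 = Real.pi / 2 * I by ring, exp_pi_div_two_mul_I]
  have e4 : cexp (-(Real.pi * I / 2)) = -I := by
    rw [show -(Real.pi * I / 2) = -Real.pi / 2 * I by ring, exp_neg_pi_div_two_mul_I]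
  rw [Fin.sum_univ_three]
  simp only [Fin.val_zero, Fin.val_one, Fin.val_two, Nat.cast_zero, Nat.cast_one, Nat.cast_ofNat]
  rw [h4]
  rcases hr with rfl | rfl
  · norm_num
    rw [e1, e3]; ring
  · have e5 : (Real.pi * I * (2 * ((-1 : ℤ) : ℂ) / 3)) = -(Real.pi * I * (2 / 3)) := by
      push_cast; ring
    have e6 : (Real.pi * I * ((-1 : ℤ) : ℂ) / 2) = -(Real.pi * I / 2) := by
      push_cast; ring
    rw [e5, e6]
    simp only [one_pow, mul_one]
    rw [e2, e4]; norm_num; ring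

section blij
variable {V : Type*} [AddCommGroup V] [Module ℚ V]

/-- `exp (π i b(x,x))`. -/
noncomputable def FF (b : V →ₗ[ℚ] V →ₗ[ℚ] ℚ) (x : V) : ℂ := cexp (Real.pi * I * ((b x x : ℚ) : ℂ))

lemma FF_add (b : V →ₗ[ℚ] V →ₗ[ℚ] ℚ) (hsymm : ∀ x y, b x y = b y x) (x y : V) :
    FF b (x + y) = FF b x * FF b y * cexp (2 * Real.pi * I * ((b x y : ℚ) : ℂ)) := by
  unfold FF
  rw [← Complex.exp_add, ← Complex.exp_add]
  congr 1
  simp only [map_add, LinearMap.add_apply, hsymm y x]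
  push_cast; ring

lemma exp_int_eq_one_iff (q : ℚ) : cexp (2 * Real.pi * I * ((q : ℚ) : ℂ)) = 1 ↔ ∃ n : ℤ, q = n := by
  rw [Complex.exp_eq_one_iff]
  refine exists_congr fun n => ?_
  rw [mul_comm (2 * Real.pi * I : ℂ), mul_left_inj' Complex.two_pi_I_ne_zero]
  norm_cast

lemma FF_sum (b : V →ₗ[ℚ] V →ₗ[ℚ] ℚ) (hsymm : ∀ x y, b x y = b y x) {ι : Type*} (s : Finset ι)
    (x : ι → V) (h : ∀ i j, i ≠ j → ∃ n : ℤ, b (x i) (x j) = n) :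
    FF b (∑ i ∈ s, x i) = ∏ i ∈ s, FF b (x i) := by
  classical
  induction s using Finset.induction_on with
  | empty => simp [FF]
  | insert j s hj ih =>
    rw [Finset.sum_insert hj, Finset.prod_insert hj, FF_add b hsymm, ih, (exp_int_eq_one_iff _).2,
      mul_one]
    rw [map_sum]
    have : ∀ i, ∃ n : ℤ, i ∈ s → b (x j) (x i) = n := by
      intro i
      by_cases hi : i ∈ s
      · obtain ⟨n, hn⟩ := h j i (fun h => hj (h ▸ hi))
        exact ⟨n, fun _ => hn⟩
      · exact ⟨0, fun h => absurd h hi⟩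
    choose n hn using this
    exact ⟨∑ i ∈ s, n i, by rw [Finset.sum_congr rfl hn]; push_cast; rfl⟩

lemma van_der_blij [FiniteDimensional ℚ V] (b : V →ₗ[ℚ] V →ₗ[ℚ] ℚ)
    (hsymm : ∀ x y, b x y = b y x) (hpos : ∀ x, x ≠ 0 → 0 < b x x) (L : Submodule ℤ V)
    (hfull : ∀ x : V, ∃ N : ℤ, N ≠ 0 ∧ N • x ∈ L)
    (heven : ∀ x ∈ L, ∃ n : ℤ, b x x = 2 * n)
    (r : ℤ) (hr : r = 1 ∨ r = -1) (m : ℕ) (e : Fin m → V)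
    (he : ∀ i, ∀ y ∈ L, ∃ n : ℤ, b (e i) y = n)
    (hortho : ∀ i j, i ≠ j → ∃ n : ℤ, b (e i) (e j) = n)
    (hsq : ∀ i, ∃ n : ℤ, b (e i) (e i) = 2 * r / 3 + 2 * n)
    (h3 : ∀ i, (3 : ℤ) • e i ∈ L)
    (hgen : ∀ x, (∀ y ∈ L, ∃ n : ℤ, b x y = n) → ∃ c : Fin m → ℤ, x - ∑ i, c i • e i ∈ L)
    (hind : ∀ c : Fin m → ℤ, (∑ i, c i • e i) ∈ L → ∀ i, (3 : ℤ) ∣ c i) :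
    2 * (m : ℤ) * r ≡ (Module.finrank ℚ V : ℤ) [ZMOD 8] := by
  classical
  -- integrality on L
  have hint : ∀ x ∈ L, ∀ y ∈ L, ∃ n : ℤ, b x y = n := by
    intro x hx y hy
    obtain ⟨n1, h1⟩ := heven x hx
    obtain ⟨n2, h2⟩ := heven y hy
    obtain ⟨n3, h3⟩ := heven _ (L.add_mem hx hy)
    refine ⟨n3 - n1 - n2, ?_⟩
    simp only [map_add, LinearMap.add_apply, hsymm y x] at h3
    push_cast; linarith
  obtain ⟨n, hn, v, hv'⟩ : ∃ n, n = Module.finrank ℚ V ∧ ∃ v : Module.Basis (Fin n) ℚ V,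
      ∀ i j, i ≠ j → b (v i) (v j) = 0 := by
    obtain ⟨v, hv⟩ := LinearMap.BilinForm.exists_orthogonal_basis (B := b)
      (⟨fun x y => hsymm x y⟩)
    exact ⟨_, rfl, v, fun i j hij => hv hij⟩
  rw [← hn]
  choose N hN hNL using fun i => hfull (v i)
  set w : Fin n → V := fun i => N i • v i with hw
  have hwL : ∀ i, w i ∈ L := hNL
  have hw0 : ∀ i, w i ≠ 0 := fun i h => by
    rw [hw] at h
    simp only at h
    rw [← Int.cast_smul_eq_zsmul ℚ] at h
    rcases smul_eq_zero.1 h with h | h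
    · exact hN i (by exact_mod_cast h)
    · exact v.ne_zero i h
  have hwo : ∀ i j, i ≠ j → b (w i) (w j) = 0 := by
    intro i j hij
    simp [hw, hv' i j hij]
  have : ∀ i, ∃ a : ℕ, 0 < a ∧ b (w i) (w i) = 2 * a := by
    intro i
    obtain ⟨z, hz⟩ := heven _ (hwL i)
    have h1 := hpos _ (hw0 i)
    rw [hz] at h1
    have h2 : 0 < z := by
      have : (0 : ℚ) < z := by linarith
      exact_mod_cast this
    refine ⟨z.toNat, by omega, ?_⟩
    rw [hz]
    have : ((z.toNat : ℤ) : ℚ) = z := by rw [Int.toNat_of_nonneg h2.le]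
    rw [← this, Int.cast_natCast]
  choose a ha hwa using this
  have haQ : ∀ i, (a i : ℚ) ≠ 0 := fun i => by exact_mod_cast (ha i).ne'
  have instN : ∀ i, NeZero (2 * a i) := fun i => ⟨by have := ha i; omega⟩
  set d : Fin n → V := fun i => (1 / (2 * a i) : ℚ) • w i with hd
  have hdw : ∀ i, w i = ((2 * a i : ℕ) : ℤ) • d i := by
    intro i
    rw [hd]
    simp only
    rw [← Int.cast_smul_eq_zsmul ℚ, smul_smul]
    have := haQ i
    push_cast
    rw [mul_one_div_cancel (by simpa using this), one_smul]
  have hdi : ∀ i j, b (d i) (w j) = if i = j then 1 else 0 := by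
    intro i j
    have := haQ i
    split_ifs with h
    · subst h
      simp only [hd, map_smul, LinearMap.smul_apply, hwa, smul_eq_mul]
      field_simp
    · simp [hd, hwo i j h]
  let φ : (Fin n → ℤ) →+ V :=
    { toFun := fun k => ∑ i, k i • d i
      map_zero' := by simp
      map_add' := by intro k l; simp [add_smul, Finset.sum_add_distrib] }
  have hφ : ∀ k, φ k = ∑ i, k i • d i := fun k => rfl
  have hφw : ∀ k j, b (φ k) (w j) = k j := by
    intro k j
    rw [hφ]
    simp [map_sum, LinearMap.sum_apply, hdi]
  have hexp : ∀ x, (∀ y ∈ L, ∃ n : ℤ, b x y = n) → ∃ k, φ k = x := by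
    intro x hx
    choose k hk using fun i => hx (w i) (hwL i)
    refine ⟨k, ?_⟩
    have h0 : ∀ i, b (φ k - x) (v i) = 0 := by
      intro i
      have h1 : b (φ k - x) (w i) = 0 := by
        rw [map_sub, LinearMap.sub_apply, hφw, hk, sub_self]
      simp only [hw, map_zsmul, smul_eq_zero] at h1
      exact h1.resolve_left (hN i)
    have h1 : b (φ k - x) = 0 := v.ext (by simpa using h0)
    by_contra hne
    have := hpos _ (sub_ne_zero.2 hne)
    rw [h1] at this; simp at this
  let ρ : (Fin n → ℤ) →+ (∀ i, ZMod (2 * a i)) :=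
    { toFun := fun k i => (k i : ZMod (2 * a i))
      map_zero' := by ext; simp
      map_add' := by intro k l; ext; simp }
  have hρ : ∀ k i, ρ k i = (k i : ZMod (2 * a i)) := fun k i => rfl
  have hρs : Function.Surjective ρ := by
    intro x
    choose k hk using fun i => ZMod.intCast_surjective (x i)
    exact ⟨k, funext hk⟩
  let f : (∀ i, ZMod (2 * a i)) → ℂ := fun x => ∏ i, gz (2 * a i) (x i)
  have hf : ∀ k, f (ρ k) = FF b (φ k) := by
    intro k
    rw [hφ, FF_sum b hsymm]
    · refine Finset.prod_congr rfl fun i _ => ?_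
      rw [hρ, gz_intCast _ (ha i)]
      unfold FF
      congr 1
      have : b (k i • d i) (k i • d i) = (k i : ℚ) ^ 2 / (2 * a i) := by
        have h1 : b (d i) (d i) = 1 / (2 * a i) := by
          have := hdi i i
          rw [if_pos rfl] at this
          conv_lhs => rw [show d i = (1 / (2 * a i) : ℚ) • w i from rfl]
          rw [hsymm, show b ((1 / (2 * a i) : ℚ) • w i) (d i)  = (1 / (2 * a i) : ℚ) • b (w i) (d i)
            by simp, hsymm, this]
          simp
        simp only [map_zsmul, LinearMap.smul_apply, h1]
        simp
        ring
      rw [this]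
      push_cast
      ring
    · intro i j hij
      refine ⟨0, ?_⟩
      simp [hd, hwo i j hij]
  have hf0 : ∀ x, f x ≠ 0 := by
    intro x
    exact Finset.prod_ne_zero_iff.2 fun i _ => Complex.exp_ne_zero _
  let H : AddSubgroup (∀ i, ZMod (2 * a i)) := (L.toAddSubgroup.comap φ).map ρ
  have hH : ∀ k, ρ k ∈ H ↔ φ k ∈ L := by
    intro k
    constructor
    · rintro ⟨l, hl, hlk⟩
      have hl' : φ l ∈ L := hl
      have : φ k = φ l + φ (k - l) := by rw [← map_add]; simp
      rw [this]
      refine L.add_mem hl' ?_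
      rw [hφ]
      refine L.sum_mem fun i _ => ?_
      have h1 : ((k - l) i : ZMod (2 * a i)) = 0 := by
        have := congrFun hlk i
        rw [hρ, hρ] at this
        simp [this]
      rw [ZMod.intCast_zmod_eq_zero_iff_dvd] at h1
      obtain ⟨q, hq⟩ := h1
      rw [hq, mul_comm, mul_smul, ← hdw]
      exact L.smul_mem _ (hwL i)
    · intro h
      exact ⟨k, h, rfl⟩
  have hFL : ∀ x ∈ L, FF b x = 1 := by
    intro x hx
    obtain ⟨n, hn⟩ := heven x hx
    unfold FF
    rw [hn, Complex.exp_eq_one_iff]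
    exact ⟨n, by push_cast; ring⟩
  have hbil : ∀ x, ∀ h ∈ H, ∀ h' ∈ H, f (x + (h + h')) * f x = f (x + h) * f (x + h') := by
    intro x h hh h' hh'
    obtain ⟨k, rfl⟩ := hρs x
    obtain ⟨l, rfl⟩ := hρs h
    obtain ⟨l', rfl⟩ := hρs h'
    rw [hH] at hh hh'
    simp only [← map_add, hf]
    simp only [map_add]
    rw [FF_add b hsymm (φ k) (φ l + φ l'), FF_add b hsymm (φ k) (φ l), FF_add b hsymm (φ k) (φ l'), hFL _ hh, hFL _ hh',
      hFL _ (L.add_mem hh hh')]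
    simp only [map_add]
    push_cast
    rw [mul_add, Complex.exp_add]
    ring
  have hcond : ∀ k, (∀ h ∈ H, f (ρ k + h) = f (ρ k)) ↔ ∀ y ∈ L, ∃ n : ℤ, b (φ k) y = n := by
    intro k
    have key : ∀ l, φ l ∈ L → (f (ρ k + ρ l) = f (ρ k) ↔ ∃ n : ℤ, b (φ k) (φ l) = n) := by
      intro l hl
      rw [← map_add, hf, hf, map_add, FF_add b hsymm, hFL _ hl, mul_one, ← exp_int_eq_one_iff]
      exact mul_eq_left₀ (Complex.exp_ne_zero _)
    constructor
    · intro h y hy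
      obtain ⟨l, rfl⟩ := hexp y (hint y hy)
      exact (key l hy).1 (h _ ((hH l).2 hy))
    · intro h x hx
      obtain ⟨l, rfl⟩ := hρs x
      exact (key l ((hH l).1 hx)).2 (h _ ((hH l).1 hx))
  choose ε hε using fun i => hexp (e i) (he i)
  let S : (Fin m → Fin 3) → (Fin n → ℤ) := fun c => ∑ i, ((c i : ℕ) : ℤ) • ε i
  have hS : ∀ c, φ (S c) = ∑ i, ((c i : ℕ) : ℤ) • e i := by
    intro c
    simp only [S, map_sum, map_zsmul, hε]
  obtain ⟨κ, hκ, hsum⟩ := sum_reduce' f hf0 H hbil (fun c => ρ (S c)) (by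
      intro c
      rw [hcond]
      intro y hy
      rw [hS]
      choose q hq using fun i => he i y hy
      refine ⟨∑ i, ((c i : ℕ) : ℤ) * q i, ?_⟩
      simp [map_sum, LinearMap.sum_apply, hq]) (by
      intro c c' hcc
      rw [← map_sub, hH, map_sub, hS, hS, ← Finset.sum_sub_distrib] at hcc
      simp only [← sub_smul] at hcc
      have := hind _ hcc
      ext i
      have h1 := this i
      have h2 := (c i).2
      have h3 := (c' i).2
      omega) (by
      intro x hx
      obtain ⟨k, rfl⟩ := hρs x
      obtain ⟨c, hc⟩ := hgen _ ((hcond k).1 hx)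
      refine ⟨fun i => ⟨(c i % 3).toNat, by omega⟩, ?_⟩
      rw [← map_sub, hH, map_sub, hS]
      simp only
      have : φ k - ∑ i, (((c i % 3).toNat : ℕ) : ℤ) • e i = (φ k - ∑ i, c i • e i) +
          ∑ i, (c i / 3) • ((3 : ℤ) • e i) := by
        rw [sub_add, ← Finset.sum_sub_distrib]
        congr 1
        refine Finset.sum_congr rfl fun i _ => ?_
        rw [smul_smul, ← sub_smul]
        congr 1
        omega
      rw [this]
      exact L.add_mem hc (L.sum_mem fun i _ => L.smul_mem _ (h3 i)))
  -- the left sum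
  choose s hs hsgz using fun i => gz_sum (a i) (ha i)
  have hleft : ∑ x, f x = ((∏ i, s i : ℝ) : ℂ) * cexp (Real.pi * I * n / 4) := by
    have : ∑ x, f x = ∏ i, ∑ k : ZMod (2 * a i), gz (2 * a i) k := by
      rw [Finset.prod_univ_sum, Fintype.piFinset_univ]
    rw [this, Finset.prod_congr rfl (fun i _ => hsgz i), Finset.prod_mul_distrib]
    rw [Finset.prod_const, Finset.card_univ, Fintype.card_fin, ← Complex.exp_nat_mul]
    push_cast
    congr 2
    ring
  have hright : ∑ c : Fin m → Fin 3, f (ρ (S c)) =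
      ((√3 ^ m : ℝ) : ℂ) * cexp (Real.pi * I * r * m / 2) := by
    have h1 : ∀ c : Fin m → Fin 3, f (ρ (S c)) =
        ∏ i, cexp (Real.pi * I * (2 * r / 3) * ((c i : ℕ) : ℂ) ^ 2) := by
      intro c
      rw [hf, hS, FF_sum b hsymm]
      · refine Finset.prod_congr rfl fun i _ => ?_
        unfold FF
        obtain ⟨q, hq⟩ := hsq i
        rw [Complex.exp_eq_exp_iff_exists_int]
        refine ⟨q * (c i : ℕ) ^ 2, ?_⟩
        simp only [map_zsmul, LinearMap.smul_apply, hq]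
        simp
        ring
      · intro i j hij
        obtain ⟨q, hq⟩ := hortho i j hij
        refine ⟨(c i : ℕ) * ((c j : ℕ) * q), ?_⟩
        simp only [map_zsmul, LinearMap.smul_apply, hq]
        simp
        ring
    rw [Finset.sum_congr rfl (fun c _ => h1 c)]
    have := Finset.prod_univ_sum (fun _ : Fin m => (Finset.univ : Finset (Fin 3)))
      (fun _ c => cexp (Real.pi * I * (2 * r / 3) * ((c : ℕ) : ℂ) ^ 2))
    rw [Fintype.piFinset_univ] at this
    rw [← this, gauss_three r hr, Finset.prod_const, Finset.card_univ, Fintype.card_fin, mul_pow,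
      ← Complex.exp_nat_mul]
    push_cast
    congr 2
    ring
  rw [hleft, hright, ← mul_assoc] at hsum
  have hA : (0 : ℝ) < ∏ i, s i := Finset.prod_pos fun i _ => hs i
  have hB : (0 : ℝ) < κ * √3 ^ m := by positivity
  have hn1 : ‖cexp (Real.pi * I * n / 4)‖ = 1 := by
    rw [show (Real.pi * I * n / 4 : ℂ) = ((Real.pi * n / 4 : ℝ) : ℂ) * I by push_cast; ring]
    exact Complex.norm_exp_ofReal_mul_I _
  have hn2 : ‖cexp (Real.pi * I * r * m / 2)‖ = 1 := by
    rw [show (Real.pi * I * r * m / 2 : ℂ) = ((Real.pi * r * m / 2 : ℝ) : ℂ) * I by push_cast; ring]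
    exact Complex.norm_exp_ofReal_mul_I _
  have hsum' : ((∏ i, s i : ℝ) : ℂ) * cexp (Real.pi * I * n / 4) =
      ((κ * √3 ^ m : ℝ) : ℂ) * cexp (Real.pi * I * r * m / 2) := by
    rw [hsum]; push_cast; ring
  have hAB : (∏ i, s i : ℝ) = κ * √3 ^ m := by
    have := congrArg norm hsum'
    rw [norm_mul, norm_mul, hn1, hn2, mul_one, mul_one, Complex.norm_of_nonneg hA.le,
      Complex.norm_of_nonneg hB.le] at this
    exact this
  rw [hAB] at hsum'
  have hfin := mul_left_cancel₀ (by exact_mod_cast hB.ne') hsum'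
  rw [Complex.exp_eq_exp_iff_exists_int] at hfin
  obtain ⟨j, hj⟩ := hfin
  have hpi : (Real.pi : ℂ) ≠ 0 := by exact_mod_cast Real.pi_ne_zero
  have hj' : (n : ℂ) = 2 * m * r + 8 * j := by
    have h0 : (Real.pi * I : ℂ) ≠ 0 := mul_ne_zero hpi I_ne_zero
    apply mul_left_cancel₀ h0
    linear_combination 4 * hj
  have hj2 : (n : ℤ) = 2 * m * r + 8 * j := by exact_mod_cast hj'
  rw [hj2]
  exact (Int.modEq_iff_dvd.2 ⟨j, by ring⟩)

end blij

end helpers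

lemma dual_dual {V : Type*} [AddCommGroup V] [Module ℚ V] [FiniteDimensional ℚ V]
    (B : V →ₗ[ℚ] V →ₗ[ℚ] ℚ) (hsymm : ∀ x y, B x y = B y x)
    (hnd : ∀ x : V, (∀ y, B x y = 0) → x = 0)
    (T : Submodule ℤ V) (hfg : T.FG)
    (hspan : Submodule.span ℚ (T : Set V) = ⊤) (x : V)
    (hx : ∀ y ∈ dualLat B T, ∃ n : ℤ, B x y = n) : x ∈ T := by
  classical
  have : Module.Finite ℤ T := Module.Finite.iff_fg.2 hfg
  have : Module.IsTorsionFree ℤ V := Module.IsTorsionFree.trans_faithfulSMul ℤ ℚ V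
  have : Module.Free ℤ T := inferInstance
  let bT := Module.Free.chooseBasis ℤ T
  have hli : LinearIndependent ℤ (fun i => (bT i : V)) :=
    bT.linearIndependent.map' T.subtype (by simp)
  have hliQ : LinearIndependent ℚ (fun i => (bT i : V)) :=
    (LinearIndependent.iff_fractionRing ℤ ℚ).1 hli
  have hspT : Submodule.span ℤ (Set.range fun i => (bT i : V)) = T := by
    have := congrArg (Submodule.map T.subtype) bT.span_eq
    rw [Submodule.map_span, Submodule.map_top, Submodule.range_subtype, ← Set.range_comp] at this
    exact this
  have hsp : ⊤ ≤ Submodule.span ℚ (Set.range fun i => (bT i : V)) := by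
    rw [← hspan, Submodule.span_le]
    intro y hy
    rw [← hspT] at hy
    exact Submodule.span_subset_span ℤ ℚ _ hy
  let bV := Module.Basis.mk hliQ hsp
  have hbV : Submodule.span ℤ (Set.range bV) = T := by
    rw [Module.Basis.coe_mk, hspT]
  have hBs : LinearMap.BilinForm.IsSymm B := ⟨fun x y => hsymm x y⟩
  have hBn : LinearMap.BilinForm.Nondegenerate B := by
    refine ⟨fun x h => hnd x h, fun x h => hnd x fun y => ?_⟩
    rw [hsymm]; exact h y
  have hdd := LinearMap.BilinForm.dualSubmodule_dualSubmodule_of_basis (R := ℤ) B hBn hBs bV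
  rw [hbV] at hdd
  rw [← hdd]
  intro y hy
  obtain ⟨k, hk⟩ := hx y (by
    intro z hz
    obtain ⟨k, hk⟩ := Submodule.mem_one.1 (hy z hz)
    exact ⟨k, by simpa using hk.symm⟩)
  exact Submodule.mem_one.2 ⟨k, by simpa using hk.symm⟩

/-- a negative definite even lattice `T` with 3-elementary discriminant
group has a finite index sublattice `T' ≅ T̄^♯(3)` for an even lattice `T̄` (form
`B̄ = B/3`) whose discriminant form is `⟨(2/3)r⟩^m`, with `r = ±1`, `m ≤ 2` and
`2mr ≡ σ(T) (mod 8)`; here `σ(T) = −rank T` since `T` is negative definite. -/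
theorem three_elementary_sublattice
    {V : Type*} [AddCommGroup V] [Module ℚ V] [FiniteDimensional ℚ V]
    (B : V →ₗ[ℚ] V →ₗ[ℚ] ℚ) (hsymm : ∀ x y, B x y = B y x)
    (hnd : ∀ x : V, (∀ y, B x y = 0) → x = 0)
    (T : Submodule ℤ V) (hfg : T.FG)
    (hspan : Submodule.span ℚ (T : Set V) = ⊤)
    (hint : ∀ x ∈ T, ∀ y ∈ T, ∃ n : ℤ, B x y = (n : ℚ))
    (heven : ∀ x ∈ T, ∃ n : ℤ, B x x = 2 * (n : ℚ))
    (hneg : ∀ x ∈ T, x ≠ 0 → B x x < 0)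
    (h3elem : ∀ x ∈ dualLat B T, (3 : ℤ) • x ∈ T) :
    ∃ T' : Submodule ℤ V, T' ≤ T ∧
      (∃ N : ℤ, N ≠ 0 ∧ ∀ x ∈ T, N • x ∈ T') ∧
      ∃ (Tbar : Submodule ℤ V) (r : ℤ) (m : ℕ) (e : Fin m → V),
        (r = 1 ∨ r = -1) ∧ m ≤ 2 ∧
        -- `T̄` is an integral even lattice with respect to `B̄ = B/3`:
        (∀ x ∈ Tbar, ∀ y ∈ Tbar, ∃ n : ℤ, B x y = 3 * (n : ℚ)) ∧
        (∀ x ∈ Tbar, ∃ n : ℤ, B x x = 3 * (2 * (n : ℚ))) ∧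
        -- `T' = T̄^♯(3)`: as a subgroup, `T'` is the `B̄`-dual of `T̄`
        -- (and its form, the restriction of `B = 3B̄`, is the dual form times 3):
        T' = dualLat ((3 : ℚ)⁻¹ • B) Tbar ∧
        -- the discriminant form of `T̄` is `⟨(2/3)r⟩^m`, generated by the classes of
        -- `e 1, …, e m`, mutually orthogonal of square `(2/3)r (mod 2ℤ)`:
        (∀ i, e i ∈ dualLat ((3 : ℚ)⁻¹ • B) Tbar) ∧
        (∀ i j, i ≠ j → ∃ n : ℤ, (3 : ℚ)⁻¹ * B (e i) (e j) = (n : ℚ)) ∧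
        (∀ i, ∃ n : ℤ, (3 : ℚ)⁻¹ * B (e i) (e i) = 2 * (r : ℚ) / 3 + 2 * (n : ℚ)) ∧
        (∀ x ∈ dualLat ((3 : ℚ)⁻¹ • B) Tbar,
          ∃ c : Fin m → ℤ, x - ∑ i, c i • e i ∈ Tbar) ∧
        (∀ c : Fin m → ℤ, (∑ i, c i • e i) ∈ Tbar → ∀ i, (3 : ℤ) ∣ c i) ∧
        (2 * (m : ℤ) * r) ≡ -(Module.finrank ℚ V : ℤ) [ZMOD 8] := by
  classical
  have hdmem : ∀ M : Submodule ℤ V, ∀ x, x ∈ dualLat ((3 : ℚ)⁻¹ • B) M ↔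
      ∀ y ∈ M, ∃ n : ℤ, B x y = 3 * n := by
    intro M x
    refine forall₂_congr fun y _ => exists_congr fun n => ?_
    simp only [LinearMap.smul_apply, smul_eq_mul]
    constructor <;> intro h <;> linarith
  have hzs : ∀ (k : ℤ) (x y : V), B (k • x) y = k * B x y := by
    intro k x y; simp
  have hzs' : ∀ (k : ℤ) (x y : V), B x (k • y) = k * B x y := by
    intro k x y; simp
  have hquad : ∀ x y, B (x + y) (x + y) = B x x + 2 * B x y + B y y := by
    intro x y
    simp only [map_add, LinearMap.add_apply, hsymm y x]; ring
  -- the class of admissible lattices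
  let P : Submodule ℤ V → Prop := fun M =>
    (∀ x ∈ dualLat B T, (3 : ℤ) • x ∈ M) ∧ M ≤ T ∧ ∀ x ∈ M, ∃ n : ℤ, B x x = 3 * (2 * (n : ℚ))
  have hP0 : P ((dualLat B T).map (LinearMap.lsmul ℤ V (3 : ℤ))) := by
    refine ⟨fun x hx => ⟨x, hx, rfl⟩, ?_, ?_⟩
    · rintro _ ⟨x, hx, rfl⟩
      exact h3elem x hx
    · rintro _ ⟨x, hx, rfl⟩
      have h1 : (3 : ℤ) • x ∈ T := h3elem x hx
      obtain ⟨n, hn⟩ := heven _ h1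
      obtain ⟨k, hk⟩ := hx _ h1
      rw [hzs, hzs'] at hn
      rw [hzs'] at hk
      have h2 : 3 * k = 2 * n := by
        have : (3 * k : ℚ) = 2 * n := by rw [← hk, ← hn]; push_cast; ring
        exact_mod_cast this
      obtain ⟨j, rfl⟩ : ∃ j, k = 2 * j := ⟨k / 2, by omega⟩
      refine ⟨j, ?_⟩
      simp only [LinearMap.lsmul_apply]
      rw [hzs, hzs', hk]
      push_cast; ring
  have hmax : ∃ M, P M ∧ ∀ M', P M' → M ≤ M' → M' ≤ M := by
    have : IsNoetherian ℤ T := isNoetherian_of_fg_of_noetherian T hfg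
    have hset := set_has_maximal_iff_noetherian.2 this
      {K : Submodule ℤ T | P (K.map T.subtype)} ⟨Submodule.comap T.subtype
        ((dualLat B T).map (LinearMap.lsmul ℤ V (3 : ℤ))), by
          rw [Set.mem_setOf_eq, Submodule.map_comap_subtype, inf_eq_right.2 hP0.2.1]; exact hP0⟩
    obtain ⟨K, hK, hKmax⟩ := hset
    refine ⟨_, hK, fun M' hM' hle => ?_⟩
    have hM'eq : Submodule.map T.subtype (Submodule.comap T.subtype M') = M' := by
      rw [Submodule.map_comap_subtype, inf_eq_right.2 hM'.2.1]
    have h1 : K ≤ Submodule.comap T.subtype M' := Submodule.map_le_iff_le_comap.1 hle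
    have h2 := hKmax (Submodule.comap T.subtype M') (by rw [Set.mem_setOf_eq, hM'eq]; exact hM')
    have h3 : K = Submodule.comap T.subtype M' := by
      by_contra hne; exact h2 (lt_of_le_of_ne h1 hne)
    rw [h3, hM'eq]
  obtain ⟨M, ⟨hM3, hMT, hMq⟩, hMmax⟩ := hmax
  have hMint : ∀ x ∈ M, ∀ y ∈ M, ∃ n : ℤ, B x y = 3 * (n : ℚ) := by
    intro x hx y hy
    obtain ⟨n1, h1⟩ := hMq x hx
    obtain ⟨n2, h2⟩ := hMq y hy
    obtain ⟨n3, h3⟩ := hMq _ (M.add_mem hx hy)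
    refine ⟨n3 - n1 - n2, ?_⟩
    rw [hquad] at h3
    push_cast; linarith
  have hT3M : ∀ x ∈ T, (3 : ℤ) • x ∈ M := fun x hx => hM3 x (hint x hx)
  set D := dualLat ((3 : ℚ)⁻¹ • B) M with hD
  have hDT : D ≤ T := by
    intro x hx
    rw [hD, hdmem] at hx
    refine dual_dual B hsymm hnd T hfg hspan x fun y hy => ?_
    obtain ⟨n, hn⟩ := hx _ (hM3 y hy)
    refine ⟨n, ?_⟩
    rw [hzs'] at hn
    push_cast at hn; linarith
  have hMD : M ≤ D := by
    intro x hx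
    rw [hD, hdmem]
    exact hMint x hx
  have hDpair : ∀ x ∈ D, ∀ y ∈ M, ∃ n : ℤ, B x y = 3 * n := fun x hx => (hdmem M x).1 hx
  -- anisotropy
  have haniso : ∀ x ∈ D, (∃ n : ℤ, B x x = 3 * (2 * (n : ℚ))) → x ∈ M := by
    rintro x hx ⟨n, hn⟩
    have hle : M ≤ M ⊔ Submodule.span ℤ {x} := le_sup_left
    refine hMmax (M ⊔ Submodule.span ℤ {x}) ⟨fun y hy => hle (hM3 y hy), ?_, ?_⟩ hle
      (le_sup_right (a := M) (Submodule.mem_span_singleton_self x))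
    · rw [sup_le_iff, Submodule.span_singleton_le_iff_mem]
      exact ⟨hMT, hDT hx⟩
    · intro y hy
      obtain ⟨t, ht, z, hz, rfl⟩ := Submodule.mem_sup.1 hy
      obtain ⟨k, rfl⟩ := Submodule.mem_span_singleton.1 hz
      obtain ⟨n1, h1⟩ := hMq t ht
      obtain ⟨n2, h2⟩ := hDpair x hx t ht
      refine ⟨n1 + k * n2 + k ^ 2 * n, ?_⟩
      rw [hquad, hzs', hzs, hzs', hn, h1, hsymm t x, h2]
      push_cast; ring
  -- squares of elements outside M
  have hunit : ∀ x ∈ D, x ∉ M → ∃ r : ℤ, (r = 1 ∨ r = -1) ∧ ∃ n : ℤ, B x x = 2 * (r + 3 * n) := by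
    intro x hx hxM
    obtain ⟨n, hn⟩ := heven x (hDT hx)
    have h3 : ¬ (3 : ℤ) ∣ n := by
      rintro ⟨j, rfl⟩
      exact hxM (haniso x hx ⟨j, by rw [hn]; push_cast; ring⟩)
    rcases (by omega : n % 3 = 1 ∨ n % 3 = 2) with h | h
    · refine ⟨1, Or.inl rfl, n / 3, ?_⟩
      have : n = 1 + 3 * (n / 3) := by omega
      rw [hn]; conv_lhs => rw [this]
      push_cast; ring
    · refine ⟨-1, Or.inr rfl, n / 3 + 1, ?_⟩
      have : n = -1 + 3 * (n / 3 + 1) := by omega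
      rw [hn]; conv_lhs => rw [this]
      push_cast; ring
  have hDint : ∀ x ∈ D, ∀ y ∈ D, ∃ n : ℤ, B x y = n := fun x hx y hy =>
    hint x (hDT hx) y (hDT hy)
  -- orthogonal elements outside M have the same square class
  have hsame : ∀ x ∈ D, ∀ y ∈ D, ∀ (r s n k l : ℤ), (r = 1 ∨ r = -1) → (s = 1 ∨ s = -1) →
      B x x = 2 * (r + 3 * n) → B y y = 2 * (s + 3 * k) → B x y = 3 * l → s = r := by
    intro x hx y hy r s n k l hr hs hxx hyy hxy
    by_contra hne
    have hs' : s = -r := by omega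
    have hmem : x + y ∈ M := by
      refine haniso _ (D.add_mem hx hy) ⟨n + k + l, ?_⟩
      rw [hquad, hxx, hyy, hxy, hs']
      push_cast; ring
    obtain ⟨j, hj⟩ := hDpair x hx _ hmem
    rw [map_add, hxx, hxy] at hj
    have : 2 * (r + 3 * n) + 3 * l = 3 * j := by exact_mod_cast hj
    omega
  -- projecting away from a vector
  have hproj : ∀ e ∈ D, ∀ (r n : ℤ), (r = 1 ∨ r = -1) → B e e = 2 * (r + 3 * n) → ∀ x ∈ D,
      ∃ c l : ℤ, B (x - c • e) e = 3 * l := by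
    intro e he r n hr hee x hx
    obtain ⟨q, hq⟩ := hDint x hx e he
    refine ⟨-r * q, if r = 1 then q + 2 * q * n else q - 2 * q * n, ?_⟩
    rw [map_sub, LinearMap.sub_apply, hzs, hq, hee]
    rcases hr with rfl | rfl
    · simp; ring
    · simp; ring
  -- the classification
  obtain ⟨r, m, e, hr, hm, heD, heo, hes, hgen⟩ : ∃ (r : ℤ) (m : ℕ) (e : Fin m → V),
      (r = 1 ∨ r = -1) ∧ m ≤ 2 ∧ (∀ i, e i ∈ D) ∧
      (∀ i j, i ≠ j → ∃ n : ℤ, B (e i) (e j) = 3 * n) ∧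
      (∀ i, ∃ n : ℤ, B (e i) (e i) = 2 * (r + 3 * n)) ∧
      (∀ x ∈ D, ∃ c : Fin m → ℤ, x - ∑ i, c i • e i ∈ M) := by
    by_cases h0 : D ≤ M
    · exact ⟨1, 0, Fin.elim0, Or.inl rfl, by omega, fun i => i.elim0, fun i => i.elim0,
        fun i => i.elim0, fun x hx => ⟨Fin.elim0, by simpa using h0 hx⟩⟩
    obtain ⟨e₁, he₁, he₁M⟩ := SetLike.not_le_iff_exists.1 h0
    obtain ⟨r, hr, n₁, hn₁⟩ := hunit e₁ he₁ he₁M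
    by_cases h1 : ∀ x ∈ D, (∃ l : ℤ, B x e₁ = 3 * l) → x ∈ M
    · refine ⟨r, 1, fun _ => e₁, hr, by omega, fun _ => he₁, ?_, fun _ => ⟨n₁, hn₁⟩, ?_⟩
      · intro i j hij; exact absurd (Subsingleton.elim i j) hij
      · intro x hx
        obtain ⟨c, l, hl⟩ := hproj e₁ he₁ r n₁ hr hn₁ x hx
        refine ⟨fun _ => c, ?_⟩
        simp only [Finset.univ_unique, Finset.sum_singleton]
        exact h1 _ (D.sub_mem hx (D.smul_mem c he₁)) ⟨l, hl⟩
    · push Not at h1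
      obtain ⟨e₂, he₂, ⟨l, hl⟩, he₂M⟩ := h1
      obtain ⟨s, hs, n₂, hn₂⟩ := hunit e₂ he₂ he₂M
      have hsr : s = r := hsame e₁ he₁ e₂ he₂ r s n₁ n₂ l hr hs hn₁ hn₂ (by rw [hsymm]; exact hl)
      subst hsr
      have h2 : ∀ x ∈ D, ∀ p q : ℤ, B x e₁ = 3 * p → B x e₂ = 3 * q → x ∈ M := by
        intro x hx p q hp hq
        by_contra hxM
        obtain ⟨t, ht, n₃, hn₃⟩ := hunit x hx hxM
        have htr : t = s := hsame e₁ he₁ x hx s t n₁ n₃ p hr ht hn₁ hn₃ (by rw [hsymm]; exact hp)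
        subst htr
        have hmem : e₁ + e₂ + x ∈ M := by
          refine haniso _ (D.add_mem (D.add_mem he₁ he₂) hx)
            ⟨t + n₁ + n₂ + n₃ + l + p + q, ?_⟩
          rw [hquad, hquad, hn₁, hn₂, hn₃, hsymm e₁ e₂, hl, map_add, LinearMap.add_apply,
            hsymm e₁ x, hsymm e₂ x, hp, hq]
          push_cast; ring
        obtain ⟨j, hj⟩ := hDpair e₁ he₁ _ hmem
        rw [map_add, map_add, hn₁, hsymm e₁ e₂, hl, hsymm e₁ x, hp] at hj
        have : 2 * (t + 3 * n₁) + 3 * l + 3 * p = 3 * j := by exact_mod_cast hj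
        omega
      refine ⟨s, 2, ![e₁, e₂], hs, le_rfl, ?_, ?_, ?_, ?_⟩
      · intro i; fin_cases i
        · exact he₁
        · exact he₂
      · intro i j hij
        fin_cases i <;> fin_cases j
        · exact absurd rfl hij
        · exact ⟨l, by simpa [hsymm e₁ e₂] using hl⟩
        · exact ⟨l, by simpa using hl⟩
        · exact absurd rfl hij
      · intro i; fin_cases i
        · exact ⟨n₁, hn₁⟩
        · exact ⟨n₂, hn₂⟩
      · intro x hx
        obtain ⟨c, p, hp⟩ := hproj e₁ he₁ s n₁ hr hn₁ x hx
        obtain ⟨c', q, hq⟩ := hproj e₂ he₂ s n₂ hs hn₂ x hx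
        refine ⟨![c, c'], ?_⟩
        simp only [Fin.sum_univ_two, Matrix.cons_val_zero, Matrix.cons_val_one]
        refine h2 _ (D.sub_mem hx (D.add_mem (D.smul_mem c he₁) (D.smul_mem c' he₂)))
          (p - c' * l) (q - c * l) ?_ ?_
        · rw [← sub_sub, map_sub, LinearMap.sub_apply, hp, hzs, hl]
          push_cast; ring
        · rw [add_comm, ← sub_sub, map_sub, LinearMap.sub_apply, hq, hzs, hsymm e₁ e₂, hl]
          push_cast; ring
  have hind : ∀ c : Fin m → ℤ, (∑ i, c i • e i) ∈ M → ∀ i, (3 : ℤ) ∣ c i := by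
    intro c hc i
    obtain ⟨j, hj⟩ := hDpair _ (heD i) _ hc
    have : ∀ k, ∃ n : ℤ, k ≠ i → B (e i) (e k) = 3 * n := by
      intro k
      by_cases hk : k = i
      · exact ⟨0, fun h => absurd hk h⟩
      · obtain ⟨n, hn⟩ := heo i k (Ne.symm hk)
        exact ⟨n, fun _ => hn⟩
    choose q hq using this
    obtain ⟨n, hn⟩ := hes i
    rw [map_sum, ← Finset.add_sum_erase _ _ (Finset.mem_univ i), hzs', hn] at hj
    have hrest : ∑ k ∈ Finset.univ.erase i, B (e i) (c k • e k) =
        3 * ((∑ k ∈ Finset.univ.erase i, c k * q k : ℤ) : ℚ) := by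
      push_cast
      rw [Finset.mul_sum]
      refine Finset.sum_congr rfl fun k hk => ?_
      rw [hzs', hq k (Finset.ne_of_mem_erase hk)]; ring
    rw [hrest] at hj
    have h4 : c i * (2 * (r + 3 * n)) + 3 * (∑ k ∈ Finset.univ.erase i, c k * q k) = 3 * j := by
      exact_mod_cast hj
    generalize (∑ k ∈ Finset.univ.erase i, c k * q k) = R at h4
    rcases hr with rfl | rfl
    · exact ⟨c i + 2 * (c i * n) + R - j, by linarith⟩
    · exact ⟨c i + j - 2 * (c i * n) - R, by linarith⟩
  refine ⟨D, hDT, ⟨3, by norm_num, fun x hx => hMD (hT3M x hx)⟩, M, r, m, e, hr, hm, hMint, hMq,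
    rfl, heD, ?_, ?_, hgen, hind, ?_⟩
  · intro i j hij
    obtain ⟨n, hn⟩ := heo i j hij
    exact ⟨n, by rw [hn]; ring⟩
  · intro i
    obtain ⟨n, hn⟩ := hes i
    exact ⟨n, by rw [hn]; ring⟩
  -- signature formula
  have hfull : ∀ x : V, ∃ N : ℤ, N ≠ 0 ∧ N • x ∈ T := by
    intro x
    have hx : x ∈ Submodule.span ℚ (T : Set V) := by rw [hspan]; trivial
    induction hx using Submodule.span_induction with
    | mem x h => exact ⟨1, one_ne_zero, by simpa using h⟩
    | zero => exact ⟨1, one_ne_zero, by simp⟩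
    | add x y _ _ hx hy =>
      obtain ⟨p, hp, hpx⟩ := hx
      obtain ⟨q, hq, hqy⟩ := hy
      refine ⟨p * q, mul_ne_zero hp hq, ?_⟩
      rw [smul_add]
      refine T.add_mem ?_ ?_
      · rw [mul_comm, mul_smul]; exact T.smul_mem _ hpx
      · rw [mul_smul]; exact T.smul_mem _ hqy
    | smul a x _ hx =>
      obtain ⟨p, hp, hpx⟩ := hx
      refine ⟨p * a.den, mul_ne_zero hp (by exact_mod_cast a.den_ne_zero), ?_⟩
      have : (p * (a.den : ℤ)) • a • x = a.num • p • x := by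
        rw [← Int.cast_smul_eq_zsmul ℚ, ← Int.cast_smul_eq_zsmul ℚ, ← Int.cast_smul_eq_zsmul ℚ,
          smul_smul, smul_smul]
        congr 1
        push_cast
        rw [mul_assoc, Rat.den_mul_eq_num]; ring
      rw [this]
      exact T.smul_mem _ hpx
  have hsig := van_der_blij (-((3 : ℚ)⁻¹ • B)) (by
      intro x y; simp [hsymm x y]) (by
      intro x hx
      obtain ⟨N, hN, hNx⟩ := hfull x
      have hNQ : (N : ℚ) ≠ 0 := by exact_mod_cast hN
      have hne : N • x ≠ 0 := by
        rw [← Int.cast_smul_eq_zsmul ℚ]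
        exact smul_ne_zero hNQ hx
      have h1 := hneg _ hNx hne
      rw [hzs, hzs', ← mul_assoc] at h1
      have h2 : 0 < (N : ℚ) * N := mul_self_pos.2 hNQ
      have h3 : B x x < 0 := by
        by_contra h; push Not at h
        have := mul_nonneg h2.le h
        linarith
      simp only [LinearMap.neg_apply, LinearMap.smul_apply, smul_eq_mul]
      linarith) M (by
      intro x
      obtain ⟨N, hN, hNx⟩ := hfull x
      exact ⟨3 * N, by omega, by rw [mul_smul]; exact hT3M _ hNx⟩) (by
      intro x hx
      obtain ⟨n, hn⟩ := hMq x hx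
      refine ⟨-n, ?_⟩
      simp only [LinearMap.neg_apply, LinearMap.smul_apply, smul_eq_mul, hn]
      push_cast; ring) (-r) (by omega) m e (by
      intro i y hy
      obtain ⟨n, hn⟩ := hDpair _ (heD i) y hy
      refine ⟨-n, ?_⟩
      simp only [LinearMap.neg_apply, LinearMap.smul_apply, smul_eq_mul, hn]
      push_cast; ring) (by
      intro i j hij
      obtain ⟨n, hn⟩ := heo i j hij
      refine ⟨-n, ?_⟩
      simp only [LinearMap.neg_apply, LinearMap.smul_apply, smul_eq_mul, hn]
      push_cast; ring) (by
      intro i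
      obtain ⟨n, hn⟩ := hes i
      refine ⟨-n, ?_⟩
      simp only [LinearMap.neg_apply, LinearMap.smul_apply, smul_eq_mul, hn]
      push_cast; ring) (fun i => hT3M _ (hDT (heD i))) (by
      intro x hx
      refine hgen x ?_
      rw [hD, hdmem]
      intro y hy
      obtain ⟨n, hn⟩ := hx y hy
      refine ⟨-n, ?_⟩
      simp only [LinearMap.neg_apply, LinearMap.smul_apply, smul_eq_mul] at hn
      push_cast; linarith) hind
  have := hsig.neg
  rw [show -(2 * (m : ℤ) * -r) = 2 * m * r by ring] at this
  exact this
end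

section
/- Let T be a negative definite even lattice such that: discr₂T is odd 2-elementary with Br(discr₂T) ≡ rank T (mod 8); discr₃T is 3-elementary; and discr_p T = 0 for all primes p > 3. Then T contains a finite index sublattice T' ≅ T̄(6) for some odd unimodular lattice T̄. -/
open scoped BigOperators

variable {V : Type*} [AddCommGroup V] [Module ℚ V]

/-- The `p`-primary part of the discriminant group, realized as the sublattice of
`T^♯` of vectors with `p`-power order modulo `T`. -/
def primaryPart (B : V →ₗ[ℚ] V →ₗ[ℚ] ℚ) (T : Submodule ℤ V) (p : ℤ) :
    Submodule ℤ V where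
  carrier := {x | x ∈ dualLat B T ∧ ∃ k : ℕ, p ^ k • x ∈ T}
  zero_mem' := ⟨(dualLat B T).zero_mem, 0, by simp⟩
  add_mem' := by
    rintro a b ⟨ha, k, hk⟩ ⟨hb, l, hl⟩
    refine ⟨(dualLat B T).add_mem ha hb, k + l, ?_⟩
    rw [smul_add]
    refine T.add_mem ?_ ?_
    · rw [pow_add, mul_comm, mul_smul]
      exact T.smul_mem _ hk
    · rw [pow_add, mul_smul]
      exact T.smul_mem _ hl
  smul_mem' := by
    rintro c x ⟨hx, k, hk⟩
    exact ⟨(dualLat B T).smul_mem c hx, k, by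
      rw [smul_comm]; exact T.smul_mem c hk⟩

/-- The 2-primary discriminant group `discr₂ T = (T^♯)₂ / T`. -/
abbrev discrTwo (B : V →ₗ[ℚ] V →ₗ[ℚ] ℚ) (T : Submodule ℤ V) :=
  (↥(primaryPart B T 2)) ⧸ (Submodule.comap (primaryPart B T 2).subtype T)

open Filter Topology in
theorem gs_feq (τ : ℂ) (h : 0 < τ.im) :
    jacobiTheta (-1/τ) = (-Complex.I * τ) ^ (1 / 2 : ℂ) * jacobiTheta τ := by
  have := jacobiTheta_S_smul ⟨τ, h⟩
  rw [UpperHalfPlane.modular_S_smul] at this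
  convert this using 2
  simp [neg_div, inv_neg]

theorem gs_mul_cpow (y : ℝ) (hy : 0 < y) (z : ℂ) (hz : z ≠ 0) :
    ((y:ℂ) * z) ^ (1/2 : ℂ) = (y:ℂ)^(1/2 : ℂ) * z ^ (1/2:ℂ) := by
  have hyC : (y:ℂ) ≠ 0 := by exact_mod_cast hy.ne'
  rw [Complex.cpow_def_of_ne_zero (mul_ne_zero hyC hz), Complex.cpow_def_of_ne_zero hyC,
    Complex.cpow_def_of_ne_zero hz, ← Complex.exp_add, Complex.log_ofReal_mul hy hz,
    Complex.ofReal_log hy.le]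
  ring_nf

theorem gs_add (N : ℕ) (hN : Even N) (τ : ℂ) : jacobiTheta (N + τ) = jacobiTheta τ := by
  obtain ⟨m, rfl⟩ := hN
  induction m with
  | zero => simp
  | succ k ih =>
    rw [← ih, ← jacobiTheta_two_add (((k + k : ℕ) : ℂ) + τ)]
    congr 1
    push_cast; ring

open Filter Topology in
theorem gs_split (N : ℕ) (hN : Even N) (hpos : 0 < N) (y : ℝ) (hy : 0 < y) :
    jacobiTheta (1/N + Complex.I / (N^2*y)) =
      (y:ℂ) ^ (1/2 : ℂ) * ∑ k ∈ Finset.range N,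
        Complex.exp (Real.pi * Complex.I * k^2 / N) *
          (HurwitzZeta.cosKernel (((k:ℝ)/N : ℝ) : UnitAddCircle) y : ℂ) := by
  have hNR : (0:ℝ) < N := by exact_mod_cast hpos
  have hNC : (N:ℂ) ≠ 0 := by exact_mod_cast hpos.ne'
  have hyC : (y:ℂ) ≠ 0 := by exact_mod_cast hy.ne'
  have : NeZero N := ⟨hpos.ne'⟩
  set τ : ℂ := 1/N + Complex.I / (N^2*y) with hτ
  have hτim : 0 < τ.im := by
    have : τ = ((1/N : ℝ) : ℂ) + ((1/(N^2*y) : ℝ):ℂ) * Complex.I := by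
      rw [hτ]; push_cast; ring
    rw [this, Complex.add_im, Complex.ofReal_im, Complex.im_ofReal_mul, Complex.I_im]
    positivity
  have hs : HasSum (fun n : ℤ => Complex.exp (Real.pi * Complex.I * (n : ℂ) ^ 2 * τ)) (jacobiTheta τ) := by
    have := hasSum_jacobiTheta₂_term 0 hτim
    rw [← jacobiTheta_eq_jacobiTheta₂] at this
    simpa [jacobiTheta₂_term] using this
  -- reindex
  have hk : ∀ k : Fin N, HasSum (fun n : ℤ => Complex.exp (Real.pi * Complex.I * ((n * N + k : ℤ) : ℂ) ^ 2 * τ))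
      (Complex.exp (Real.pi * Complex.I * k^2 / N) *
        ((y:ℂ) ^ (1/2 : ℂ) * (HurwitzZeta.cosKernel (((k:ℝ)/N : ℝ) : UnitAddCircle) y : ℂ))) := by
    intro k
    have h1 := HurwitzZeta.hasSum_int_evenKernel ((k:ℝ)/N) (t := 1/y) (by positivity)
    rw [HurwitzZeta.evenKernel_functional_equation, ← Complex.hasSum_ofReal] at h1
    have h2 := h1.mul_left (Complex.exp (Real.pi * Complex.I * k^2 / N))
    have e1 : ∀ n : ℤ, Complex.exp (Real.pi * Complex.I * k^2 / N) * ((Real.exp (-Real.pi * ((n:ℝ) + (k:ℝ) / N) ^ 2 * (1 / y)) : ℝ) : ℂ)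
        = Complex.exp (Real.pi * Complex.I * ((n * N + k : ℤ) : ℂ) ^ 2 * τ) := by
      intro n
      obtain ⟨m, hm⟩ := hN
      push_cast
      rw [← Complex.exp_add]
      symm
      rw [Complex.exp_eq_exp_iff_exists_int]
      refine ⟨n^2 * m + n * k, ?_⟩
      have hNm : (N:ℂ) = 2 * m := by rw [hm]; push_cast; ring
      have hm0 : (m:ℂ) ≠ 0 := by
        intro h; apply hNC; rw [hNm, h, mul_zero]
      rw [hτ, hNm]
      push_cast
      field_simp
      linear_combination ((n * 2 * m + k) ^ 2 : ℂ) * Complex.I_sq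
    simp_rw [e1] at h2
    convert! h2 using 2
    push_cast
    rw [show (1/y)= y⁻¹ by ring, Real.inv_rpow hy.le, Complex.ofReal_inv, one_div (_⁻¹), inv_inv, one_div (_⁻¹), inv_inv]
    rw [Complex.ofReal_cpow hy.le]; norm_num
  have hs2 := ((Equiv.prodComm _ _).trans (Int.divModEquiv N).symm).hasSum_iff.mpr hs
  have hs3 := HasSum.prod_fiberwise hs2 (g := fun k : Fin N => (Complex.exp (Real.pi * Complex.I * k^2 / N) *
        ((y:ℂ) ^ (1/2 : ℂ) * (HurwitzZeta.cosKernel (((k:ℝ)/N : ℝ) : UnitAddCircle) y : ℂ)))) (by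
    intro k
    convert! hk k using 3 with n
    )
  have hs4 := (hasSum_fintype _).unique hs3
  rw [← hs4, Finset.mul_sum, Finset.sum_range]
  apply Finset.sum_congr rfl
  intro k _
  ring

open Filter Topology in
theorem gs_cos (a : UnitAddCircle) : Tendsto (fun y : ℝ => (HurwitzZeta.cosKernel a y : ℂ)) atTop (𝓝 1) := by
  obtain ⟨p, hp, h⟩ := HurwitzZeta.isBigO_atTop_cosKernel_sub a
  have h0 : Tendsto (fun y : ℝ => Real.exp (-p * y)) atTop (𝓝 0) := by
    apply Real.tendsto_exp_atBot.comp
    exact tendsto_id.const_mul_atTop_of_neg (by linarith)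
  have h1 := (h.trans_tendsto h0).add_const 1
  simp only [sub_add_cancel, zero_add] at h1
  exact_mod_cast (Complex.continuous_ofReal.tendsto 1).comp h1

open Filter Topology in
theorem gauss_sum_pos (N : ℕ) (hN : Even N) (hpos : 0 < N) :
    (-Complex.I / N) ^ (1/2 : ℂ) * ∑ k ∈ Finset.range N, Complex.exp (Real.pi * Complex.I * k^2 / N) = 1 := by
  have hNR : (0:ℝ) < N := by exact_mod_cast hpos
  have hNC : (N:ℂ) ≠ 0 := by exact_mod_cast hpos.ne'
  have key : ∀ y : ℝ, 0 < y → (1 + Complex.I / (N * y)) ^ (1/2 : ℂ) * jacobiTheta (Complex.I * y - 1/N) =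
      (-Complex.I * (1/N + Complex.I / (N^2*y))) ^ (1/2:ℂ) * ∑ k ∈ Finset.range N,
        Complex.exp (Real.pi * Complex.I * k^2 / N) *
          (HurwitzZeta.cosKernel (((k:ℝ)/N : ℝ) : UnitAddCircle) y : ℂ) := by
    intro y hy
    have hyC : (y:ℂ) ≠ 0 := by exact_mod_cast hy.ne'
    have hy2 : (y:ℂ)^(1/2:ℂ) ≠ 0 := by
      rw [Ne, Complex.cpow_eq_zero_iff]; tauto
    have him : 0 < (Complex.I * y - 1/N).im := by
      have : (Complex.I * y - 1/N) = ((-1/N : ℝ):ℂ) + (y:ℂ) * Complex.I := by push_cast; ring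
      rw [this, Complex.add_im, Complex.ofReal_im, Complex.im_ofReal_mul, Complex.I_im]
      linarith
    have him2 : 0 < (1/N + Complex.I / (N^2*y)).im := by
      have : (1/N + Complex.I / (N^2*y)) = ((1/N : ℝ) : ℂ) + ((1/(N^2*y) : ℝ):ℂ) * Complex.I := by
        push_cast; ring
      rw [this, Complex.add_im, Complex.ofReal_im, Complex.im_ofReal_mul, Complex.I_im]
      positivity
    have f1 := gs_feq _ him
    have f2 := gs_feq _ him2
    have e : -1 / (Complex.I * y - 1/N) = N + -1 / (1/N + Complex.I / (N^2*y)) := by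
      have n1 : (Complex.I * y - 1/N : ℂ) ≠ 0 := by
        intro h; rw [h] at him; simp at him
      have n2 : (1/N + Complex.I / (N^2*y) : ℂ) ≠ 0 := by
        intro h; rw [h] at him2; simp at him2
      have n1' : (Complex.I * y * N - 1 : ℂ) ≠ 0 := by
        intro h; apply n1; field_simp; linear_combination h
      have n2' : (N * y + Complex.I : ℂ) ≠ 0 := by
        intro h; apply n2; field_simp; linear_combination h
      rw [show (Complex.I * y - 1/N : ℂ) = (Complex.I * y * N - 1)/N by field_simp,
        show (1/N + Complex.I / (N^2*y) : ℂ) = (N * y + Complex.I)/(N^2*y) by field_simp]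
      rw [div_div_eq_mul_div, div_div_eq_mul_div, eq_comm, ← sub_eq_zero]
      have e3 : (N:ℂ) + -1 * (N^2*y) / (N * y + Complex.I) = N * Complex.I / (N * y + Complex.I) := by
        field_simp; ring
      rw [e3, div_sub_div _ _ n2' n1', div_eq_zero_iff]
      left
      linear_combination (N^2 * y : ℂ) * Complex.I_sq
    rw [e, gs_add N hN, f2, gs_split N hN hpos y hy] at f1
    have e2 : (-Complex.I * (Complex.I * y - 1/N)) ^ (1/2 : ℂ) = (y:ℂ)^(1/2:ℂ) * (1 + Complex.I / (N * y)) ^ (1/2 : ℂ) := by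
      rw [show (-Complex.I * (Complex.I * y - 1/N)) = (y:ℂ) * (1 + Complex.I / (N * y)) by
        field_simp; linear_combination (-N*y:ℂ) * Complex.I_sq]
      apply gs_mul_cpow y hy
      intro h
      have := congrArg Complex.re h
      rw [show (1 + Complex.I / (N * y) : ℂ) = ((1:ℝ):ℂ) + ((1/(N*y) : ℝ):ℂ) * Complex.I by push_cast; ring,
        Complex.add_re, Complex.re_ofReal_mul, Complex.I_re, Complex.ofReal_re] at this
      simp at this
    rw [e2] at f1
    apply mul_left_cancel₀ hy2
    linear_combination -f1
  have hinv : Tendsto (fun y : ℝ => ((y:ℂ))⁻¹) atTop (𝓝 0) := by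
    have := (Complex.continuous_ofReal.tendsto 0).comp tendsto_inv_atTop_zero
    simpa [Function.comp_def] using this
  have L1 : Tendsto (fun y : ℝ => (1 + Complex.I / (N * y)) ^ (1/2 : ℂ)) atTop (𝓝 1) := by
    have : Tendsto (fun y : ℝ => (1 + Complex.I / N * (y:ℂ)⁻¹)) atTop (𝓝 (1 + Complex.I/N * 0)) :=
      (hinv.const_mul _).const_add _
    rw [mul_zero, add_zero] at this
    have h := this.cpow (tendsto_const_nhds (x := (1/2:ℂ))) (by simp)
    rw [Complex.one_cpow] at h
    refine h.congr fun y => ?_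
    congr 2; rw [div_mul_eq_div_div]; ring
  have L2 : Tendsto (fun y : ℝ => jacobiTheta (Complex.I * y - 1/N)) atTop (𝓝 1) := by
    have h := isBigO_at_im_infty_jacobiTheta_sub_one
    have h0 : Tendsto (fun τ : ℂ => Real.exp (-Real.pi * τ.im)) (comap Complex.im atTop) (𝓝 0) := by
      apply Real.tendsto_exp_atBot.comp
      exact tendsto_comap.const_mul_atTop_of_neg (by linarith [Real.pi_pos])
    have h1 := (h.trans_tendsto h0).add_const 1
    simp only [sub_add_cancel, zero_add] at h1
    apply h1.comp
    rw [tendsto_comap_iff]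
    refine tendsto_id.congr fun y => ?_
    have : (Complex.I * y - 1/N) = ((-1/N : ℝ):ℂ) + (y:ℂ) * Complex.I := by push_cast; ring
    rw [Function.comp, this, Complex.add_im, Complex.ofReal_im, Complex.im_ofReal_mul, Complex.I_im]
    simp
  have L3 : Tendsto (fun y : ℝ => (-Complex.I * (1/N + Complex.I / (N^2*y))) ^ (1/2:ℂ)) atTop
      (𝓝 ((-Complex.I / N) ^ (1/2 : ℂ))) := by
    have : Tendsto (fun y : ℝ => (-Complex.I * (1/N + Complex.I / N^2 * (y:ℂ)⁻¹))) atTop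
        (𝓝 (-Complex.I * (1/N + Complex.I / N^2 * 0))) :=
      ((hinv.const_mul _).const_add _).const_mul _
    rw [mul_zero, add_zero, mul_one_div] at this
    have h := this.cpow (tendsto_const_nhds (x := (1/2:ℂ))) (by
      right
      rw [show -Complex.I / N = ((-1/N:ℝ):ℂ) * Complex.I by push_cast; ring, Complex.im_ofReal_mul, Complex.I_im]
      have : (N:ℝ) ≠ 0 := hNR.ne'
      simp [this])
    refine h.congr fun y => ?_
    congr 3; rw [div_mul_eq_div_div]; ring
  have L4 : Tendsto (fun y : ℝ => ∑ k ∈ Finset.range N,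
        Complex.exp (Real.pi * Complex.I * k^2 / N) *
          (HurwitzZeta.cosKernel (((k:ℝ)/N : ℝ) : UnitAddCircle) y : ℂ)) atTop
      (𝓝 (∑ k ∈ Finset.range N, Complex.exp (Real.pi * Complex.I * k^2 / N))) := by
    apply tendsto_finsetSum
    intro k _
    simpa using (gs_cos _).const_mul (Complex.exp (Real.pi * Complex.I * k^2 / N))
  have A := L1.mul L2
  have B := L3.mul L4
  have A' := A.congr' (by
    filter_upwards [eventually_gt_atTop 0] with y hy
    exact key y hy)
  rw [tendsto_nhds_unique B A', mul_one]

/-- Phase of the quadratic Gauss sum with even modulus. -/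
theorem gauss_sum_neg (N : ℕ) (hN : Even N) (hpos : 0 < N) :
    ∃ c : ℝ, 0 < c ∧ ∑ k ∈ Finset.range N, Complex.exp (-(Real.pi * Complex.I * k^2 / N)) =
      c * Complex.exp (-(Real.pi * Complex.I / 4)) := by
  have hNR : (0:ℝ) < N := by exact_mod_cast hpos
  have hNC : (N:ℂ) ≠ 0 := by exact_mod_cast hpos.ne'
  have h := gauss_sum_pos N hN hpos
  have e : (-Complex.I / N) ^ (1/2 : ℂ) = ((1/N : ℝ)^(1/2:ℝ) : ℝ) * Complex.exp (-(Real.pi * Complex.I / 4)) := by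
    rw [show (-Complex.I / N) = ((1/N : ℝ) : ℂ) * (-Complex.I) by push_cast; ring,
      gs_mul_cpow _ (by positivity) _ (by simp), Complex.ofReal_cpow (by positivity)]
    congr 1
    · norm_num
    · rw [Complex.cpow_def_of_ne_zero (by simp), Complex.log_neg_I]
      ring_nf
  have hc : 0 < (1/N : ℝ)^(1/2:ℝ) := by positivity
  set c := (1/N : ℝ)^(1/2:ℝ)
  have hcC : (c:ℂ) ≠ 0 := by exact_mod_cast hc.ne'
  refine ⟨c⁻¹, by positivity, ?_⟩
  rw [e] at h
  have h2 := congrArg (starRingEnd ℂ) h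
  simp only [map_mul, map_sum, map_one, Complex.conj_ofReal, ← Complex.exp_conj, map_neg, map_div₀, Complex.conj_I,
    map_pow, Complex.conj_natCast, map_ofNat] at h2
  have e5 : ∀ k : ℕ, (Real.pi * -Complex.I * k^2 / N : ℂ) = (-(Real.pi * Complex.I * k^2 / N)) := by
    intro k; ring
  simp only [e5] at h2
  have e6 : Complex.exp (-(Real.pi * Complex.I / 4)) * Complex.exp (-(Real.pi * -Complex.I / 4)) = 1 := by
    rw [← Complex.exp_add, ← Complex.exp_zero]; congr 1; ring
  set S := ∑ k ∈ Finset.range N, Complex.exp (-(Real.pi * Complex.I * k^2 / N))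
  push_cast
  field_simp
  linear_combination (Complex.exp (-(Real.pi * Complex.I / 4))) * h2 - c * S * e6

/-- `s` is a complete system of representatives of `P` modulo `A`. -/
def IsReps (P A : Submodule ℤ V) (s : Finset V) : Prop :=
  (∀ x ∈ s, x ∈ P) ∧ (∀ x ∈ P, ∃ r ∈ s, x - r ∈ A) ∧ (∀ r ∈ s, ∀ r' ∈ s, r - r' ∈ A → r = r')

theorem IsReps.sum_eq {P A : Submodule ℤ V} {s s' : Finset V} (h : IsReps P A s)
    (h' : IsReps P A s') (f : V → ℂ) (hf : ∀ x ∈ P, ∀ a ∈ A, f (x + a) = f x) :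
    ∑ x ∈ s, f x = ∑ x ∈ s', f x := by
  have H : ∀ r ∈ s, ∃ r' ∈ s', r - r' ∈ A := fun r hr => h'.2.1 r (h.1 r hr)
  choose! g hg1 hg2 using H
  refine Finset.sum_bij (fun r _ => g r) hg1 ?_ ?_ ?_
  · intro r hr r' hr' e
    apply h.2.2 r hr r' hr'
    have := A.sub_mem (hg2 r hr) (hg2 r' hr')
    simp only [e] at this
    simpa using this
  · intro b hb
    obtain ⟨r, hr, hrb⟩ := h.2.1 b (h'.1 b hb)
    refine ⟨r, hr, ?_⟩
    apply h'.2.2 _ (hg1 r hr) b hb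
    have := A.neg_mem (A.add_mem hrb (hg2 r hr))
    convert this using 1; abel
  · intro r hr
    have := hf (g r) (h'.1 _ (hg1 r hr)) _ (hg2 r hr)
    rw [← this]; congr 1; abel

open Classical in
theorem IsReps.shift {P A : Submodule ℤ V} {s : Finset V} (h : IsReps P A s)
    (f : V → ℂ) (hf : ∀ x ∈ P, ∀ a ∈ A, f (x + a) = f x) (p : V) (hp : p ∈ P) :
    ∑ x ∈ s, f (x + p) = ∑ x ∈ s, f x := by
  have h2 : IsReps P A (s.image (· + p)) := by
    refine ⟨?_, ?_, ?_⟩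
    · intro x hx
      obtain ⟨r, hr, rfl⟩ := Finset.mem_image.1 hx
      exact P.add_mem (h.1 r hr) hp
    · intro x hx
      obtain ⟨r, hr, hxr⟩ := h.2.1 (x - p) (P.sub_mem hx hp)
      refine ⟨r + p, Finset.mem_image_of_mem _ hr, ?_⟩
      convert hxr using 1; abel
    · intro x hx y hy hxy
      obtain ⟨r, hr, rfl⟩ := Finset.mem_image.1 hx
      obtain ⟨r', hr', rfl⟩ := Finset.mem_image.1 hy
      have := h.2.2 r hr r' hr' (by convert hxy using 1; simp)
      rw [this]
  rw [← h2.sum_eq h f hf, Finset.sum_image]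
  intro a _ b _ e
  exact add_right_cancel e

open Classical in
theorem IsReps.filter {P A M : Submodule ℤ V} {s : Finset V} (h : IsReps P A s)
    (hAM : A ≤ M) (hMP : M ≤ P) : IsReps M A (s.filter (· ∈ M)) := by
  refine ⟨fun x hx => (Finset.mem_filter.1 hx).2, ?_, ?_⟩
  · intro x hx
    obtain ⟨r, hr, hxr⟩ := h.2.1 x (hMP hx)
    refine ⟨r, Finset.mem_filter.2 ⟨hr, ?_⟩, hxr⟩
    have := M.sub_mem hx (hAM hxr)
    simpa using this
  · intro r hr r' hr'
    exact h.2.2 r (Finset.mem_filter.1 hr).1 r' (Finset.mem_filter.1 hr').1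

open Classical in
/-- a finite cover contains a system of representatives -/
theorem exists_isReps {P M : Submodule ℤ V} (hMP : M ≤ P) (s : Finset V)
    (hs : ∀ x ∈ s, x ∈ P) (hc : ∀ x ∈ P, ∃ r ∈ s, x - r ∈ M) : ∃ u, IsReps P M u := by
  have key : ∀ x : V, x - (Submodule.Quotient.mk (p := M) x).out ∈ M := by
    intro x
    rw [← Submodule.Quotient.eq]
    exact (Quotient.out_eq _).symm
  refine ⟨s.image (fun x => (Submodule.Quotient.mk (p := M) x).out), ?_, ?_, ?_⟩
  · intro x hx
    obtain ⟨r, hr, rfl⟩ := Finset.mem_image.1 hx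
    have := P.sub_mem (hs r hr) (hMP (key r))
    simpa using this
  · intro x hx
    obtain ⟨r, hr, hxr⟩ := hc x hx
    refine ⟨_, Finset.mem_image_of_mem _ hr, ?_⟩
    have := M.add_mem hxr (key r)
    simpa using this
  · intro x hx y hy hxy
    obtain ⟨r, hr, rfl⟩ := Finset.mem_image.1 hx
    obtain ⟨r', hr', rfl⟩ := Finset.mem_image.1 hy
    have h1 := (Submodule.Quotient.eq M).2 hxy
    have h2 : ∀ q : V ⧸ M, (Submodule.Quotient.mk (p := M) q.out) = q := fun q => Quotient.out_eq q
    rw [h2, h2] at h1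
    rw [h1]

open Classical in
theorem IsReps.mul {P M A : Submodule ℤ V} {s t : Finset V} (hs : IsReps P M s)
    (ht : IsReps M A t) (hAM : A ≤ M) (hMP : M ≤ P) :
    IsReps P A ((s ×ˢ t).image (fun z => z.1 + z.2)) ∧
      Set.InjOn (fun z : V × V => z.1 + z.2) (s ×ˢ t : Finset (V × V)) := by
  have key : ∀ a ∈ s, ∀ b ∈ t, ∀ a' ∈ s, ∀ b' ∈ t, (a + b) - (a' + b') ∈ A → a = a' ∧ b = b' := by
    intro a ha b hb a' ha' b' hb' h
    have h1 : a = a' := by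
      apply hs.2.2 a ha a' ha'
      have := M.sub_mem (hAM h) (M.sub_mem (ht.1 b hb) (ht.1 b' hb'))
      convert this using 1; abel
    subst h1
    refine ⟨rfl, ht.2.2 b hb b' hb' ?_⟩
    convert h using 1; abel
  refine ⟨⟨?_, ?_, ?_⟩, ?_⟩
  · intro x hx
    obtain ⟨⟨a, b⟩, hab, rfl⟩ := Finset.mem_image.1 hx
    rw [Finset.mem_product] at hab
    exact P.add_mem (hs.1 _ hab.1) (hMP (ht.1 _ hab.2))
  · intro x hx
    obtain ⟨a, ha, hxa⟩ := hs.2.1 x hx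
    obtain ⟨b, hb, hxb⟩ := ht.2.1 _ hxa
    refine ⟨a + b, Finset.mem_image.2 ⟨(a, b), Finset.mem_product.2 ⟨ha, hb⟩, rfl⟩, ?_⟩
    convert hxb using 1; abel
  · intro x hx y hy hxy
    obtain ⟨⟨a, b⟩, hab, rfl⟩ := Finset.mem_image.1 hx
    obtain ⟨⟨a', b'⟩, hab', rfl⟩ := Finset.mem_image.1 hy
    rw [Finset.mem_product] at hab hab'
    obtain ⟨h1, h2⟩ := key a hab.1 b hab.2 a' hab'.1 b' hab'.2 hxy
    rw [h1, h2]
  · rintro ⟨a, b⟩ hab ⟨a', b'⟩ hab' h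
    rw [Finset.mem_coe, Finset.mem_product] at hab hab'
    obtain ⟨h1, h2⟩ := key a hab.1 b hab.2 a' hab'.1 b' hab'.2 (by
      simp only at h
      rw [h, sub_self]; exact A.zero_mem)
    rw [h1, h2]

/-- the quadratic character -/
noncomputable def qchar (C : V →ₗ[ℚ] V →ₗ[ℚ] ℚ) (x : V) : ℂ :=
  Complex.exp (Real.pi * Complex.I * ((C x x : ℚ) : ℂ))

/-- the bilinear character -/
noncomputable def bchar (C : V →ₗ[ℚ] V →ₗ[ℚ] ℚ) (x y : V) : ℂ :=
  Complex.exp (2 * Real.pi * Complex.I * ((C x y : ℚ) : ℂ))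

theorem qchar_add (C : V →ₗ[ℚ] V →ₗ[ℚ] ℚ) (hC : ∀ x y, C x y = C y x) (x y : V) :
    qchar C (x + y) = qchar C x * qchar C y * bchar C x y := by
  unfold qchar bchar
  rw [← Complex.exp_add, ← Complex.exp_add]
  congr 1
  simp only [map_add, LinearMap.add_apply, hC y x]
  push_cast
  ring

theorem bchar_add (C : V →ₗ[ℚ] V →ₗ[ℚ] ℚ) (x y z : V) :
    bchar C x (y + z) = bchar C x y * bchar C x z := by
  unfold bchar
  rw [← Complex.exp_add]
  congr 1
  simp only [map_add]
  push_cast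
  ring

theorem bchar_eq_one_iff (C : V →ₗ[ℚ] V →ₗ[ℚ] ℚ) (x y : V) :
    bchar C x y = 1 ↔ ∃ n : ℤ, C x y = (n : ℚ) := by
  unfold bchar
  rw [Complex.exp_eq_one_iff]
  have hpi : (2 * Real.pi * Complex.I : ℂ) ≠ 0 := Complex.two_pi_I_ne_zero
  constructor
  · rintro ⟨n, hn⟩
    refine ⟨n, ?_⟩
    rw [mul_comm (n:ℂ)] at hn
    have := mul_left_cancel₀ hpi hn
    exact_mod_cast this
  · rintro ⟨n, hn⟩
    refine ⟨n, ?_⟩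
    rw [hn]; push_cast; ring

theorem qchar_even (C : V →ₗ[ℚ] V →ₗ[ℚ] ℚ) (x : V) (h : ∃ n : ℤ, C x x = 2 * (n : ℚ)) :
    qchar C x = 1 := by
  obtain ⟨n, hn⟩ := h
  unfold qchar
  rw [Complex.exp_eq_one_iff]
  refine ⟨n, ?_⟩
  rw [hn]; push_cast; ring

theorem int_of_even (C : V →ₗ[ℚ] V →ₗ[ℚ] ℚ) (hC : ∀ x y, C x y = C y x) (H : Submodule ℤ V)
    (heven : ∀ x ∈ H, ∃ n : ℤ, C x x = 2 * (n : ℚ)) (x y : V) (hx : x ∈ H) (hy : y ∈ H) :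
    ∃ n : ℤ, C x y = n := by
  obtain ⟨a, ha⟩ := heven x hx
  obtain ⟨b, hb⟩ := heven y hy
  obtain ⟨c, hc⟩ := heven (x + y) (H.add_mem hx hy)
  refine ⟨c - a - b, ?_⟩
  simp only [map_add, LinearMap.add_apply, hC y x] at hc
  push_cast
  linarith

open Classical in
theorem gauss_reduce (C : V →ₗ[ℚ] V →ₗ[ℚ] ℚ) (hC : ∀ x y, C x y = C y x)
    (P H A : Submodule ℤ V) (hAH : A ≤ H) (hHP : H ≤ P)
    (heven : ∀ x ∈ H, ∃ n : ℤ, C x x = 2 * (n : ℚ))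
    (hint : ∀ x ∈ P, ∀ a ∈ A, ∃ n : ℤ, C x a = n)
    (s : Finset V) (hs : IsReps P A s) :
    ∃ u, IsReps (P ⊓ dualLat C H) H u ∧
      ∃ c : ℕ, 0 < c ∧ ∑ x ∈ s, qchar C x = c * ∑ x ∈ u, qchar C x := by
  set Q := P ⊓ dualLat C H with hQ
  have hHQ : H ≤ Q := by
    intro x hx
    exact ⟨hHP hx, fun y hy => int_of_even C hC H heven x y hx hy⟩
  have hQP : Q ≤ P := inf_le_left
  have hinv : ∀ x ∈ P, ∀ a ∈ A, qchar C (x + a) = qchar C x := by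
    intro x hx a ha
    rw [qchar_add C hC, qchar_even C a (heven a (hAH ha)), (bchar_eq_one_iff C x a).2 (hint x hx a ha)]
    ring
  have hinvQ : ∀ x ∈ Q, ∀ a ∈ H, qchar C (x + a) = qchar C x := by
    intro x hx a ha
    rw [qchar_add C hC, qchar_even C a (heven a ha), (bchar_eq_one_iff C x a).2 (hx.2 a ha)]
    ring
  have hsQ := hs.filter (hAH.trans hHQ) hQP
  obtain ⟨u, hu⟩ := exists_isReps hHQ _ hsQ.1 (fun x hx => by
    obtain ⟨r, hr, h⟩ := hsQ.2.1 x hx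
    exact ⟨r, hr, hAH h⟩)
  have ht := hs.filter hAH hHP
  set t := s.filter (· ∈ H) with htdef
  have htne : 0 < t.card := by
    obtain ⟨r, hr, _⟩ := ht.2.1 0 H.zero_mem
    exact Finset.card_pos.2 ⟨r, hr⟩
  refine ⟨u, hu, t.card, htne, ?_⟩
  have step1 : (t.card : ℂ) * ∑ x ∈ s, qchar C x = (t.card : ℂ) * ∑ x ∈ s.filter (· ∈ Q), qchar C x := by
    have e1 : (t.card : ℂ) * ∑ x ∈ s, qchar C x = ∑ h ∈ t, ∑ x ∈ s, qchar C (x + h) := by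
      rw [Finset.sum_congr rfl (fun h hh => hs.shift (qchar C) hinv h (hHP (ht.1 h hh)))]
      rw [Finset.sum_const, nsmul_eq_mul]
    rw [e1, Finset.sum_comm, Finset.sum_filter, Finset.mul_sum]
    apply Finset.sum_congr rfl
    intro x hx
    have e2 : ∀ h ∈ t, qchar C (x + h) = qchar C x * bchar C x h := by
      intro h hh
      rw [qchar_add C hC, qchar_even C h (heven h (ht.1 h hh)), mul_one]
    rw [Finset.sum_congr rfl e2, ← Finset.mul_sum]
    split_ifs with hxQ
    · rw [Finset.sum_congr rfl (fun h hh => (bchar_eq_one_iff C x h).2 (hxQ.2 h (ht.1 h hh)))]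
      simp [mul_comm]
    · have : ∃ h ∈ H, bchar C x h ≠ 1 := by
        by_contra! hcon
        exact hxQ ⟨hs.1 x hx, fun y hy => (bchar_eq_one_iff C x y).1 (hcon y hy)⟩
      obtain ⟨h, hh, hne⟩ := this
      have e3 := ht.shift (bchar C x) (by
        intro y _ a ha
        rw [bchar_add, (bchar_eq_one_iff C x a).2 (hint x (hs.1 x hx) a ha), mul_one]) h hh
      simp only [bchar_add] at e3
      rw [← Finset.sum_mul] at e3
      have : (∑ y ∈ t, bchar C x y) * (bchar C x h - 1) = 0 := by linear_combination e3
      rcases mul_eq_zero.1 this with h0 | h0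
      · rw [h0]; simp
      · exact absurd (sub_eq_zero.1 h0) hne
  have hc0 : (t.card : ℂ) ≠ 0 := by exact_mod_cast htne.ne'
  rw [mul_left_cancel₀ hc0 step1]
  obtain ⟨m1, m2⟩ := hu.mul ht hAH hHQ
  rw [hsQ.sum_eq m1 (qchar C) (fun x hx a ha => hinvQ x hx a (hAH ha)), Finset.sum_image m2,
    Finset.sum_product, Finset.mul_sum]
  apply Finset.sum_congr rfl
  intro x hx
  rw [Finset.sum_congr rfl (fun h hh => hinvQ x (hu.1 x hx) h (ht.1 h hh))]
  simp

open Classical in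
theorem milgram_diag {ι : Type*} [Fintype ι] (C : V →ₗ[ℚ] V →ₗ[ℚ] ℚ)
    (e : Module.Basis ι ℚ V) (N : ι → ℕ) (hpos : ∀ i, 0 < N i) (hev : ∀ i, Even (N i))
    (hort : ∀ i j, i ≠ j → C (e i) (e j) = 0) (hN : ∀ i, C (e i) (e i) = -(N i : ℚ)) :
    ∃ s, IsReps (dualLat C (Submodule.span ℤ (Set.range e))) (Submodule.span ℤ (Set.range e)) s ∧
      ∃ c : ℝ, 0 < c ∧ ∑ x ∈ s, qchar C x =
        c * Complex.exp (-(Real.pi * Complex.I * (Fintype.card ι : ℂ) / 4)) := by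
  have hNQ : ∀ i, (N i : ℚ) ≠ 0 := fun i => by exact_mod_cast (hpos i).ne'
  set D := Submodule.span ℤ (Set.range e) with hD
  have hDmem : ∀ x, x ∈ D ↔ ∀ i, ∃ m : ℤ, e.repr x i = m := by
    intro x
    rw [hD, Module.Basis.mem_span_iff_repr_mem]
    apply forall_congr'
    intro i
    simp [Set.mem_range, eq_comm]
  have hCe : ∀ x i, C x (e i) = -(e.repr x i * N i) := by
    intro x i
    conv_lhs => rw [← e.sum_repr x]
    simp only [map_sum, LinearMap.sum_apply, map_smul, LinearMap.smul_apply]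
    rw [Finset.sum_eq_single i]
    · rw [hN]; simp
    · intro j _ hj; rw [hort j i hj]; simp
    · simp
  have hCxy : ∀ x y, C x y = -∑ i, e.repr y i * e.repr x i * N i := by
    intro x y
    conv_lhs => rw [← e.sum_repr y]
    simp only [map_sum, map_smul, hCe, smul_eq_mul]
    rw [← Finset.sum_neg_distrib]
    apply Finset.sum_congr rfl
    intro i _; ring
  have hPmem : ∀ x, x ∈ dualLat C D ↔ ∀ i, ∃ m : ℤ, e.repr x i * N i = m := by
    intro x
    constructor
    · intro h i
      obtain ⟨n, hn⟩ := h (e i) (Submodule.subset_span ⟨i, rfl⟩)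
      rw [hCe] at hn
      exact ⟨-n, by push_cast; linarith⟩
    · intro h y hy
      choose m hm using h
      choose k hk using (hDmem y).1 hy
      refine ⟨-∑ i, k i * m i, ?_⟩
      rw [hCxy]
      push_cast
      congr 1
      apply Finset.sum_congr rfl
      intro i _
      rw [← hm, ← hk]; ring
  let b : (ι → ℕ) → V := fun k => ∑ i, ((k i : ℚ) / N i) • e i
  have hb : ∀ k i, e.repr (b k) i = (k i : ℚ) / N i := by
    intro k i
    have := e.repr_sum_self (fun i => (k i : ℚ) / N i)
    exact congrFun this i
  have hinj : ∀ k ∈ Fintype.piFinset (fun i => Finset.range (N i)),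
      ∀ k' ∈ Fintype.piFinset (fun i => Finset.range (N i)), b k - b k' ∈ D → k = k' := by
    intro k hk k' hk' h
    rw [Fintype.mem_piFinset] at hk hk'
    funext i
    obtain ⟨m, hm⟩ := (hDmem _).1 h i
    rw [map_sub, Finsupp.sub_apply, hb, hb] at hm
    have h1 : ((k i : ℤ) - k' i) = m * N i := by
      have : ((k i : ℚ) - k' i) = m * N i := by
        field_simp [hNQ i] at hm; linarith
      exact_mod_cast this
    have h2 := Finset.mem_range.1 (hk i)
    have h3 := Finset.mem_range.1 (hk' i)
    have h4 : (k i : ℤ) = k' i := by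
      have a1 : (k i : ℤ) % N i = k i := Int.emod_eq_of_lt (by positivity) (by exact_mod_cast h2)
      have a2 : (k' i : ℤ) % N i = k' i := Int.emod_eq_of_lt (by positivity) (by exact_mod_cast h3)
      rw [← a1, ← a2]
      rw [show (k i : ℤ) = k' i + m * N i by linarith, Int.add_mul_emod_self_right]
    exact_mod_cast h4
  refine ⟨(Fintype.piFinset (fun i => Finset.range (N i))).image b, ⟨?_, ?_, ?_⟩, ?_⟩
  · intro x hx
    obtain ⟨k, hk, rfl⟩ := Finset.mem_image.1 hx
    rw [hPmem]
    intro i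
    refine ⟨k i, ?_⟩
    rw [hb, div_mul_cancel₀ _ (hNQ i)]; simp
  · intro x hx
    choose m hm using (hPmem x).1 hx
    have hNZ : ∀ i, (N i : ℤ) ≠ 0 := fun i => by exact_mod_cast (hpos i).ne'
    refine ⟨b (fun i => (m i % N i).toNat), Finset.mem_image_of_mem _ ?_, ?_⟩
    · rw [Fintype.mem_piFinset]
      intro i
      rw [Finset.mem_range]
      have := Int.emod_lt_of_pos (m i) (show (0:ℤ) < N i by exact_mod_cast hpos i)
      have := Int.emod_nonneg (m i) (hNZ i)
      lia
    · rw [hDmem]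
      intro i
      refine ⟨m i / N i, ?_⟩
      rw [map_sub, Finsupp.sub_apply, hb]
      have h1 : (((m i % N i).toNat : ℕ) : ℚ) = ((m i % N i : ℤ) : ℚ) := by
        have := Int.toNat_of_nonneg (Int.emod_nonneg (m i) (hNZ i))
        exact_mod_cast congrArg (fun z : ℤ => (z : ℚ)) this
      have h2 : (m i : ℚ) = ((m i % N i : ℤ) : ℚ) + N i * ((m i / N i : ℤ) : ℚ) := by
        exact_mod_cast congrArg (fun z : ℤ => (z : ℚ)) (Int.emod_add_mul_ediv (m i) (N i)).symm
      rw [h1]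
      have h3 := hm i
      rw [h2] at h3
      have := hNQ i
      field_simp
      linarith
  · intro x hx y hy hxy
    obtain ⟨k, hk, rfl⟩ := Finset.mem_image.1 hx
    obtain ⟨k', hk', rfl⟩ := Finset.mem_image.1 hy
    rw [hinj k hk k' hk' hxy]
  · rw [Finset.sum_image (by
      intro k hk k' hk' h
      exact hinj k hk k' hk' (by rw [h, sub_self]; exact D.zero_mem))]
    have hq : ∀ k, qchar C (b k) = ∏ i, Complex.exp (-(Real.pi * Complex.I * (k i : ℂ)^2 / N i)) := by
      intro k
      unfold qchar
      rw [← Complex.exp_sum]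
      congr 1
      rw [hCxy]
      push_cast
      rw [mul_neg, Finset.mul_sum, ← Finset.sum_neg_distrib]
      apply Finset.sum_congr rfl
      intro i _
      rw [hb]
      have : (N i : ℂ) ≠ 0 := by exact_mod_cast hNQ i
      push_cast
      field_simp
    rw [Finset.sum_congr rfl (fun k _ => hq k)]
    rw [← Finset.prod_univ_sum (fun i => Finset.range (N i))
      (fun i j => Complex.exp (-(Real.pi * Complex.I * (j : ℂ)^2 / N i)))]
    choose c hc1 hc2 using fun i => gauss_sum_neg (N i) (hev i) (hpos i)
    refine ⟨∏ i, c i, Finset.prod_pos (fun i _ => hc1 i), ?_⟩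
    rw [Finset.prod_congr rfl (fun i _ => hc2 i), Finset.prod_mul_distrib]
    push_cast
    rw [Finset.prod_const, ← Complex.exp_nat_mul, Finset.card_univ]
    congr 2
    ring

theorem exists_mul_mem (L : Submodule ℤ V) (hspan : Submodule.span ℚ (L : Set V) = ⊤) (x : V) :
    ∃ n : ℕ, 0 < n ∧ n • x ∈ L := by
  have hx : x ∈ Submodule.span ℚ (L : Set V) := by rw [hspan]; trivial
  induction hx using Submodule.span_induction with
  | mem x h => exact ⟨1, one_pos, by simpa using h⟩
  | zero => exact ⟨1, one_pos, by simp⟩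
  | add x y _ _ hx hy =>
    obtain ⟨n, hn, h1⟩ := hx
    obtain ⟨m, hm, h2⟩ := hy
    refine ⟨n * m, by positivity, ?_⟩
    rw [smul_add]
    refine L.add_mem ?_ ?_
    · rw [mul_comm, mul_smul]; exact L.nsmul_mem h1 m
    · rw [mul_smul]; exact L.nsmul_mem h2 n
  | smul q x _ hx =>
    obtain ⟨n, hn, h1⟩ := hx
    refine ⟨q.den * n, Nat.mul_pos q.den_pos hn, ?_⟩
    have : (q.den * n) • q • x = q.num • (n • x) := by
      simp only [← Nat.cast_smul_eq_nsmul ℚ, ← Int.cast_smul_eq_zsmul ℚ, smul_smul]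
      congr 1
      push_cast
      have := Rat.den_mul_eq_num q
      linear_combination (n:ℚ) * this
    rw [this]
    exact L.smul_mem _ h1

open Classical in
theorem milgram [FiniteDimensional ℚ V] (C : V →ₗ[ℚ] V →ₗ[ℚ] ℚ) (hC : ∀ x y, C x y = C y x)
    (hneg : ∀ x, x ≠ 0 → C x x < 0) (L : Submodule ℤ V)
    (hspan : ∀ x : V, ∃ n : ℕ, 0 < n ∧ n • x ∈ L)
    (heven : ∀ x ∈ L, ∃ n : ℤ, C x x = 2 * (n : ℚ)) :
    ∃ u, IsReps (dualLat C L) L u ∧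
      ∃ c : ℝ, 0 < c ∧ ∑ x ∈ u, qchar C x =
        c * Complex.exp (-(Real.pi * Complex.I * (Module.finrank ℚ V : ℂ) / 4)) := by
  obtain ⟨v, hv⟩ := LinearMap.BilinForm.exists_orthogonal_basis (B := C) ⟨fun x y => by simpa using hC x y⟩
  choose a ha1 ha2 using fun i => hspan (v i)
  let e := v.isUnitSMul (w := fun i => (a i : ℚ)) (fun i => by
    rw [isUnit_iff_ne_zero]; exact_mod_cast (ha1 i).ne')
  have he : ∀ i, e i = a i • v i := fun i => by
    rw [Module.Basis.isUnitSMul_apply, Nat.cast_smul_eq_nsmul]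
  have heL : ∀ i, e i ∈ L := fun i => by rw [he]; exact ha2 i
  choose m hm using fun i => heven (e i) (heL i)
  have hmneg : ∀ i, m i < 0 := by
    intro i
    have h1 := hneg (e i) (e.ne_zero i)
    rw [hm] at h1
    have : (m i : ℚ) < 0 := by linarith
    exact_mod_cast this
  have hcast : ∀ i, (((-m i).toNat : ℕ) : ℚ) = -(m i : ℚ) := by
    intro i
    have := Int.toNat_of_nonneg (show 0 ≤ -m i by linarith [hmneg i])
    exact_mod_cast congrArg (fun z : ℤ => (z : ℚ)) this
  obtain ⟨s, hs, c, hc, hsum⟩ := milgram_diag C e (fun i => 2 * (-m i).toNat)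
    (fun i => by have := hmneg i; lia) (fun i => even_two_mul _)
    (fun i j hij => by
      rw [he, he]
      have := hv hij
      simp only [Function.onFun] at this
      simp [this])
    (fun i => by rw [hm]; push_cast; rw [hcast]; ring)
  set D := Submodule.span ℤ (Set.range e) with hD
  have hDL : D ≤ L := by
    rw [hD, Submodule.span_le]
    rintro _ ⟨i, rfl⟩
    exact heL i
  have hLP : L ≤ dualLat C D := fun x hx y hy => int_of_even C hC L heven x y hx (hDL hy)
  obtain ⟨u, hu, k, hk, hku⟩ := gauss_reduce C hC (dualLat C D) L D hDL hLP heven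
    (fun x hx a ha => hx a ha) s hs
  have hinf : dualLat C D ⊓ dualLat C L = dualLat C L :=
    inf_eq_right.2 (fun x hx y hy => hx y (hDL hy))
  rw [hinf] at hu
  refine ⟨u, hu, c / k, by positivity, ?_⟩
  rw [hsum, Fintype.card_fin] at hku
  have hk0 : (k:ℂ) ≠ 0 := by exact_mod_cast hk.ne'
  push_cast
  field_simp
  linear_combination -hku

theorem max_iso (B : V →ₗ[ℚ] V →ₗ[ℚ] ℚ) (hsymm : ∀ x y, B x y = B y x) (T : Submodule ℤ V) (p : ℤ) :
    ∃ W : Submodule ℤ V, W ≤ T ∧ (∀ x ∈ W, ∀ y ∈ W, ∃ n : ℤ, B x y = p * (n : ℚ)) ∧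
      ∀ x ∈ T, (∀ y ∈ W, ∃ n : ℤ, B x y = p * (n : ℚ)) → (∃ n : ℤ, B x x = p * (n : ℚ)) → x ∈ W := by
  obtain ⟨W, -, hW⟩ := zorn_le_nonempty₀
    {W : Submodule ℤ V | W ≤ T ∧ (∀ x ∈ W, ∀ y ∈ W, ∃ n : ℤ, B x y = p * (n : ℚ))} (by
      intro c hc hchain y hy
      refine ⟨sSup c, ⟨sSup_le fun W hW => (hc hW).1, ?_⟩, fun W hW => le_sSup hW⟩
      intro a ha b hb
      rw [Submodule.mem_sSup_of_directed ⟨y, hy⟩ hchain.directedOn] at ha hb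
      obtain ⟨W1, h1, ha⟩ := ha
      obtain ⟨W2, h2, hb⟩ := hb
      rcases hchain.total h1 h2 with h | h
      · exact (hc h2).2 a (h ha) b hb
      · exact (hc h1).2 a ha b (h hb)) ⊥ ⟨bot_le, by
        intro x hx y hy
        rw [Submodule.mem_bot] at hx
        exact ⟨0, by simp [hx]⟩⟩
  refine ⟨W, hW.prop.1, hW.prop.2, ?_⟩
  rintro x hxT hxW ⟨k, hk⟩
  have hle : W ≤ W ⊔ Submodule.span ℤ {x} := le_sup_left
  have hmem := hW.le_of_ge (y := W ⊔ Submodule.span ℤ {x}) ⟨?_, ?_⟩ hle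
  · exact hmem (Submodule.mem_sup_right (Submodule.mem_span_singleton_self x))
  · refine sup_le hW.prop.1 ?_
    rw [Submodule.span_le]
    simpa using hxT
  · intro a ha b hb
    obtain ⟨w, hw, z, hz, rfl⟩ := Submodule.mem_sup.1 ha
    obtain ⟨w', hw', z', hz', rfl⟩ := Submodule.mem_sup.1 hb
    obtain ⟨i, rfl⟩ := Submodule.mem_span_singleton.1 hz
    obtain ⟨j, rfl⟩ := Submodule.mem_span_singleton.1 hz'
    obtain ⟨n1, h1⟩ := hW.prop.2 w hw w' hw'
    obtain ⟨n2, h2⟩ := hxW w hw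
    obtain ⟨n3, h3⟩ := hxW w' hw'
    refine ⟨n1 + j * n2 + i * n3 + i * j * k, ?_⟩
    simp only [map_add, LinearMap.add_apply, map_zsmul, LinearMap.smul_apply, h1, h3, hsymm w x, h2, hk,
      zsmul_eq_mul]
    push_cast
    ring

theorem double_dual [FiniteDimensional ℚ V]
    (B : V →ₗ[ℚ] V →ₗ[ℚ] ℚ) (hsymm : ∀ x y, B x y = B y x)
    (hnd : ∀ x : V, (∀ y, B x y = 0) → x = 0)
    (T : Submodule ℤ V) (hfg : T.FG)
    (hspan : Submodule.span ℚ (T : Set V) = ⊤) (x : V)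
    (hx : ∀ y ∈ dualLat B T, ∃ n : ℤ, B x y = n) : x ∈ T := by
  have : Submodule.IsLattice ℚ T := ⟨hfg, hspan⟩
  have : Module.Free ℤ T := Submodule.IsLattice.free ℚ T
  have : Module.Finite ℤ T := Module.Finite.iff_fg.2 hfg
  let b := Module.Free.chooseBasis ℤ T
  let b' := b.extendOfIsLattice ℚ
  have hT : Submodule.span ℤ (Set.range b') = T := by
    have h1 : Set.range b' = T.subtype '' (Set.range b) := by
      rw [← Set.range_comp]
      congr 1
      funext i
      simp [b']
    rw [h1, Submodule.span_image, b.span_eq, Submodule.map_subtype_top]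
  have key := LinearMap.BilinForm.dualSubmodule_dualSubmodule_of_basis (R := ℤ) (B := B)
    ⟨fun x h => hnd x h, fun y h => hnd y (fun z => by rw [hsymm]; exact h z)⟩ ⟨fun x y => by simpa using hsymm x y⟩ b'
  rw [hT] at key
  rw [← key]
  intro y hy
  obtain ⟨n, hn⟩ := hx y (fun z hz => by
    obtain ⟨m, hm⟩ := Submodule.mem_one.1 (hy z hz)
    exact ⟨m, by rw [← hm]; simp⟩)
  rw [Submodule.mem_one]
  exact ⟨n, by rw [hn]; simp⟩

theorem six_dual (B : V →ₗ[ℚ] V →ₗ[ℚ] ℚ) (T : Submodule ℤ V)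
    (hspan : Submodule.span ℚ (T : Set V) = ⊤)
    (h2elem : ∀ x ∈ dualLat B T, (∃ k : ℕ, ((2 : ℤ) ^ k) • x ∈ T) → (2 : ℤ) • x ∈ T)
    (h3elem : ∀ x ∈ dualLat B T, (∃ k : ℕ, ((3 : ℤ) ^ k) • x ∈ T) → (3 : ℤ) • x ∈ T)
    (hp : ∀ p : ℕ, p.Prime → 3 < p →
      ∀ x ∈ dualLat B T, (∃ k : ℕ, ((p : ℤ) ^ k) • x ∈ T) → x ∈ T) (x : V) (hx : x ∈ dualLat B T) :
    (6 : ℤ) • x ∈ T := by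
  have key : ∀ n : ℕ, n ≠ 0 → ∀ x ∈ dualLat B T, (n : ℤ) • x ∈ T →
      ∃ a b : ℕ, ((2:ℤ)^a * 3^b) • x ∈ T := by
    intro n
    induction n using induction_on_primes with
    | zero => intro h; exact absurd rfl h
    | one => intro _ x _ h; exact ⟨0, 0, by simpa using h⟩
    | prime_mul p m hpp ih =>
      intro hn x hx h
      have hm : m ≠ 0 := by rintro rfl; simp at hn
      by_cases hp2 : p = 2
      · obtain ⟨a, b, hab⟩ := ih hm ((2:ℤ) • x) ((dualLat B T).smul_mem _ hx) (by
          rw [smul_smul]; convert h using 2; rw [hp2]; push_cast; ring)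
        exact ⟨a + 1, b, by rw [smul_smul] at hab; convert hab using 2; ring⟩
      by_cases hp3 : p = 3
      · obtain ⟨a, b, hab⟩ := ih hm ((3:ℤ) • x) ((dualLat B T).smul_mem _ hx) (by
          rw [smul_smul]; convert h using 2; rw [hp3]; push_cast; ring)
        exact ⟨a, b + 1, by rw [smul_smul] at hab; convert hab using 2; ring⟩
      have h3 : 3 < p := by
        have := hpp.two_le
        omega
      exact ih hm x hx (hp p hpp h3 _ ((dualLat B T).smul_mem _ hx) ⟨1, by
        rw [smul_smul]; convert h using 2; push_cast; ring⟩)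
  obtain ⟨n, hn, hnx⟩ := exists_mul_mem T hspan x
  obtain ⟨a, b, hab⟩ := key n hn.ne' x hx (by rwa [natCast_zsmul])
  have h1 := h2elem ((3:ℤ)^b • x) ((dualLat B T).smul_mem _ hx) ⟨a, by rwa [smul_smul]⟩
  have h2 := h3elem ((2:ℤ) • x) ((dualLat B T).smul_mem _ hx) ⟨b, by
    rw [smul_comm]; exact h1⟩
  rw [smul_smul] at h2
  exact h2

theorem cube_root_re (z : ℂ) (h3 : z ^ 3 = 1) (h1 : z ≠ 1) : z.re = -1/2 ∧ z.im ≠ 0 := by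
  have h : z ^ 2 + z + 1 = 0 := by
    have : (z - 1) * (z ^ 2 + z + 1) = 0 := by linear_combination h3
    rcases mul_eq_zero.1 this with h | h
    · exact absurd (sub_eq_zero.1 h) h1
    · exact h
  have hr := congrArg Complex.re h
  have hi := congrArg Complex.im h
  simp [pow_two] at hr hi
  have him : z.im ≠ 0 := by
    intro h0
    rw [h0] at hr
    nlinarith [sq_nonneg (z.re + 1/2)]
  refine ⟨?_, him⟩
  have : z.im * (2 * z.re + 1) = 0 := by linarith
  rcases mul_eq_zero.1 this with h | h
  · exact absurd h him
  · linarith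

open Classical in
theorem three_part (B : V →ₗ[ℚ] V →ₗ[ℚ] ℚ) (hsymm : ∀ x y, B x y = B y x) (T R W : Submodule ℤ V)
    (heven : ∀ x ∈ T, ∃ n : ℤ, B x x = 2 * (n : ℚ))
    (hR : ∀ x, x ∈ R ↔ x ∈ T ∧ ∀ y ∈ T, ∃ n : ℤ, B x y = 3 * (n : ℚ))
    (hWT : W ≤ T) (hW : ∀ x ∈ W, ∀ y ∈ W, ∃ n : ℤ, B x y = 3 * (n : ℚ))
    (hmax : ∀ x ∈ T, (∀ y ∈ W, ∃ n : ℤ, B x y = 3 * (n : ℚ)) → (∃ n : ℤ, B x x = 3 * (n : ℚ)) → x ∈ W)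
    (s : Finset V) (hs : IsReps T R s) (c : ℝ) (hc : 0 < c)
    (hsum : ∑ x ∈ s, qchar ((3:ℚ)⁻¹ • B) x = c) (x : V) (hx : x ∈ T)
    (hxW : ∀ y ∈ W, ∃ n : ℤ, B x y = 3 * (n : ℚ)) : x ∈ W := by
  have hCsymm : ∀ x y, ((3:ℚ)⁻¹ • B) x y = ((3:ℚ)⁻¹ • B) y x := by
    intro x y; simp [hsymm x y]
  have hRW : R ≤ W := by
    intro r hr
    obtain ⟨h1, h2⟩ := (hR r).1 hr
    exact hmax r h1 (fun y hy => h2 y (hWT hy)) (h2 r h1)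
  have hWev : ∀ x ∈ W, ∃ n : ℤ, ((3:ℚ)⁻¹ • B) x x = 2 * (n : ℚ) := by
    intro x hx
    obtain ⟨n, hn⟩ := heven x (hWT hx)
    obtain ⟨m, hm⟩ := hW x hx x hx
    have h : 2 * n = 3 * m := by
      have : (2 * n : ℚ) = 3 * m := by rw [← hn, hm]
      exact_mod_cast this
    refine ⟨m / 2, ?_⟩
    have h2 : m = 2 * (m / 2) := by omega
    simp only [LinearMap.smul_apply, smul_eq_mul, hm]
    have h3 : (m : ℚ) = 2 * ((m / 2 : ℤ) : ℚ) := by exact_mod_cast h2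
    linarith
  obtain ⟨u, hu, k, hk, hku⟩ := gauss_reduce ((3:ℚ)⁻¹ • B) hCsymm T W R hRW hWT hWev (by
    intro x hx a ha
    obtain ⟨n, hn⟩ := ((hR a).1 ha).2 x hx
    refine ⟨n, ?_⟩
    simp only [LinearMap.smul_apply, smul_eq_mul, hsymm x a, hn]
    ring) s hs
  by_contra hcon
  have hQ : ∀ y ∈ T ⊓ dualLat ((3:ℚ)⁻¹ • B) W, y ∉ W → (qchar ((3:ℚ)⁻¹ • B) y).re = -1/2 ∧
      (qchar ((3:ℚ)⁻¹ • B) y).im ≠ 0 := by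
    rintro y ⟨hyT, hyd⟩ hyW
    obtain ⟨n, hn⟩ := heven y hyT
    have hpi : (2 * Real.pi * Complex.I : ℂ) ≠ 0 := Complex.two_pi_I_ne_zero
    apply cube_root_re
    · unfold qchar
      rw [← Complex.exp_nat_mul, Complex.exp_eq_one_iff]
      refine ⟨n, ?_⟩
      simp only [LinearMap.smul_apply, smul_eq_mul, hn]
      push_cast; ring
    · intro h
      unfold qchar at h
      rw [Complex.exp_eq_one_iff] at h
      obtain ⟨m, hm⟩ := h
      apply hyW
      apply hmax y hyT
      · intro w hw
        obtain ⟨j, hj⟩ := hyd w hw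
        simp only [LinearMap.smul_apply, smul_eq_mul] at hj
        exact ⟨j, by linarith⟩
      · refine ⟨2 * m, ?_⟩
        simp only [LinearMap.smul_apply, smul_eq_mul, hn] at hm
        push_cast at hm
        have h5 : (2 * Real.pi * Complex.I : ℂ) * (3⁻¹ * n) = (2 * Real.pi * Complex.I : ℂ) * m := by
          linear_combination hm
        have h6 := mul_left_cancel₀ hpi h5
        have h7 : (n : ℂ) = 3 * m := by linear_combination 3 * h6
        have h8 : (n : ℚ) = 3 * m := by exact_mod_cast h7
        rw [hn, h8]; push_cast; ring
  obtain ⟨r0, hr0, h0⟩ := hu.2.1 0 (Submodule.zero_mem _)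
  obtain ⟨r1, hr1, h1⟩ := hu.2.1 x ⟨hx, fun y hy => by
    obtain ⟨n, hn⟩ := hxW y hy
    refine ⟨n, ?_⟩
    simp only [LinearMap.smul_apply, smul_eq_mul, hn]
    ring⟩
  have hr0W : r0 ∈ W := by simpa using h0
  have hr1W : r1 ∉ W := by
    intro h
    apply hcon
    have := W.add_mem h1 h
    simpa using this
  have hne : r1 ≠ r0 := by rintro rfl; exact hr1W hr0W
  have hsum2 : ∑ x ∈ u, qchar ((3:ℚ)⁻¹ • B) x = 1 + ∑ x ∈ u.erase r0, qchar ((3:ℚ)⁻¹ • B) x := by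
    rw [← Finset.add_sum_erase u _ hr0, qchar_even _ r0 (hWev r0 hr0W)]
  have herase : ∀ r ∈ u.erase r0, (qchar ((3:ℚ)⁻¹ • B) r).re = -1/2 ∧
      (qchar ((3:ℚ)⁻¹ • B) r).im ≠ 0 := by
    intro r hr
    have hru := Finset.mem_of_mem_erase hr
    apply hQ r (hu.1 r hru)
    intro hrW
    exact Finset.ne_of_mem_erase hr (hu.2.2 r hru r0 hr0 (W.sub_mem hrW hr0W))
  rw [hsum, hsum2] at hku
  have hkR : (0:ℝ) < k := by exact_mod_cast hk
  have hre := congrArg Complex.re hku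
  have him := congrArg Complex.im hku
  rw [← Complex.ofReal_natCast, Complex.re_ofReal_mul, Complex.ofReal_re, Complex.add_re, Complex.re_sum,
    Finset.sum_congr rfl (fun r hr => (herase r hr).1), Finset.sum_const, nsmul_eq_mul, Complex.one_re] at hre
  rw [← Complex.ofReal_natCast, Complex.im_ofReal_mul, Complex.ofReal_im, Complex.add_im, Complex.one_im] at him
  have hcard : ((u.erase r0).card : ℝ) < 2 := by
    by_contra! h
    nlinarith
  have hcard2 : (u.erase r0).card < 2 := by exact_mod_cast hcard
  have hmem : r1 ∈ u.erase r0 := Finset.mem_erase.2 ⟨hne, hr1⟩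
  have hcard3 : (u.erase r0).card = 1 := by
    have := Finset.card_pos.2 ⟨r1, hmem⟩
    omega
  obtain ⟨r, hr⟩ := Finset.card_eq_one.1 hcard3
  rw [hr, Finset.sum_singleton, zero_add] at him
  have := (herase r (by rw [hr]; simp)).2
  rcases mul_eq_zero.1 him.symm with h | h
  · linarith
  · exact this h

theorem zs_left (B : V →ₗ[ℚ] V →ₗ[ℚ] ℚ) (n : ℤ) (x y : V) : B (n • x) y = n * B x y := by
  rw [map_zsmul, LinearMap.smul_apply, zsmul_eq_mul]

theorem zs_right (B : V →ₗ[ℚ] V →ₗ[ℚ] ℚ) (n : ℤ) (x y : V) : B x (n • y) = n * B x y := by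
  rw [map_zsmul, zsmul_eq_mul]

theorem int_of_two_three (q : ℚ) (h2 : ∃ n : ℤ, 2 * q = n) (h3 : ∃ n : ℤ, 3 * q = n) :
    ∃ n : ℤ, q = n := by
  obtain ⟨a, ha⟩ := h2
  obtain ⟨b, hb⟩ := h3
  exact ⟨b - a, by push_cast; linarith⟩

/-- the 3-part of the Gauss sum is positive -/
theorem gauss_three_s12 [FiniteDimensional ℚ V]
    (B : V →ₗ[ℚ] V →ₗ[ℚ] ℚ) (hsymm : ∀ x y, B x y = B y x)
    (hnd : ∀ x : V, (∀ y, B x y = 0) → x = 0)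
    (T R : Submodule ℤ V) (hfg : T.FG)
    (hspan : Submodule.span ℚ (T : Set V) = ⊤)
    (hint : ∀ x ∈ T, ∀ y ∈ T, ∃ n : ℤ, B x y = (n : ℚ))
    (heven : ∀ x ∈ T, ∃ n : ℤ, B x x = 2 * (n : ℚ))
    (hneg : ∀ x ∈ T, x ≠ 0 → B x x < 0)
    (h2elem : ∀ x ∈ dualLat B T, (∃ k : ℕ, ((2 : ℤ) ^ k) • x ∈ T) → (2 : ℤ) • x ∈ T)
    [Fintype (discrTwo B T)]
    (hBr : ∀ E : discrTwo B T → ℂ,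
      (∀ x : primaryPart B T 2,
        E (Submodule.Quotient.mk x) =
          Complex.exp (Real.pi * Complex.I * ((B x x : ℚ) : ℂ))) →
      ∑ y : discrTwo B T, E y =
        (Real.sqrt (Fintype.card (discrTwo B T)) : ℂ) *
          Complex.exp (Real.pi * Complex.I * (Module.finrank ℚ V : ℂ) / 4))
    (h6 : ∀ x ∈ dualLat B T, (6 : ℤ) • x ∈ T)
    (hR : ∀ x, x ∈ R ↔ x ∈ T ∧ ∀ y ∈ T, ∃ n : ℤ, B x y = 3 * (n : ℚ)) :
    ∃ (s : Finset V) (c : ℝ), IsReps T R s ∧ 0 < c ∧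
      ∑ x ∈ s, qchar ((3:ℚ)⁻¹ • B) x = c := by
  classical
  have hCsymm : ∀ x y, ((3:ℚ)⁻¹ • B) x y = ((3:ℚ)⁻¹ • B) y x := by
    intro x y; simp [hsymm x y]
  have hCapp : ∀ x y, ((3:ℚ)⁻¹ • B) x y = 3⁻¹ * B x y := by
    intro x y; simp
  have hRT : R ≤ T := fun x hx => ((hR x).1 hx).1
  have h3T : ∀ x ∈ T, (3:ℤ) • x ∈ R := by
    intro x hx
    refine (hR _).2 ⟨T.smul_mem _ hx, fun y hy => ?_⟩
    obtain ⟨n, hn⟩ := hint x hx y hy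
    exact ⟨n, by rw [zs_left, hn]; norm_num⟩
  have hCeven : ∀ x ∈ R, ∃ n : ℤ, ((3:ℚ)⁻¹ • B) x x = 2 * (n : ℚ) := by
    intro x hx
    obtain ⟨h1, h2⟩ := (hR x).1 hx
    obtain ⟨a, ha⟩ := heven x h1
    obtain ⟨b, hb⟩ := h2 x h1
    have : 2 * a = 3 * b := by
      have h : (2:ℚ) * a = 3 * b := by rw [← ha, ← hb]
      exact_mod_cast h
    obtain ⟨k, rfl⟩ : ∃ k, b = 2 * k := ⟨b / 2, by omega⟩
    exact ⟨k, by rw [hCapp, hb]; push_cast; ring⟩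
  have hCneg : ∀ x, x ≠ 0 → ((3:ℚ)⁻¹ • B) x x < 0 := by
    intro x hx
    obtain ⟨n, hn, hnx⟩ := exists_mul_mem T hspan x
    have hnx' : (n:ℤ) • x ∈ T := by rwa [natCast_zsmul]
    have hne : (n:ℤ) • x ≠ 0 := by
      rw [natCast_zsmul, ← Nat.cast_smul_eq_nsmul ℚ]
      exact smul_ne_zero (by exact_mod_cast hn.ne') hx
    have h := hneg _ hnx' hne
    rw [zs_left, zs_right] at h
    have hn' : (0:ℚ) < ((n:ℤ):ℚ) := by exact_mod_cast hn
    rw [hCapp]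
    by_contra hcon
    push Not at hcon
    have : 0 ≤ B x x := by linarith
    have := mul_nonneg hn'.le (mul_nonneg hn'.le this)
    linarith
  have hRspan : ∀ x : V, ∃ n : ℕ, 0 < n ∧ n • x ∈ R := by
    intro x
    obtain ⟨n, hn, hnx⟩ := exists_mul_mem T hspan x
    refine ⟨3 * n, by positivity, ?_⟩
    have := h3T _ hnx
    rw [mul_smul]
    exact_mod_cast this
  have hP2 : ∀ x ∈ primaryPart B T 2, (2:ℤ) • x ∈ T := fun x hx => h2elem x hx.1 hx.2
  have hdual : dualLat ((3:ℚ)⁻¹ • B) R = primaryPart B T 2 := by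
    apply le_antisymm
    · intro x hx
      have hx1 : x ∈ dualLat B T := by
        intro y hy
        obtain ⟨n, hn⟩ := hx _ (h3T y hy)
        refine ⟨n, ?_⟩
        rw [hCapp, zs_right] at hn
        rw [← hn]; push_cast; ring
      refine ⟨hx1, 1, ?_⟩
      rw [pow_one]
      refine double_dual B hsymm hnd T hfg hspan _ fun y hy => ?_
      have h6y : (6:ℤ) • y ∈ R := by
        refine (hR _).2 ⟨h6 y hy, fun z hz => ?_⟩
        obtain ⟨n, hn⟩ := hy z hz
        exact ⟨2 * n, by rw [zs_left, hn]; push_cast; ring⟩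
      obtain ⟨n, hn⟩ := hx _ h6y
      refine ⟨n, ?_⟩
      rw [hCapp, zs_right] at hn
      rw [zs_left, ← hn]; push_cast; ring
    · intro x hx y hy
      obtain ⟨n, hn⟩ := ((hR y).1 hy).2 _ (hP2 x hx)
      obtain ⟨m, hm⟩ := hx.1 y (hRT hy)
      rw [zs_right, hsymm y x] at hn
      refine ⟨m - n, ?_⟩
      rw [hCapp]
      push_cast at hn ⊢
      linarith
  obtain ⟨u, hu, c, hc, hsum⟩ := milgram _ hCsymm hCneg R hRspan hCeven
  rw [hdual] at hu
  have hTP : T ≤ primaryPart B T 2 := fun x hx =>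
    ⟨fun y hy => hint x hx y hy, 0, by simpa using hx⟩
  have hs1 := hu.filter hRT hTP
  set s1 := u.filter (· ∈ T) with hs1def
  let g : discrTwo B T → V := fun q => (q.out : V)
  have hg : ∀ x : primaryPart B T 2, (x : V) - g (Submodule.Quotient.mk x) ∈ T := by
    intro x
    have h : (Submodule.Quotient.mk x : discrTwo B T) =
        Submodule.Quotient.mk (Quotient.out (Submodule.Quotient.mk x : discrTwo B T)) :=
      (Quotient.out_eq _).symm
    rw [Submodule.Quotient.eq] at h
    exact h
  have hgP : ∀ q, g q ∈ primaryPart B T 2 := fun q => (Quotient.out q).2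
  have hginj : ∀ q q', g q - g q' ∈ T → q = q' := by
    intro q q' h
    have h1 : (Submodule.Quotient.mk (Quotient.out q) : discrTwo B T) =
        Submodule.Quotient.mk (Quotient.out q') := by
      rw [Submodule.Quotient.eq]
      exact h
    have e1 : (Submodule.Quotient.mk (Quotient.out q) : discrTwo B T) = q := Quotient.out_eq q
    have e2 : (Submodule.Quotient.mk (Quotient.out q') : discrTwo B T) = q' := Quotient.out_eq q'
    rw [e1, e2] at h1
    exact h1
  have h3to1 : ∀ y ∈ primaryPart B T 2, (3:ℤ) • y ∈ T → y ∈ T := by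
    intro y hy h
    have := T.sub_mem h (hP2 y hy)
    rwa [← sub_smul, show (3:ℤ) - 2 = 1 by norm_num, one_smul] at this
  let F : V × discrTwo B T → V := fun p => p.1 + (3:ℤ) • g p.2
  have hF : ∀ p ∈ s1 ×ˢ (Finset.univ : Finset (discrTwo B T)),
      ∀ p' ∈ s1 ×ˢ (Finset.univ : Finset (discrTwo B T)), F p - F p' ∈ R → p = p' := by
    rintro ⟨t, q⟩ h ⟨t', q'⟩ h' hd
    have ht := (Finset.mem_product.1 h).1
    have ht' := (Finset.mem_product.1 h').1
    simp only at ht ht'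
    have e : F (t, q) - F (t', q') = (t - t') + (3:ℤ) • (g q - g q') := by
      simp only [F, smul_sub]; abel
    rw [e] at hd
    have h1 : (3:ℤ) • (g q - g q') ∈ T := by
      have := T.sub_mem (hRT hd) (T.sub_mem (hs1.1 t ht) (hs1.1 t' ht'))
      simpa using this
    have h2 := hginj _ _ (h3to1 _ ((primaryPart B T 2).sub_mem (hgP q) (hgP q')) h1)
    subst h2
    rw [sub_self, smul_zero, add_zero] at hd
    rw [hs1.2.2 t ht t' ht' hd]
  have hFreps : IsReps (primaryPart B T 2) R
      ((s1 ×ˢ (Finset.univ : Finset (discrTwo B T))).image F) := by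
    refine ⟨?_, ?_, ?_⟩
    · intro x hx
      obtain ⟨⟨t, q⟩, h, rfl⟩ := Finset.mem_image.1 hx
      have ht := (Finset.mem_product.1 h).1
      exact (primaryPart B T 2).add_mem (hTP (hs1.1 t ht))
        ((primaryPart B T 2).smul_mem _ (hgP q))
    · intro x hx
      have h1 := hg ⟨x, hx⟩
      set q : discrTwo B T := Submodule.Quotient.mk ⟨x, hx⟩ with hq
      have h2 : x - (3:ℤ) • g q ∈ T := by
        have := T.sub_mem (T.smul_mem (3:ℤ) h1) (hP2 x hx)
        have e : (3:ℤ) • (x - g q) - (2:ℤ) • x = x - (3:ℤ) • g q := by module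
        rw [← e]; exact this
      obtain ⟨t, ht, htr⟩ := hs1.2.1 _ h2
      refine ⟨F (t, q), Finset.mem_image.2 ⟨(t, q), Finset.mem_product.2 ⟨ht, Finset.mem_univ _⟩, rfl⟩, ?_⟩
      have e : x - F (t, q) = x - (3:ℤ) • g q - t := by simp only [F]; abel
      rw [e]; exact htr
    · intro r hr r' hr' h
      obtain ⟨p, hp, rfl⟩ := Finset.mem_image.1 hr
      obtain ⟨p', hp', rfl⟩ := Finset.mem_image.1 hr'
      rw [hF p hp p' hp' h]
  have hinv : ∀ x ∈ primaryPart B T 2, ∀ a ∈ R,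
      qchar ((3:ℚ)⁻¹ • B) (x + a) = qchar ((3:ℚ)⁻¹ • B) x := by
    intro x hx a ha
    rw [qchar_add _ hCsymm, qchar_even _ a (hCeven a ha),
      (bchar_eq_one_iff _ x a).2 (by rw [← hdual] at hx; exact hx a ha)]
    ring
  have key := hu.sum_eq hFreps _ hinv
  rw [Finset.sum_image (fun p hp p' hp' h => hF p hp p' hp' (by rw [h, sub_self]; exact R.zero_mem)),
    Finset.sum_product] at key
  have hquarter : ∀ y ∈ primaryPart B T 2, qchar B y ^ 4 = 1 := by
    intro y hy
    obtain ⟨n, hn⟩ := heven _ (hP2 y hy)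
    have e := qchar_even B _ ⟨n, hn⟩
    rw [← e, qchar, qchar, ← Complex.exp_nat_mul, zs_left, zs_right]
    congr 1
    push_cast; ring
  have hterm : ∀ t ∈ s1, ∀ q : discrTwo B T, qchar ((3:ℚ)⁻¹ • B) (F (t, q)) =
      qchar ((3:ℚ)⁻¹ • B) t * (starRingEnd ℂ) (qchar B (g q)) := by
    intro t ht q
    have hb : bchar ((3:ℚ)⁻¹ • B) t ((3:ℤ) • g q) = 1 := by
      rw [bchar_eq_one_iff]
      obtain ⟨n, hn⟩ := (hgP q).1 t (hs1.1 t ht)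
      refine ⟨n, ?_⟩
      rw [hCapp, zs_right, hsymm, hn]; push_cast; ring
    have h3 : qchar ((3:ℚ)⁻¹ • B) ((3:ℤ) • g q) = qchar B (g q) ^ 3 := by
      rw [qchar, qchar, ← Complex.exp_nat_mul, hCapp, zs_left, zs_right]
      congr 1
      push_cast; ring
    have hconj : qchar B (g q) * (starRingEnd ℂ) (qchar B (g q)) = 1 := by
      rw [qchar, ← Complex.exp_conj, ← Complex.exp_add]
      simp
    have h4 := hquarter _ (hgP q)
    simp only [F]
    rw [qchar_add _ hCsymm, hb, h3, mul_one]
    congr 1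
    calc qchar B (g q) ^ 3 = qchar B (g q) ^ 3 * (qchar B (g q) * (starRingEnd ℂ) (qchar B (g q))) := by
          rw [hconj, mul_one]
      _ = qchar B (g q) ^ 4 * (starRingEnd ℂ) (qchar B (g q)) := by ring
      _ = _ := by rw [h4, one_mul]
  rw [Finset.sum_congr rfl (fun t ht => Finset.sum_congr rfl (fun q _ => hterm t ht q))] at key
  simp_rw [← Finset.mul_sum] at key
  rw [← Finset.sum_mul, ← map_sum] at key
  have hE := hBr (fun q => qchar B (g q)) (by
    intro x
    change qchar B (g _) = qchar B (x : V)
    have h1 := hg x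
    set y := g (Submodule.Quotient.mk x) with hy
    have e : (x : V) = y + ((x : V) - y) := by abel
    rw [e, qchar_add _ hsymm, qchar_even _ _ (heven _ h1), (bchar_eq_one_iff _ _ _).2 ((hgP _).1 _ h1)]
    ring)
  rw [hE, hsum] at key
  have hcard : 0 < Real.sqrt (Fintype.card (discrTwo B T)) := by
    apply Real.sqrt_pos.2
    exact_mod_cast Fintype.card_pos_iff.2 ⟨0⟩
  refine ⟨s1, c / Real.sqrt (Fintype.card (discrTwo B T)), hs1, by positivity, ?_⟩
  have hcj : (starRingEnd ℂ) ((Real.sqrt (Fintype.card (discrTwo B T)) : ℂ) *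
      Complex.exp (Real.pi * Complex.I * (Module.finrank ℚ V : ℂ) / 4)) =
      (Real.sqrt (Fintype.card (discrTwo B T)) : ℂ) *
      Complex.exp (-(Real.pi * Complex.I * (Module.finrank ℚ V : ℂ) / 4)) := by
    rw [map_mul, Complex.conj_ofReal, ← Complex.exp_conj]
    congr 2
    have h4 : (starRingEnd ℂ) (4:ℂ) = 4 := Complex.conj_ofNat 4
    simp [neg_div, h4]
  rw [hcj, ← mul_assoc] at key
  have key2 := mul_right_cancel₀ (Complex.exp_ne_zero _) key
  have hne : (Real.sqrt (Fintype.card (discrTwo B T)) : ℂ) ≠ 0 := by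
    exact_mod_cast hcard.ne'
  rw [Complex.ofReal_div, key2, mul_div_assoc, div_self hne, mul_one]

/-- a negative definite even lattice `T` with `discr₂ T` odd
2-elementary of Brown invariant `≡ rank T (mod 8)` (expressed through the Gauss sum
defining the Brown invariant), `discr₃ T` 3-elementary, and trivial `p`-discriminants
for `p > 3`, contains a finite index sublattice `T' ≅ T̄(6)` with `T̄` odd unimodular. -/
theorem sublattice_isomorphic_to_odd_unimodular_rescaled
    {V : Type*} [AddCommGroup V] [Module ℚ V] [FiniteDimensional ℚ V]
    (B : V →ₗ[ℚ] V →ₗ[ℚ] ℚ) (hsymm : ∀ x y, B x y = B y x)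
    (hnd : ∀ x : V, (∀ y, B x y = 0) → x = 0)
    (T : Submodule ℤ V) (hfg : T.FG)
    (hspan : Submodule.span ℚ (T : Set V) = ⊤)
    (hint : ∀ x ∈ T, ∀ y ∈ T, ∃ n : ℤ, B x y = (n : ℚ))
    (heven : ∀ x ∈ T, ∃ n : ℤ, B x x = 2 * (n : ℚ))
    (hneg : ∀ x ∈ T, x ≠ 0 → B x x < 0)
    -- `discr₂ T` is 2-elementary:
    (h2elem : ∀ x ∈ dualLat B T, (∃ k : ℕ, ((2 : ℤ) ^ k) • x ∈ T) → (2 : ℤ) • x ∈ T)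
    -- `discr₂ T` is odd:
    (hodd : ∃ x ∈ primaryPart B T 2, ¬ ∃ n : ℤ, B x x = (n : ℚ))
    -- `Br (discr₂ T) ≡ rank T (mod 8)`, via the Gauss sum defining `Br`:
    [Fintype (discrTwo B T)]
    (hBr : ∀ E : discrTwo B T → ℂ,
      (∀ x : primaryPart B T 2,
        E (Submodule.Quotient.mk x) =
          Complex.exp (Real.pi * Complex.I * ((B x x : ℚ) : ℂ))) →
      ∑ y : discrTwo B T, E y =
        (Real.sqrt (Fintype.card (discrTwo B T)) : ℂ) *
          Complex.exp (Real.pi * Complex.I * (Module.finrank ℚ V : ℂ) / 4))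
    -- `discr₃ T` is 3-elementary:
    (h3elem : ∀ x ∈ dualLat B T, (∃ k : ℕ, ((3 : ℤ) ^ k) • x ∈ T) → (3 : ℤ) • x ∈ T)
    -- `discr_p T = 0` for all primes `p > 3`:
    (hp : ∀ p : ℕ, p.Prime → 3 < p →
      ∀ x ∈ dualLat B T, (∃ k : ℕ, ((p : ℤ) ^ k) • x ∈ T) → x ∈ T) :
    ∃ T' : Submodule ℤ V, T' ≤ T ∧
      (∃ N : ℤ, N ≠ 0 ∧ ∀ x ∈ T, N • x ∈ T') ∧
      -- `T̄ := T'(1/6)` is an integral lattice: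
      (∀ x ∈ T', ∀ y ∈ T', ∃ n : ℤ, B x y = 6 * (n : ℚ)) ∧
      -- `T̄` is unimodular: it coincides with its dual with respect to `B/6`:
      dualLat ((6 : ℚ)⁻¹ • B) T' = T' ∧
      -- `T̄` is odd: some vector has odd square:
      (∃ x ∈ T', ∀ n : ℤ, B x x ≠ 12 * (n : ℚ)) := by
  have h6 := six_dual B T hspan h2elem h3elem hp
  let R : Submodule ℤ V := T ⊓ dualLat ((3:ℚ)⁻¹ • B) T
  have hR : ∀ x, x ∈ R ↔ x ∈ T ∧ ∀ y ∈ T, ∃ n : ℤ, B x y = 3 * (n : ℚ) := by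
    intro x
    refine and_congr Iff.rfl (forall₂_congr fun y _ => exists_congr fun n => ?_)
    rw [LinearMap.smul_apply, LinearMap.smul_apply, smul_eq_mul]
    constructor
    · intro h; linarith
    · intro h; linarith
  obtain ⟨s, c, hs, hc, hsum⟩ :=
    gauss_three_s12 B hsymm hnd T R hfg hspan hint heven hneg h2elem hBr h6 hR
  obtain ⟨W2, hW2T, hW2, hmax2⟩ := max_iso B hsymm T 2
  obtain ⟨W3, hW3T, hW3, hmax3⟩ := max_iso B hsymm T 3
  simp only [Int.cast_ofNat] at hW2 hmax2 hW3 hmax3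
  have hm2 : ∀ x ∈ T, (∀ y ∈ W2, ∃ n : ℤ, B x y = 2 * (n : ℚ)) → x ∈ W2 :=
    fun x hx h => hmax2 x hx h (heven x hx)
  have hm3 := three_part B hsymm T R W3 heven hR hW3T hW3 hmax3 s hs c hc hsum
  have h6T : ∀ y ∈ dualLat B T, (6:ℤ) • y ∈ W2 ⊓ W3 := by
    intro y hy
    refine ⟨hm2 _ (h6 y hy) fun z hz => ?_, hm3 _ (h6 y hy) fun z hz => ?_⟩
    · obtain ⟨n, hn⟩ := hy z (hW2T hz)
      exact ⟨3 * n, by rw [zs_left, hn]; push_cast; ring⟩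
    · obtain ⟨n, hn⟩ := hy z (hW3T hz)
      exact ⟨2 * n, by rw [zs_left, hn]; push_cast; ring⟩
  have hint6 : ∀ x ∈ W2 ⊓ W3, ∀ y ∈ W2 ⊓ W3, ∃ n : ℤ, B x y = 6 * (n : ℚ) := by
    intro x hx y hy
    obtain ⟨a, ha⟩ := hW2 x hx.1 y hy.1
    obtain ⟨b, hb⟩ := hW3 x hx.2 y hy.2
    have h : (2:ℚ) * a = 3 * b := by rw [← ha, ← hb]
    have h' : 2 * a = 3 * b := by exact_mod_cast h
    obtain ⟨k, rfl⟩ : ∃ k, b = 2 * k := ⟨b / 2, by omega⟩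
    obtain rfl : a = 3 * k := by omega
    exact ⟨k, by rw [ha]; push_cast; ring⟩
  refine ⟨W2 ⊓ W3, fun x hx => hW2T hx.1, ⟨6, by norm_num, fun x hx => h6T x (hint x hx)⟩,
    hint6, ?_, ?_⟩
  · apply le_antisymm
    · intro x hx
      have hx' : ∀ y ∈ W2 ⊓ W3, ∃ n : ℤ, B x y = 6 * (n : ℚ) := by
        intro y hy
        obtain ⟨n, hn⟩ := hx y hy
        rw [LinearMap.smul_apply, LinearMap.smul_apply, smul_eq_mul] at hn
        exact ⟨n, by linarith⟩
      have hxT : x ∈ T := by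
        refine double_dual B hsymm hnd T hfg hspan x fun y hy => ?_
        obtain ⟨n, hn⟩ := hx' _ (h6T y hy)
        rw [zs_right] at hn
        push_cast at hn
        exact ⟨n, by linarith⟩
      refine ⟨hm2 x hxT fun y hy => ?_, hm3 x hxT fun y hy => ?_⟩
      · have h3y : (3:ℤ) • y ∈ W2 ⊓ W3 := by
          refine ⟨W2.smul_mem _ hy, hm3 _ (T.smul_mem _ (hW2T hy)) fun z hz => ?_⟩
          obtain ⟨n, hn⟩ := hint y (hW2T hy) z (hW3T hz)
          exact ⟨n, by rw [zs_left, hn]; norm_num⟩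
        obtain ⟨n, hn⟩ := hx' _ h3y
        rw [zs_right] at hn
        push_cast at hn
        exact ⟨n, by linarith⟩
      · have h2y : (2:ℤ) • y ∈ W2 ⊓ W3 := by
          refine ⟨hm2 _ (T.smul_mem _ (hW3T hy)) fun z hz => ?_, W3.smul_mem _ hy⟩
          obtain ⟨n, hn⟩ := hint y (hW3T hy) z (hW2T hz)
          exact ⟨n, by rw [zs_left, hn]; norm_num⟩
        obtain ⟨n, hn⟩ := hx' _ h2y
        rw [zs_right] at hn
        push_cast at hn
        exact ⟨n, by linarith⟩
    · intro x hx y hy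
      obtain ⟨n, hn⟩ := hint6 x hx y hy
      exact ⟨n, by rw [LinearMap.smul_apply, LinearMap.smul_apply, smul_eq_mul, hn]; ring⟩
  · obtain ⟨z, hz, hzn⟩ := hodd
    refine ⟨(6:ℤ) • z, h6T z hz.1, fun n hn => hzn ?_⟩
    obtain ⟨m, hm⟩ := heven _ (h2elem z hz.1 hz.2)
    rw [zs_left, zs_right] at hn hm
    push_cast at hn hm
    exact int_of_two_three _ ⟨m, by linarith⟩ ⟨n, by linarith⟩
end

section
/- Let X ⊂ P³ be a nonsingular quartic over an algebraically closed field of characteristic ≠ 2, and suppose the configuration of lines on X contains twelve lines a₁,…,a₁₀, b₁, b₂ forming the complete bipartite graph K_{10,2} (each aᵢ meets both bⱼ; the aᵢ are pairwise disjoint; b₁, b₂ are disjoint). Then the branch curve D of the degree-2 morphism π = π[b₁, b₂] : X → P¹ × P¹ splits as D = π(b₁) ∪ π(b₂), the union of an irreducible curve of bidegree (3,1) and an irreducible curve of bidegree (1,3) meeting transversally at ten points. -/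
open MvPolynomial

noncomputable section

variable {k : Type*} [Field k]

/-- Substitution describing the pencil of lines joining the point of `b₂` with
coordinates `(x₀, x₁)` (variables `Sum.inl`) in the basis `u` and the point of `b₁`
with coordinates `(y₀, y₁)` (variables `Sum.inr`) in the basis `w`: the `i`-th
coordinate of the point `s·(x₀u₀ + x₁u₁) + (y₀w₀ + y₁w₁)` of the line, as a
polynomial in the affine parameter `s` (= `Polynomial.X`). -/
def lineCoord (u w : Fin 2 → Fin 4 → k) (i : Fin 4) :
    Polynomial (MvPolynomial (Fin 2 ⊕ Fin 2) k) :=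
  Polynomial.C (X (Sum.inl 0) * C (u 0 i) + X (Sum.inl 1) * C (u 1 i)) * Polynomial.X
    + Polynomial.C (X (Sum.inr 0) * C (w 0 i) + X (Sum.inr 1) * C (w 1 i))

/-- The `n`-th coefficient of the restriction of the quartic `F` to the moving line:
for `n = 3, 2, 1` these are the coefficients `α, β, γ` of the residual conic
`αs² + βst + γt²` of the double covering `π = π[b₁,b₂] : X → ℙ¹ × ℙ¹`; the curve
`{α = 0}` is `π(b₂)` and `{γ = 0}` is `π(b₁)`, and `{β² − 4αγ = 0}` is the branch
curve `D` of `π`. -/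
def resCoeff (F : MvPolynomial (Fin 4) k) (u w : Fin 2 → Fin 4 → k) (n : ℕ) :
    MvPolynomial (Fin 2 ⊕ Fin 2) k :=
  (MvPolynomial.aeval (lineCoord u w) F).coeff n

/-- Directional derivative of a bihomogeneous polynomial at `(a, b)` along `(v, w)`. -/
def dirDeriv (φ : MvPolynomial (Fin 2 ⊕ Fin 2) k) (a b v w : Fin 2 → k) : k :=
  (∑ i : Fin 2, v i * eval (Sum.elim a b) (pderiv (Sum.inl i) φ))
    + ∑ i : Fin 2, w i * eval (Sum.elim a b) (pderiv (Sum.inr i) φ)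

/-- The set of intersection points (pairs of 1-dimensional subspaces, i.e. points of
`ℙ¹ × ℙ¹`) of the two curves `{α = 0}` and `{γ = 0}`. -/
def interPoints (α γ : MvPolynomial (Fin 2 ⊕ Fin 2) k) :
    Set (Submodule k (Fin 2 → k) × Submodule k (Fin 2 → k)) :=
  {P | Module.finrank k P.1 = 1 ∧ Module.finrank k P.2 = 1 ∧
    ∀ a ∈ P.1, ∀ b ∈ P.2,
      eval (Sum.elim a b) α = 0 ∧ eval (Sum.elim a b) γ = 0}

/-- The bidegree weighting on the variables of `ℙ¹ × ℙ¹`. -/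
def biWeight : Fin 2 ⊕ Fin 2 → ℕ × ℕ := Sum.elim (fun _ => (1, 0)) fun _ => (0, 1)

section aux1

variable {K : Type*} [Field K]

lemma bs_exists_homog {A : MvPolynomial (Fin 2) K} {n : ℕ} (hA : A.IsHomogeneous n) :
    ∃ p : Polynomial K, p.natDegree ≤ n ∧ p.homogenize n = A := by
  refine ⟨aeval ![Polynomial.X, 1] A, ?_, Polynomial.homogenize_eq_of_isHomogeneous hA rfl⟩
  have := MvPolynomial.aeval_natDegree_le (F := A) (m := n) hA.totalDegree_le
    (![Polynomial.X, 1]) (n := 1) (by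
      intro i; fin_cases i <;> simp)
  simpa using this

lemma bs_eval_homogenize (p : Polynomial K) (n : ℕ) (a : Fin 2 → K) :
    eval a (p.homogenize n) = ∑ j : Fin (n + 1), p.coeff j * (a 0 ^ (j : ℕ) * a 1 ^ (n - j : ℕ)) := by
  rw [Polynomial.homogenize, Finset.Nat.sum_antidiagonal_eq_sum_range_succ_mk, map_sum,
    Finset.sum_range]
  refine Finset.sum_congr rfl fun j _ => ?_
  rw [eval_monomial, Finsupp.prod_fintype _ _ (by simp)]
  simp [Fin.prod_univ_two]

/-- A binary form of degree `n` with `n + 1` distinct zeros vanishes. -/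
lemma bs_form_zero {A : MvPolynomial (Fin 2) K} {n : ℕ} (hA : A.IsHomogeneous n)
    (p : Fin (n + 1) → Fin 2 → K)
    (hp : ∀ i j, i ≠ j → p i 0 * p j 1 - p j 0 * p i 1 ≠ 0)
    (h0 : ∀ i, eval (p i) A = 0) : A = 0 := by
  obtain ⟨q, hq, rfl⟩ := bs_exists_homog hA
  rw [Polynomial.homogenize_eq_zero_iff hq]
  have hdet : (Matrix.projVandermonde (fun i => p i 0) (fun i => p i 1)).det ≠ 0 := by
    rw [Matrix.det_projVandermonde]
    refine Finset.prod_ne_zero_iff.2 fun i _ => Finset.prod_ne_zero_iff.2 fun j hj => ?_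
    exact hp j i (by simpa using (Finset.mem_Ioi.1 hj).ne')
  have := Matrix.eq_zero_of_mulVec_eq_zero hdet (v := fun j : Fin (n + 1) => q.coeff j) (by
    ext i
    have := h0 i
    rw [bs_eval_homogenize] at this
    simp only [Matrix.mulVec, dotProduct, Matrix.projVandermonde_apply, Pi.zero_apply]
    rw [← this]
    refine Finset.sum_congr rfl fun j _ => ?_
    rw [Fin.val_rev]
    have : n + 1 - (j + 1 : ℕ) = n - j := by omega
    rw [this]; ring)
  ext i
  by_cases hi : i ≤ n
  · exact congrFun this ⟨i, by omega⟩
  · simpa using Polynomial.coeff_eq_zero_of_natDegree_lt (by omega : q.natDegree < i)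

lemma bs_dvd_zero {σ : Type*} {A B : MvPolynomial σ K} {m n : ℕ} (hA : A.IsHomogeneous m)
    (hB : B.IsHomogeneous n) (hmn : n < m) (h : A ∣ B) : B = 0 := by
  by_contra hB0
  obtain ⟨D, rfl⟩ := h
  have hA0 : A ≠ 0 := by rintro rfl; simp at hB0
  have hD0 : D ≠ 0 := by rintro rfl; simp at hB0
  have h1 := totalDegree_mul_of_isDomain hA0 hD0
  rw [hB.totalDegree hB0, hA.totalDegree hA0] at h1
  omega

/-- linear forms are irreducible -/
lemma bs_lin_irred {σ : Type*} {i j : σ} (hij : i ≠ j) (r : K) :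
    Irreducible (X i - C r * X j : MvPolynomial σ K) := by
  classical
  have hc : (X i - C r * X j : MvPolynomial σ K).coeff (Finsupp.single i 1) = 1 := by
    rw [coeff_sub, coeff_C_mul, coeff_X, coeff_X, if_pos rfl, if_neg, mul_zero, sub_zero]
    rw [Finsupp.single_left_inj one_ne_zero]; exact hij.symm
  have h1 : (X i - C r * X j : MvPolynomial σ K).IsHomogeneous 1 :=
    (isHomogeneous_X _ _).sub (isHomogeneous_C_mul_X _ _)
  apply irreducible_of_totalDegree_eq_one
  · apply h1.totalDegree
    intro h; rw [h] at hc; simp at hc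
  · intro x hx
    have := hx (Finsupp.single i 1)
    rw [hc] at this
    exact isUnit_of_dvd_one this

variable [IsAlgClosed K]

lemma bs_relprime_aux {σ : Type*} (e : Fin 2 → σ) (he : Function.Injective e)
    (g : MvPolynomial σ K) (n : ℕ) : ∀ (p : Polynomial K), p ≠ 0 → p.natDegree ≤ n →
    (∀ a : Fin 2 → K, a ≠ 0 → eval a (p.homogenize n) = 0 →
      ∃ z : σ → K, z ∘ e = a ∧ eval z g ≠ 0) →
    IsRelPrime (rename e (p.homogenize n)) g := by
  induction n with
  | zero =>
    intro p hp hn _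
    apply IsUnit.isRelPrime_left
    rw [Polynomial.eq_C_of_natDegree_le_zero hn] at hp ⊢
    simp only [Polynomial.homogenize_C, pow_zero, mul_one, rename_C]
    rw [isUnit_map_iff]
    apply IsUnit.mk0
    simpa using hp
  | succ n ih =>
    intro p hp hn H
    have key : ∃ (q : Polynomial K) (l : MvPolynomial (Fin 2) K) (a : Fin 2 → K), q ≠ 0 ∧
        q.natDegree ≤ n ∧ p.homogenize (n + 1) = l * q.homogenize n ∧ a ≠ 0 ∧ eval a l = 0 ∧
        Irreducible (rename e l) := by
      by_cases hpn : p.natDegree ≤ n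
      · refine ⟨p, X 1, ![1, 0], hp, hpn, ?_, ?_, ?_, ?_⟩
        · have := Polynomial.homogenize_mul p 1 hpn (n := 1) (by simp)
          rw [mul_one] at this
          rw [this]; simp [mul_comm]
        · intro h; simpa using congrFun h 0
        · simp
        · have := bs_lin_irred (K := K) (he.ne (show (1 : Fin 2) ≠ 0 by simp)) 0
          simpa using this
      · have hd : p.degree ≠ 0 := by
          intro h
          have := Polynomial.natDegree_eq_of_degree_eq_some (n := 0) (by simpa using h)
          omega
        obtain ⟨r, hr⟩ := IsAlgClosed.exists_root p hd
        obtain ⟨q, rfl⟩ := Polynomial.dvd_iff_isRoot.2 hr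
        have hq : q ≠ 0 := right_ne_zero_of_mul hp
        have hqn : q.natDegree ≤ n := by
          rw [Polynomial.natDegree_mul (Polynomial.X_sub_C_ne_zero r) hq,
            Polynomial.natDegree_X_sub_C] at hn
          omega
        refine ⟨q, X 0 - C r * X 1, ![r, 1], hq, hqn, ?_, ?_, ?_, ?_⟩
        · have := Polynomial.homogenize_mul (Polynomial.X - Polynomial.C r) q (m := 1) (by simp) hqn
          rw [add_comm n 1, this]
          simp
        · intro h; simpa using congrFun h 1
        · simp
        · have := bs_lin_irred (K := K) (he.ne (show (0 : Fin 2) ≠ 1 by simp)) r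
          simpa using this
    obtain ⟨q, l, a, hq, hqn, hpq, ha, hal, hirr⟩ := key
    rw [hpq] at H ⊢
    rw [map_mul]
    apply IsRelPrime.mul_left
    · rw [hirr.isRelPrime_iff_not_dvd]
      rintro ⟨D, rfl⟩
      obtain ⟨z, hz, hz2⟩ := H a ha (by simp [hal])
      apply hz2
      rw [map_mul, eval_rename, hz, hal, zero_mul]
    · apply ih q hq hqn
      intro b hb hb2
      exact H b hb (by simp [hb2])

lemma bs_relprime {σ : Type*} (e : Fin 2 → σ) (he : Function.Injective e)
    (g : MvPolynomial σ K) {n : ℕ} {A : MvPolynomial (Fin 2) K} (hA : A.IsHomogeneous n)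
    (hA0 : A ≠ 0)
    (h : ∀ a : Fin 2 → K, a ≠ 0 → eval a A = 0 → ∃ z : σ → K, z ∘ e = a ∧ eval z g ≠ 0) :
    IsRelPrime (rename e A) g := by
  obtain ⟨q, hq, rfl⟩ := bs_exists_homog hA
  exact bs_relprime_aux e he g n q (by rintro rfl; simp at hA0) hq h

/-- a binary form of positive degree has a nontrivial zero -/
lemma bs_exists_zero {n : ℕ} {A : MvPolynomial (Fin 2) K} (hA : A.IsHomogeneous (n + 1)) :
    ∃ a : Fin 2 → K, a ≠ 0 ∧ eval a A = 0 := by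
  by_contra! H
  have hA0 : A ≠ 0 := by
    rintro rfl
    exact H ![1, 0] (fun h => by simpa using congrFun h 0) (by simp)
  have := bs_relprime id Function.injective_id A hA hA0
    (fun a ha h => absurd h (H a ha))
  rw [rename_id_apply] at this
  have hu : IsUnit A := this dvd_rfl dvd_rfl
  have := (MvPolynomial.isUnit_iff_totalDegree_of_isReduced.mp hu).2
  rw [hA.totalDegree hA0] at this
  omega

end aux1

section aux2

variable {K : Type*} [Field K]

lemma bs_weight (e : Fin 2 ⊕ Fin 2 →₀ ℕ) : Finsupp.weight biWeight e =
    (e (Sum.inl 0) + e (Sum.inl 1), e (Sum.inr 0) + e (Sum.inr 1)) := by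
  rw [Finsupp.weight_apply, Finsupp.sum_fintype _ _ (by simp)]
  ext <;> simp [biWeight, Fintype.sum_sum_type, Fin.sum_univ_two]

/-- assembling a bihomogeneous polynomial -/
def bsForm (n : ℕ) (A : ℕ → MvPolynomial (Fin 2) K) : MvPolynomial (Fin 2 ⊕ Fin 2) K :=
  ∑ j ∈ Finset.range (n + 1),
    rename Sum.inl (A j) * (X (Sum.inr 0) ^ j * X (Sum.inr 1) ^ (n - j))

lemma bs_decomp {p : MvPolynomial (Fin 2 ⊕ Fin 2) K} {m n : ℕ}
    (hp : p.IsWeightedHomogeneous biWeight (m, n)) :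
    ∃ A : ℕ → MvPolynomial (Fin 2) K, (∀ j, (A j).IsHomogeneous m) ∧ p = bsForm n A := by
  induction hp using IsWeightedHomogeneous.induction_on with
  | zero => exact ⟨fun _ => 0, fun _ => isHomogeneous_zero _ _ _, by simp [bsForm]⟩
  | add p q _ _ h1 h2 =>
    obtain ⟨A, hA, rfl⟩ := h1
    obtain ⟨B, hB, rfl⟩ := h2
    refine ⟨fun j => A j + B j, fun j => (hA j).add (hB j), ?_⟩
    simp [bsForm, add_mul, Finset.sum_add_distrib]
  | monomial d r hr =>
    rw [bs_weight, Prod.mk.injEq] at hr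
    obtain ⟨h1, h2⟩ := hr
    refine ⟨fun j => if j = d (Sum.inr 0) then
      C r * (X 0 ^ d (Sum.inl 0) * X 1 ^ d (Sum.inl 1)) else 0, fun j => ?_, ?_⟩
    · dsimp only
      split_ifs
      · rw [← h1]
        exact ((isHomogeneous_X_pow _ _).mul (isHomogeneous_X_pow _ _)).C_mul r
      · exact isHomogeneous_zero _ _ _
    · rw [bsForm, Finset.sum_eq_single (d (Sum.inr 0))]
      · rw [monomial_eq, Finsupp.prod_fintype _ _ (by simp)]
        have : n - d (Sum.inr 0) = d (Sum.inr 1) := by omega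
        rw [this]
        simp [Fintype.prod_sum_type, Fin.prod_univ_two]
        ring
      · intro j _ hj
        simp [hj]
      · intro hj
        simp only [Finset.mem_range] at hj
        omega

lemma bs_eval_smul {σ : Type*} {A : MvPolynomial σ K} {n : ℕ} (hA : A.IsHomogeneous n) (c : K)
    (x : σ → K) : eval (c • x) A = c ^ n * eval x A := by
  rw [eval_eq, eval_eq, Finset.mul_sum]
  refine Finset.sum_congr rfl fun d hd => ?_
  have := hA.degree_eq_sum_deg_support hd
  simp only [Pi.smul_apply, smul_eq_mul, mul_pow, Finset.prod_mul_distrib,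
    Finset.prod_pow_eq_pow_sum]
  rw [← this]
  ring

lemma bs_eval_form (n : ℕ) (A : ℕ → MvPolynomial (Fin 2) K) (a b : Fin 2 → K) :
    eval (Sum.elim a b) (bsForm n A) =
      ∑ j ∈ Finset.range (n + 1), eval a (A j) * (b 0 ^ j * b 1 ^ (n - j)) := by
  simp [bsForm, eval_rename]

lemma bs_scale {p : MvPolynomial (Fin 2 ⊕ Fin 2) K} {m n : ℕ}
    (hp : p.IsWeightedHomogeneous biWeight (m, n)) (c d : K) (a b : Fin 2 → K) :
    eval (Sum.elim (c • a) (d • b)) p = c ^ m * d ^ n * eval (Sum.elim a b) p := by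
  obtain ⟨A, hA, rfl⟩ := bs_decomp hp
  rw [bs_eval_form, bs_eval_form, Finset.mul_sum]
  refine Finset.sum_congr rfl fun j hj => ?_
  rw [bs_eval_smul (hA j)]
  have : n = j + (n - j) := by rw [Finset.mem_range] at hj; omega
  conv_rhs => rw [this, pow_add]
  simp only [Pi.smul_apply, smul_eq_mul, mul_pow, Nat.add_sub_cancel_left]
  ring

lemma bs_pd_inl (i : Fin 2) (A : MvPolynomial (Fin 2) K) :
    pderiv (Sum.inl i : Fin 2 ⊕ Fin 2) (rename Sum.inl A) = rename Sum.inl (pderiv i A) :=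
  pderiv_rename Sum.inl_injective _ _

lemma bs_pd_inr (i : Fin 2) (A : MvPolynomial (Fin 2) K) :
    pderiv (Sum.inr i : Fin 2 ⊕ Fin 2) (rename Sum.inl A) = 0 := by
  classical
  apply pderiv_eq_zero_of_notMem_vars
  intro h
  have := vars_rename Sum.inl A h
  simp at this

lemma bs_swap {p : MvPolynomial (Fin 2 ⊕ Fin 2) K} {m n : ℕ}
    (hp : p.IsWeightedHomogeneous biWeight (m, n)) :
    (rename Sum.swap p).IsWeightedHomogeneous biWeight (n, m) := by
  induction hp using IsWeightedHomogeneous.induction_on with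
  | zero => simpa using isWeightedHomogeneous_zero _ _ _
  | add p q _ _ h1 h2 => rw [map_add]; exact h1.add h2
  | monomial d r hr =>
    rw [rename_monomial]
    apply isWeightedHomogeneous_monomial
    rw [bs_weight, Prod.mk.injEq] at hr ⊢
    have h : ∀ x, Finsupp.mapDomain Sum.swap d x = d (Sum.swap x) := by
      intro x
      have := Finsupp.mapDomain_apply (Sum.swap_leftInverse (α := Fin 2) (β := Fin 2)).injective d x.swap
      simpa using this
    simp only [h, Sum.swap_inl, Sum.swap_inr]
    exact ⟨hr.2, hr.1⟩

lemma bs_swap_eval (p : MvPolynomial (Fin 2 ⊕ Fin 2) K) (a b : Fin 2 → K) :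
    eval (Sum.elim a b) (rename Sum.swap p) = eval (Sum.elim b a) p := by
  rw [eval_rename]
  congr 2
  ext (i | i) <;> simp

/-- nonsingularity of the quartic, in adapted coordinates -/
def BSSmooth (f : MvPolynomial (Fin 2 ⊕ Fin 2) K) : Prop :=
  ∀ a b : Fin 2 → K, (a ≠ 0 ∨ b ≠ 0) → eval (Sum.elim a b) f = 0 →
    (∀ i, eval (Sum.elim a b) (pderiv i f) = 0) → False

lemma bs_swap_pderiv (p : MvPolynomial (Fin 2 ⊕ Fin 2) K) (i : Fin 2 ⊕ Fin 2) :
    pderiv i (rename Sum.swap p) = rename Sum.swap (pderiv i.swap p) := by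
  have := pderiv_rename (Sum.swap_leftInverse (α := Fin 2) (β := Fin 2)).injective i.swap p
  simpa using this

lemma bs_swap_smooth {f : MvPolynomial (Fin 2 ⊕ Fin 2) K} (hf : BSSmooth f) :
    BSSmooth (rename Sum.swap f) := by
  intro a b hab h0 h1
  rw [bs_swap_eval] at h0
  refine hf b a hab.symm h0 fun i => ?_
  have := h1 i.swap
  rwa [bs_swap_pderiv, bs_swap_eval, Sum.swap_swap] at this

/-- at each point of the line `y = 0`, some `y`-derivative of `α` is nonzero -/
lemma bs_nonvanish {α β γ : MvPolynomial (Fin 2 ⊕ Fin 2) K}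
    (hα : α.IsWeightedHomogeneous biWeight (3, 1))
    (hβ : β.IsWeightedHomogeneous biWeight (2, 2))
    (hγ : γ.IsWeightedHomogeneous biWeight (1, 3)) (hs : BSSmooth (α + β + γ))
    (a b : Fin 2 → K) (ha : a ≠ 0)
    (h : ∀ i, eval (Sum.elim a b) (pderiv (Sum.inr i) α) = 0) : False := by
  obtain ⟨A, -, rfl⟩ := bs_decomp hα
  obtain ⟨B, -, rfl⟩ := bs_decomp hβ
  obtain ⟨G, -, rfl⟩ := bs_decomp hγ
  have h0 := h 0
  have h1 := h 1
  simp [bsForm, Finset.sum_range_succ, bs_pd_inr, eval_rename, pderiv_X] at h0 h1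
  refine hs a 0 (Or.inl ha) ?_ ?_
  · simp [bs_eval_form, Finset.sum_range_succ]
  · rintro (i | i)
    · simp [bsForm, Finset.sum_range_succ, bs_pd_inl, eval_rename, pderiv_X]
    · fin_cases i <;>
      simp [bsForm, Finset.sum_range_succ, bs_pd_inr, eval_rename, pderiv_X, h0, h1]

lemma bs_nonvanish' {α β γ : MvPolynomial (Fin 2 ⊕ Fin 2) K}
    (hα : α.IsWeightedHomogeneous biWeight (3, 1))
    (hβ : β.IsWeightedHomogeneous biWeight (2, 2))
    (hγ : γ.IsWeightedHomogeneous biWeight (1, 3)) (hs : BSSmooth (α + β + γ))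
    (a b : Fin 2 → K) (hb : b ≠ 0)
    (h : ∀ i, eval (Sum.elim a b) (pderiv (Sum.inl i) γ) = 0) : False := by
  refine bs_nonvanish (bs_swap hγ) (bs_swap hβ) (bs_swap hα) ?_ b a hb ?_
  · have := bs_swap_smooth hs
    rw [map_add, map_add] at this
    convert this using 1
    ring
  · intro i
    rw [bs_swap_pderiv, bs_swap_eval]
    exact h i

lemma bs_alpha {α β γ : MvPolynomial (Fin 2 ⊕ Fin 2) K}
    (hα : α.IsWeightedHomogeneous biWeight (3, 1))
    (hβ : β.IsWeightedHomogeneous biWeight (2, 2))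
    (hγ : γ.IsWeightedHomogeneous biWeight (1, 3)) (hs : BSSmooth (α + β + γ)) :
    ∃ A B : MvPolynomial (Fin 2) K, A.IsHomogeneous 3 ∧ B.IsHomogeneous 3 ∧
      α = rename Sum.inl A * X (Sum.inr 0) + rename Sum.inl B * X (Sum.inr 1) ∧
      ∀ a, a ≠ 0 → eval a A = 0 → eval a B = 0 → False := by
  obtain ⟨A, hA, rfl⟩ := bs_decomp hα
  refine ⟨A 1, A 0, hA 1, hA 0, ?_, ?_⟩
  · simp [bsForm, Finset.sum_range_succ]; ring
  · intro a ha h1 h0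
    refine bs_nonvanish hα hβ hγ hs a 0 ha ?_
    intro i
    fin_cases i <;>
      simp [bsForm, Finset.sum_range_succ, bs_pd_inr, eval_rename, pderiv_X, h0, h1]

variable [IsAlgClosed K]

lemma bs_AB {A B : MvPolynomial (Fin 2) K} (hA : A.IsHomogeneous 3) (hB : B.IsHomogeneous 3)
    (h : ∀ a, a ≠ 0 → eval a A = 0 → eval a B = 0 → False) :
    A ≠ 0 ∧ B ≠ 0 ∧ IsRelPrime A B := by
  have hA0 : A ≠ 0 := by
    rintro rfl
    obtain ⟨a, ha, h0⟩ := bs_exists_zero hB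
    exact h a ha (by simp) h0
  have hB0 : B ≠ 0 := by
    rintro rfl
    obtain ⟨a, ha, h0⟩ := bs_exists_zero hA
    exact h a ha h0 (by simp)
  refine ⟨hA0, hB0, ?_⟩
  have := bs_relprime id Function.injective_id B hA hA0 (fun a ha h0 => ⟨a, rfl, h a ha h0⟩)
  rwa [rename_id_apply] at this

lemma bs_irreducible {α β γ : MvPolynomial (Fin 2 ⊕ Fin 2) K}
    (hα : α.IsWeightedHomogeneous biWeight (3, 1))
    (hβ : β.IsWeightedHomogeneous biWeight (2, 2))
    (hγ : γ.IsWeightedHomogeneous biWeight (1, 3)) (hs : BSSmooth (α + β + γ)) :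
    Irreducible α := by
  classical
  obtain ⟨A, B, hA, hB, rfl, h⟩ := bs_alpha hα hβ hγ hs
  obtain ⟨hA0, hB0, hAB⟩ := bs_AB hA hB h
  apply irreducible_mul_X_add
  · rwa [Ne, map_eq_zero_iff _ (rename_injective _ Sum.inl_injective)]
  · intro hm
    have := vars_rename Sum.inl A hm
    simp at this
  · intro hm
    have := vars_mul _ _ hm
    rw [vars_X, Finset.mem_union] at this
    rcases this with h | h
    · have := vars_rename Sum.inl B h
      simp at this
    · simp at h
  · refine bs_relprime Sum.inl Sum.inl_injective _ hA hA0 fun a ha h0 => ?_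
    refine ⟨Sum.elim a 1, by simp, ?_⟩
    simpa [eval_rename] using h a ha h0

lemma bs_irreducible' {α β γ : MvPolynomial (Fin 2 ⊕ Fin 2) K}
    (hα : α.IsWeightedHomogeneous biWeight (3, 1))
    (hβ : β.IsWeightedHomogeneous biWeight (2, 2))
    (hγ : γ.IsWeightedHomogeneous biWeight (1, 3)) (hs : BSSmooth (α + β + γ)) :
    Irreducible γ := by
  have := bs_irreducible (bs_swap hγ) (bs_swap hβ) (bs_swap hα) (by
    have := bs_swap_smooth hs
    rw [map_add, map_add] at this
    convert this using 1
    ring)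
  exact (MulEquiv.irreducible_iff (renameEquiv K (Equiv.sumComm (Fin 2) (Fin 2)))).1 this

end aux2

section aux3

variable {K : Type*} [Field K]

lemma bs_par {a v : Fin 2 → K} (ha : a ≠ 0) (h : v 0 * a 1 - a 0 * v 1 = 0) :
    ∃ s : K, v = s • a := by
  by_cases h0 : a 0 = 0
  · have h1 : a 1 ≠ 0 := by
      intro h1; apply ha; ext i; fin_cases i <;> simp [h0, h1]
    refine ⟨v 1 / a 1, ?_⟩
    ext i; fin_cases i
    · have : v 0 = 0 := by simpa [h0, h1] using h
      simp [h0, this]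
    · simp [h1]
  · refine ⟨v 0 / a 0, ?_⟩
    ext i; fin_cases i
    · simp [h0]
    · simp; field_simp; linear_combination -h

lemma bs_perp {a : Fin 2 → K} (ha : a ≠ 0) {l m : K} (h : a 0 * l + a 1 * m = 0) :
    ∃ p : K, l = p * a 1 ∧ m = - (p * a 0) := by
  obtain ⟨s, hs⟩ := bs_par (v := ![-m, l]) ha (by simp; linear_combination -h)
  have h0 := congrFun hs 0
  have h1 := congrFun hs 1
  simp at h0 h1
  exact ⟨s, h1, by rw [← h0]; ring⟩

/-- restriction of a bihomogeneous form to the rational curve `A y₀ + B y₁ = 0`. -/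
def bsRes (n : ℕ) (P : ℕ → MvPolynomial (Fin 2) K) (A B : MvPolynomial (Fin 2) K) :
    MvPolynomial (Fin 2) K :=
  ∑ j ∈ Finset.range (n + 1), P j * (B ^ j * (-A) ^ (n - j))

lemma bs_res_hom {m n : ℕ} {P : ℕ → MvPolynomial (Fin 2) K} (hP : ∀ j, (P j).IsHomogeneous m)
    {A B : MvPolynomial (Fin 2) K} (hA : A.IsHomogeneous 3) (hB : B.IsHomogeneous 3) :
    (bsRes n P A B).IsHomogeneous (m + 3 * n) := by
  apply IsHomogeneous.sum
  intro j hj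
  have h := (hP j).mul ((hB.pow j).mul (hA.neg.pow (n - j)))
  have e : m + 3 * n = m + (3 * j + 3 * (n - j)) := by
    rw [Finset.mem_range] at hj; omega
  rw [e]; exact h

lemma bs_res_zero {n : ℕ} {P : ℕ → MvPolynomial (Fin 2) K}
    {A B : MvPolynomial (Fin 2) K}
    (a b : Fin 2 → K) (hb : b ≠ 0)
    (h0 : eval (Sum.elim a b)
      (rename Sum.inl A * X (Sum.inr 0) + rename Sum.inl B * X (Sum.inr 1)) = 0)
    (h1 : eval (Sum.elim a b) (bsForm n P) = 0) : eval a (bsRes n P A B) = 0 := by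
  simp [eval_rename] at h0
  obtain ⟨s, hs⟩ := bs_par (v := ![eval a B, - eval a A]) hb (by simp; linear_combination h0)
  have hs0 : eval a B = s * b 0 := by simpa using congrFun hs 0
  have hs1 : - eval a A = s * b 1 := by simpa using congrFun hs 1
  have : eval a (bsRes n P A B) = s ^ n * eval (Sum.elim a b) (bsForm n P) := by
    rw [bs_eval_form, bsRes, map_sum, Finset.mul_sum]
    refine Finset.sum_congr rfl fun j hj => ?_
    have e : n = j + (n - j) := by rw [Finset.mem_range] at hj; omega
    conv_rhs => rw [e, pow_add]
    simp only [map_mul, map_pow, map_neg, hs0, hs1, Nat.add_sub_cancel_left]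
    ring
  rw [this, h1, mul_zero]

lemma bs_transversal [IsAlgClosed K] {α γ : MvPolynomial (Fin 2 ⊕ Fin 2) K}
    (hα : α.IsWeightedHomogeneous biWeight (3, 1))
    (hγ : γ.IsWeightedHomogeneous biWeight (1, 3)) (hs : BSSmooth (α + γ))
    (a b : Fin 2 → K) (ha : a ≠ 0) (hb : b ≠ 0)
    (h0 : eval (Sum.elim a b) α = 0) (h1 : eval (Sum.elim a b) γ = 0)
    (v w : Fin 2 → K) (d0 : dirDeriv α a b v w = 0) (d1 : dirDeriv γ a b v w = 0) :
    ∃ s t : K, v = s • a ∧ w = t • b := by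
  have hβ : (0 : MvPolynomial (Fin 2 ⊕ Fin 2) K).IsWeightedHomogeneous biWeight (2, 2) :=
    isWeightedHomogeneous_zero _ _ _
  have hs' : BSSmooth (α + 0 + γ) := by rwa [add_zero]
  have n1 := bs_nonvanish hα hβ hγ hs' a b ha
  have n2 := bs_nonvanish' hα hβ hγ hs' a b hb
  obtain ⟨A, hA, rfl⟩ := bs_decomp hα
  obtain ⟨G, hG, rfl⟩ := bs_decomp hγ
  have eA := fun j => congrArg (eval a) (hA j).sum_X_mul_pderiv
  have eG := fun j => congrArg (eval a) (hG j).sum_X_mul_pderiv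
  simp [Fin.sum_univ_two] at eA eG
  have S : ∀ t : K, t ≠ 0 → ¬ ∀ i : Fin 2,
      (eval (Sum.elim a b) (pderiv (Sum.inl i) (bsForm 1 A)) +
      t ^ 2 * eval (Sum.elim a b) (pderiv (Sum.inl i) (bsForm 3 G)) = 0 ∧
      eval (Sum.elim a b) (pderiv (Sum.inr i) (bsForm 1 A)) +
      t ^ 2 * eval (Sum.elim a b) (pderiv (Sum.inr i) (bsForm 3 G)) = 0) := by
    intro t ht H
    refine hs a (t • b) (Or.inl ha) ?_ ?_
    · have := bs_scale hα 1 t a b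
      rw [one_smul] at this
      rw [map_add, this, h0]
      have := bs_scale hγ 1 t a b
      rw [one_smul] at this
      rw [this, h1]; ring
    · rintro (i | i)
      · have := (H i).1
        rw [← mul_right_inj' ht, mul_zero] at this
        rw [← this]
        simp [bsForm, Finset.sum_range_succ, bs_pd_inl, eval_rename, pderiv_X]
        ring
      · have := (H i).2
        rw [← this]
        fin_cases i <;>
        · simp [bsForm, Finset.sum_range_succ, bs_pd_inr, eval_rename, pderiv_X]
          ring
  -- Euler relations
  have E1 : a 0 * eval (Sum.elim a b) (pderiv (Sum.inl 0) (bsForm 1 A)) +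
      a 1 * eval (Sum.elim a b) (pderiv (Sum.inl 1) (bsForm 1 A)) = 0 := by
    rw [bs_eval_form] at h0
    simp [Finset.sum_range_succ] at h0
    simp [bsForm, Finset.sum_range_succ, bs_pd_inl, eval_rename, pderiv_X]
    linear_combination 3 * h0 + eA 0 * b 1 + eA 1 * b 0
  have E2 : b 0 * eval (Sum.elim a b) (pderiv (Sum.inr 0) (bsForm 1 A)) +
      b 1 * eval (Sum.elim a b) (pderiv (Sum.inr 1) (bsForm 1 A)) = 0 := by
    rw [bs_eval_form] at h0
    simp [Finset.sum_range_succ] at h0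
    simp [bsForm, Finset.sum_range_succ, bs_pd_inr, eval_rename, pderiv_X]
    linear_combination h0
  have E3 : a 0 * eval (Sum.elim a b) (pderiv (Sum.inl 0) (bsForm 3 G)) +
      a 1 * eval (Sum.elim a b) (pderiv (Sum.inl 1) (bsForm 3 G)) = 0 := by
    rw [bs_eval_form] at h1
    simp [Finset.sum_range_succ] at h1
    simp [bsForm, Finset.sum_range_succ, bs_pd_inl, eval_rename, pderiv_X]
    linear_combination h1 + eG 0 * b 1 ^ 3 + eG 1 * b 0 * b 1 ^ 2 + eG 2 * b 0 ^ 2 * b 1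
      + eG 3 * b 0 ^ 3
  have E4 : b 0 * eval (Sum.elim a b) (pderiv (Sum.inr 0) (bsForm 3 G)) +
      b 1 * eval (Sum.elim a b) (pderiv (Sum.inr 1) (bsForm 3 G)) = 0 := by
    rw [bs_eval_form] at h1
    simp [Finset.sum_range_succ] at h1
    simp [bsForm, Finset.sum_range_succ, bs_pd_inr, eval_rename, pderiv_X]
    linear_combination 3 * h1
  obtain ⟨p, p0, p1⟩ := bs_perp ha E1
  obtain ⟨q, q0, q1⟩ := bs_perp hb E2
  obtain ⟨p', p'0, p'1⟩ := bs_perp ha E3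
  obtain ⟨q', q'0, q'1⟩ := bs_perp hb E4
  simp only [dirDeriv, Fin.sum_univ_two, p0, p1, q0, q1, p'0, p'1, q'0, q'1] at d0 d1
  simp only [Fin.forall_fin_two, p0, p1, q0, q1, p'0, p'1, q'0, q'1] at S n1 n2
  have hq : q ≠ 0 := by rintro rfl; simp at n1
  have hp' : p' ≠ 0 := by rintro rfl; simp at n2
  have hdet : p * q' - p' * q ≠ 0 := by
    intro hd
    have hp : p ≠ 0 := by
      rintro rfl
      apply mul_ne_zero hp' hq
      linear_combination -hd
    obtain ⟨t, ht⟩ := IsAlgClosed.exists_pow_nat_eq (-p / p') (n := 2) (by norm_num)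
    have ht0 : t ≠ 0 := by
      rintro rfl
      have : -p / p' ≠ 0 := div_ne_zero (neg_ne_zero.2 hp) hp'
      exact this (by rw [← ht]; simp)
    have k1 : p + t ^ 2 * p' = 0 := by rw [ht]; field_simp; ring
    have k2 : q + t ^ 2 * q' = 0 := by
      rw [ht]; field_simp; linear_combination -hd
    refine S t ht0 ⟨⟨?_, ?_⟩, ?_, ?_⟩
    · linear_combination a 1 * k1
    · linear_combination b 1 * k2
    · linear_combination -a 0 * k1
    · linear_combination -b 0 * k2
  have V : v 0 * a 1 - a 0 * v 1 = 0 := by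
    apply (mul_eq_zero.1 (_ : (p * q' - p' * q) * _ = 0)).resolve_left hdet
    linear_combination q' * d0 - q * d1
  have W : w 0 * b 1 - b 0 * w 1 = 0 := by
    apply (mul_eq_zero.1 (_ : (p * q' - p' * q) * _ = 0)).resolve_left hdet
    linear_combination p * d1 - p' * d0
  obtain ⟨s, hs⟩ := bs_par ha V
  obtain ⟨t, ht⟩ := bs_par hb W
  exact ⟨s, t, hs, ht⟩

variable [IsAlgClosed K]

/-- The intersection number argument for `β`. -/
lemma bs_beta_zero {α β γ : MvPolynomial (Fin 2 ⊕ Fin 2) K}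
    (hα : α.IsWeightedHomogeneous biWeight (3, 1))
    (hβ : β.IsWeightedHomogeneous biWeight (2, 2))
    (hγ : γ.IsWeightedHomogeneous biWeight (1, 3)) (hs : BSSmooth (α + β + γ))
    (p q : Fin 9 → Fin 2 → K) (hq : ∀ i, q i ≠ 0)
    (hp : ∀ i j, i ≠ j → p i 0 * p j 1 - p j 0 * p i 1 ≠ 0)
    (h0 : ∀ i, eval (Sum.elim (p i) (q i)) α = 0)
    (h1 : ∀ i, eval (Sum.elim (p i) (q i)) β = 0) : β = 0 := by
  obtain ⟨A, B, hA, hB, rfl, h⟩ := bs_alpha hα hβ hγ hs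
  obtain ⟨hA0, hB0, hAB⟩ := bs_AB hA hB h
  obtain ⟨P, hP, rfl⟩ := bs_decomp hβ
  have hG := bs_form_zero (bs_res_hom (n := 2) hP hA hB) p hp
    (fun i => bs_res_zero _ _ (hq i) (h0 i) (h1 i))
  simp [bsRes, Finset.sum_range_succ] at hG
  have P2 : P 2 = 0 := by
    apply bs_dvd_zero hA (hP 2) (by norm_num)
    apply (hAB.pow_right (n := 2)).dvd_of_dvd_mul_right
    exact ⟨P 1 * B - P 0 * A, by linear_combination hG⟩
  have P0 : P 0 = 0 := by
    apply bs_dvd_zero hB (hP 0) (by norm_num)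
    apply (hAB.symm.pow_right (n := 2)).dvd_of_dvd_mul_right
    exact ⟨P 1 * A - P 2 * B, by linear_combination hG⟩
  have P1 : P 1 = 0 := by
    rw [P2, P0] at hG
    simpa [hA0, hB0] using hG
  simp [bsForm, Finset.sum_range_succ, P0, P1, P2]

lemma bs_gamma_ne {α γ : MvPolynomial (Fin 2 ⊕ Fin 2) K}
    (hα : α.IsWeightedHomogeneous biWeight (3, 1))
    (hγ : γ.IsWeightedHomogeneous biWeight (1, 3)) (hs : BSSmooth (α + γ))
    (p q : Fin 11 → Fin 2 → K) (hq : ∀ i, q i ≠ 0)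
    (hp : ∀ i j, i ≠ j → p i 0 * p j 1 - p j 0 * p i 1 ≠ 0)
    (h0 : ∀ i, eval (Sum.elim (p i) (q i)) α = 0)
    (h1 : ∀ i, eval (Sum.elim (p i) (q i)) γ = 0) : False := by
  have hβ : (0 : MvPolynomial (Fin 2 ⊕ Fin 2) K).IsWeightedHomogeneous biWeight (2, 2) :=
    isWeightedHomogeneous_zero _ _ _
  have hs' : BSSmooth (α + 0 + γ) := by rwa [add_zero]
  have hγ0 : γ ≠ 0 := (bs_irreducible' hα hβ hγ hs').ne_zero
  obtain ⟨A, B, hA, hB, rfl, h⟩ := bs_alpha hα hβ hγ hs'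
  obtain ⟨hA0, hB0, hAB⟩ := bs_AB hA hB h
  obtain ⟨P, hP, rfl⟩ := bs_decomp hγ
  have hG := bs_form_zero (bs_res_hom (n := 3) hP hA hB) p hp
    (fun i => bs_res_zero _ _ (hq i) (h0 i) (h1 i))
  simp [bsRes, Finset.sum_range_succ] at hG
  have P3 : P 3 = 0 := by
    apply bs_dvd_zero hA (hP 3) (by norm_num)
    apply (hAB.pow_right (n := 3)).dvd_of_dvd_mul_right
    exact ⟨P 2 * B ^ 2 - P 1 * A * B + P 0 * A ^ 2, by linear_combination hG⟩
  have P0 : P 0 = 0 := by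
    apply bs_dvd_zero hB (hP 0) (by norm_num)
    apply (hAB.symm.pow_right (n := 3)).dvd_of_dvd_mul_right
    exact ⟨P 1 * A ^ 2 - P 2 * A * B + P 3 * B ^ 2, by linear_combination -hG⟩
  have hG2 : P 1 * A = P 2 * B := by
    have : A * B * (P 1 * A - P 2 * B) = 0 := by
      rw [P3, P0] at hG
      linear_combination hG
    simpa [hA0, hB0, sub_eq_zero] using this
  have P2 : P 2 = 0 := by
    apply bs_dvd_zero hA (hP 2) (by norm_num)
    apply hAB.dvd_of_dvd_mul_right
    exact ⟨P 1, by rw [← hG2]; ring⟩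
  have P1 : P 1 = 0 := by
    rw [P2] at hG2
    simpa [hA0] using hG2
  apply hγ0
  simp [bsForm, Finset.sum_range_succ, P0, P1, P2, P3]

lemma bs_inter {α γ : MvPolynomial (Fin 2 ⊕ Fin 2) K}
    (hα : α.IsWeightedHomogeneous biWeight (3, 1))
    (hγ : γ.IsWeightedHomogeneous biWeight (1, 3)) (hs : BSSmooth (α + γ))
    (p q : Fin 10 → Fin 2 → K) (hp0 : ∀ i, p i ≠ 0) (hq : ∀ i, q i ≠ 0)
    (hp : ∀ i j, i ≠ j → p i 0 * p j 1 - p j 0 * p i 1 ≠ 0)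
    (h0 : ∀ i, eval (Sum.elim (p i) (q i)) α = 0)
    (h1 : ∀ i, eval (Sum.elim (p i) (q i)) γ = 0) : (interPoints α γ).ncard = 10 := by
  have hβ : (0 : MvPolynomial (Fin 2 ⊕ Fin 2) K).IsWeightedHomogeneous biWeight (2, 2) :=
    isWeightedHomogeneous_zero _ _ _
  have hs' : BSSmooth (α + 0 + γ) := by rwa [add_zero]
  have key : interPoints α γ = Set.range (fun i : Fin 10 =>
      (Submodule.span K {p i}, Submodule.span K {q i})) := by
    ext ⟨P, Q⟩
    constructor
    · rintro ⟨hP, hQ, H⟩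
      obtain ⟨a, ha, hPa⟩ := finrank_eq_one_iff'.1 hP
      obtain ⟨b, hb, hQb⟩ := finrank_eq_one_iff'.1 hQ
      dsimp only at *
      have ha' : (a : Fin 2 → K) ≠ 0 := by simpa using ha
      have hb' : (b : Fin 2 → K) ≠ 0 := by simpa using hb
      obtain ⟨z0, z1⟩ := H a a.2 b b.2
      obtain ⟨i, hi⟩ : ∃ i, (a : Fin 2 → K) 0 * p i 1 - p i 0 * (a : Fin 2 → K) 1 = 0 := by
        by_contra! hne
        refine bs_gamma_ne hα hγ hs (Fin.cons a p) (Fin.cons b q) ?_ ?_ ?_ ?_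
        · intro i; refine Fin.cases ?_ (fun i => ?_) i
          · exact hb'
          · exact hq i
        · intro i j
          refine Fin.cases ?_ (fun i => ?_) i <;> refine Fin.cases ?_ (fun j => ?_) j
          · intro h; exact absurd rfl h
          · intro _; exact hne j
          · intro _ h; apply hne i
            simp only [Fin.cons_zero, Fin.cons_succ] at h
            linear_combination -h
          · intro h; exact hp i j (fun h' => h (by rw [h']))
        · intro i; refine Fin.cases ?_ (fun i => ?_) i
          · exact z0
          · exact h0 i
        · intro i; refine Fin.cases ?_ (fun i => ?_) i
          · exact z1
          · exact h1 i
      obtain ⟨s, hsa⟩ := bs_par (hp0 i) hi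
      have hs0 : s ≠ 0 := by rintro rfl; simp at hsa; exact ha hsa
      have z2 : eval (Sum.elim (p i) b) α = 0 := by
        have := bs_scale hα s 1 (p i) b
        rw [← hsa, one_smul, z0] at this
        simpa [hs0] using this.symm
      obtain ⟨A, B, hA, hB, rfl, h⟩ := bs_alpha hα hβ hγ hs'
      have z3 := h0 i
      simp [eval_rename] at z2 z3
      obtain ⟨t, ht⟩ : ∃ t : K, (b : Fin 2 → K) = t • q i := by
        apply bs_par (hq i)
        by_contra hne
        refine h (p i) (hp0 i) ?_ ?_
        · apply mul_left_cancel₀ hne; rw [mul_zero]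
          linear_combination q i 1 * z2 - b.1 1 * z3
        · apply mul_left_cancel₀ hne; rw [mul_zero]
          linear_combination b.1 0 * z3 - q i 0 * z2
      have ht0 : t ≠ 0 := by rintro rfl; simp at ht; exact hb ht
      refine ⟨i, ?_⟩
      have sp : ∀ (Q : Submodule K (Fin 2 → K)) (b : Q) (x : Fin 2 → K) (t : K), t ≠ 0 →
          (b : Fin 2 → K) = t • x → (∀ w : Q, ∃ c : K, c • b = w) → Submodule.span K {x} = Q := by
        intro Q b x t ht hb hw
        apply le_antisymm
        · rw [Submodule.span_singleton_le_iff_mem]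
          have : x = t⁻¹ • (b : Fin 2 → K) := by rw [hb, smul_smul, inv_mul_cancel₀ ht, one_smul]
          rw [this]; exact Q.smul_mem _ b.2
        · intro y hy
          obtain ⟨c, hc⟩ := hw ⟨y, hy⟩
          have : y = c • (b : Fin 2 → K) := (congrArg Subtype.val hc).symm
          rw [this, hb, smul_smul]
          exact Submodule.smul_mem _ _ (Submodule.mem_span_singleton_self _)
      simp only [Prod.mk.injEq]
      exact ⟨sp P a _ s hs0 hsa hPa, sp Q b _ t ht0 ht hQb⟩
    · rintro ⟨i, hi⟩
      simp only [Prod.mk.injEq] at hi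
      obtain ⟨rfl, rfl⟩ := hi
      refine ⟨finrank_span_singleton (hp0 i), finrank_span_singleton (hq i), ?_⟩
      intro a ha b hb
      obtain ⟨s, rfl⟩ := Submodule.mem_span_singleton.1 ha
      obtain ⟨t, rfl⟩ := Submodule.mem_span_singleton.1 hb
      rw [bs_scale hα, bs_scale hγ, h0, h1]
      simp
  rw [key, ← Set.image_univ, Set.ncard_image_of_injective]
  · simp [Set.ncard_univ]
  · intro i j hij
    by_contra hne
    simp only [Prod.mk.injEq] at hij
    have : p i ∈ Submodule.span K {p j} := by
      rw [← hij.1]; exact Submodule.mem_span_singleton_self _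
    obtain ⟨c, hc⟩ := Submodule.mem_span_singleton.1 this
    apply hp i j hne
    rw [← hc]
    simp; ring

end aux3

section aux4

variable {K : Type*} [Field K]

/-- homogeneity bookkeeping for polynomials in the parameter `s` -/
def BSGood (d : ℕ) (Q : Polynomial (MvPolynomial (Fin 2 ⊕ Fin 2) K)) : Prop :=
  ∀ n, Q.coeff n = 0 ∨ ∃ m, n + m = d ∧ (Q.coeff n).IsWeightedHomogeneous biWeight (n, m)

lemma BSGood.mul {d d' : ℕ} {Q Q' : Polynomial (MvPolynomial (Fin 2 ⊕ Fin 2) K)}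
    (h : BSGood d Q) (h' : BSGood d' Q') : BSGood (d + d') (Q * Q') := by
  intro n
  have key : ∀ i j, i + j = n → Q.coeff i * Q'.coeff j = 0 ∨
      ∃ m, n + m = d + d' ∧ (Q.coeff i * Q'.coeff j).IsWeightedHomogeneous biWeight (n, m) := by
    intro i j hij
    rcases h i with h1 | ⟨m, hm, h1⟩
    · left; rw [h1, zero_mul]
    rcases h' j with h2 | ⟨m', hm', h2⟩
    · left; rw [h2, mul_zero]
    right
    refine ⟨m + m', by omega, ?_⟩
    have := h1.mul h2
    rwa [Prod.mk_add_mk, hij] at this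
  rw [Polynomial.coeff_mul]
  by_cases hn : n ≤ d + d'
  · right
    refine ⟨d + d' - n, by omega, ?_⟩
    apply IsWeightedHomogeneous.sum
    rintro ⟨i, j⟩ hij
    rcases key i j (by simpa using hij) with h0 | ⟨m, hm, h0⟩
    · dsimp only; rw [h0]; exact isWeightedHomogeneous_zero _ _ _
    · have : d + d' - n = m := by omega
      rw [this]; exact h0
  · left
    apply Finset.sum_eq_zero
    rintro ⟨i, j⟩ hij
    rcases key i j (by simpa using hij) with h0 | ⟨m, hm, h0⟩
    · exact h0
    · omega

lemma BSGood.C (c : K) : BSGood 0 (Polynomial.C (MvPolynomial.C c)) := by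
  intro n
  rw [Polynomial.coeff_C]
  split_ifs with h
  · right
    subst h
    exact ⟨0, rfl, isWeightedHomogeneous_C _ _⟩
  · left; rfl

lemma BSGood.pow {d : ℕ} {Q : Polynomial (MvPolynomial (Fin 2 ⊕ Fin 2) K)}
    (h : BSGood d Q) (n : ℕ) : BSGood (d * n) (Q ^ n) := by
  induction n with
  | zero => simpa using BSGood.C (1 : K)
  | succ n ih => rw [pow_succ, mul_add, mul_one]; exact ih.mul h

lemma BSGood.line (u w : Fin 2 → Fin 4 → K) (i : Fin 4) : BSGood 1 (lineCoord u w i) := by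
  have hX : ∀ (j : Fin 2 ⊕ Fin 2) (c : K),
      (X j * MvPolynomial.C c : MvPolynomial (Fin 2 ⊕ Fin 2) K).IsWeightedHomogeneous biWeight
        (biWeight j) := by
    intro j c
    rw [mul_comm]
    exact (isWeightedHomogeneous_X _ _ _).C_mul c
  intro n
  rcases n with _ | _ | n
  · right
    refine ⟨1, rfl, ?_⟩
    simp only [lineCoord, Polynomial.coeff_add, Polynomial.coeff_mul_X_zero, zero_add,
      Polynomial.coeff_C_zero]
    exact (hX (Sum.inr 0) _).add (hX (Sum.inr 1) _)
  · right
    refine ⟨0, rfl, ?_⟩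
    simp only [lineCoord, Polynomial.coeff_add, Polynomial.coeff_C_mul_X, zero_add,
      Polynomial.coeff_C_succ, add_zero, if_true]
    exact (hX (Sum.inl 0) _).add (hX (Sum.inl 1) _)
  · left
    simp [lineCoord, -map_add, -map_mul]

lemma bs_good {F : MvPolynomial (Fin 4) K} (hF : F.IsHomogeneous 4) (u w : Fin 2 → Fin 4 → K) :
    BSGood 4 (MvPolynomial.aeval (lineCoord u w) F) := by
  have key : ∀ d ∈ F.support, BSGood 4 (aeval (lineCoord u w) (monomial d (coeff d F))) := by
    intro d hd
    have h4 := hF.degree_eq_sum_deg_support hd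
    rw [aeval_monomial, Finsupp.prod_fintype _ _ (by simp), Fin.prod_univ_four]
    have h5 : d 0 + d 1 + d 2 + d 3 = 4 := by
      rw [Finset.sum_subset (Finset.subset_univ _) (by simp), Fin.sum_univ_four] at h4
      exact h4.symm
    have := (BSGood.C (coeff d F)).mul (((((BSGood.line u w 0).pow (d 0)).mul
      ((BSGood.line u w 1).pow (d 1))).mul ((BSGood.line u w 2).pow (d 2))).mul
      ((BSGood.line u w 3).pow (d 3)))
    simp only [one_mul, zero_add, h5] at this
    exact this
  intro n
  rw [F.as_sum, map_sum, Polynomial.finsetSum_coeff]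
  by_cases hn : n ≤ 4
  · right
    refine ⟨4 - n, by omega, ?_⟩
    apply IsWeightedHomogeneous.sum
    intro d hd
    rcases key d hd n with h0 | ⟨m, hm, h0⟩
    · rw [h0]; exact isWeightedHomogeneous_zero _ _ _
    · have : 4 - n = m := by omega
      rw [this]; exact h0
  · left
    apply Finset.sum_eq_zero
    intro d hd
    rcases key d hd n with h0 | ⟨m, hm, h0⟩
    · exact h0
    · omega

lemma bs_resCoeff_wh {F : MvPolynomial (Fin 4) K} (hF : F.IsHomogeneous 4)
    (u w : Fin 2 → Fin 4 → K) (n m : ℕ) (h : n + m = 4) :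
    (resCoeff F u w n).IsWeightedHomogeneous biWeight (n, m) := by
  rcases bs_good hF u w n with h0 | ⟨m', hm, h0⟩
  · rw [resCoeff, h0]; exact isWeightedHomogeneous_zero _ _ _
  · have : m = m' := by omega
    rw [this]; exact h0

/-- the point with coordinates `x` in the basis `u` -/
def bsPt (u : Fin 2 → Fin 4 → K) (x : Fin 2 → K) : Fin 4 → K := ∑ j, x j • u j

/-- the restriction of `F` to a line -/
def bsPol (F : MvPolynomial (Fin 4) K) (u w : Fin 2 → Fin 4 → K) (x y : Fin 2 → K) :
    Polynomial K :=
  (MvPolynomial.aeval (lineCoord u w) F).map (eval (Sum.elim x y))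

lemma bs_pol_coeff (F : MvPolynomial (Fin 4) K) (u w : Fin 2 → Fin 4 → K) (x y : Fin 2 → K)
    (n : ℕ) : (bsPol F u w x y).coeff n = eval (Sum.elim x y) (resCoeff F u w n) := by
  rw [bsPol, Polynomial.coeff_map, resCoeff]

lemma bs_pol_eval (F : MvPolynomial (Fin 4) K) (u w : Fin 2 → Fin 4 → K) (x y : Fin 2 → K)
    (s : K) : (bsPol F u w x y).eval s = eval (s • bsPt u x + bsPt w y) F := by
  induction F using MvPolynomial.induction_on with
  | C c => simp [bsPol, Polynomial.algebraMap_apply]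
  | add p q hp hq => simp only [bsPol, map_add, Polynomial.map_add, Polynomial.eval_add] at *
                     rw [hp, hq]
  | mul_X p i hp =>
    simp only [bsPol, map_mul, Polynomial.map_mul, Polynomial.eval_mul] at *
    rw [hp]
    congr 1
    simp [lineCoord, bsPt, Fin.sum_univ_two]
    ring

lemma bs_pol_zero [Infinite K] (F : MvPolynomial (Fin 4) K) (u w : Fin 2 → Fin 4 → K)
    (x y : Fin 2 → K) (h : ∀ s : K, eval (s • bsPt u x + bsPt w y) F = 0) (n : ℕ) :
    eval (Sum.elim x y) (resCoeff F u w n) = 0 := by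
  rw [← bs_pol_coeff]
  have : bsPol F u w x y = 0 := by
    apply Polynomial.funext
    intro s
    rw [bs_pol_eval, h, Polynomial.eval_zero]
  rw [this, Polynomial.coeff_zero]

lemma bs_chain {σ τ : Type*} [Fintype σ] (g : σ → MvPolynomial τ K) (F : MvPolynomial σ K) (j : τ) :
    pderiv j (aeval g F) = ∑ i, aeval g (pderiv i F) * pderiv j (g i) := by
  classical
  induction F using MvPolynomial.induction_on with
  | C c => simp [MvPolynomial.algebraMap_eq]
  | add p q hp hq => simp only [map_add, hp, hq, add_mul, Finset.sum_add_distrib]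
  | mul_X p i hp =>
    simp only [map_mul, aeval_X, Derivation.leibniz, smul_eq_mul, hp, map_add, pderiv_X,
      add_mul, Finset.sum_add_distrib, Pi.single_apply]
    congr 1
    · rw [Finset.sum_eq_single i]
      · simp
      · intro k _ hk; simp [hk.symm]
      · simp
    · rw [Finset.mul_sum]
      exact Finset.sum_congr rfl fun k _ => by ring

/-- `F` in the coordinates given by `u`, `w` -/
lemma bs_sum {F : MvPolynomial (Fin 4) K} (hF : F.IsHomogeneous 4) (u w : Fin 2 → Fin 4 → K) :
    aeval (fun i => X (Sum.inl 0) * C (u 0 i) + X (Sum.inl 1) * C (u 1 i) +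
      (X (Sum.inr 0) * C (w 0 i) + X (Sum.inr 1) * C (w 1 i)) :
        Fin 4 → MvPolynomial (Fin 2 ⊕ Fin 2) K) F =
    resCoeff F u w 0 + resCoeff F u w 1 + resCoeff F u w 2 + resCoeff F u w 3 +
      resCoeff F u w 4 := by
  have h1 : aeval (fun i => X (Sum.inl 0) * C (u 0 i) + X (Sum.inl 1) * C (u 1 i) +
      (X (Sum.inr 0) * C (w 0 i) + X (Sum.inr 1) * C (w 1 i)) :
        Fin 4 → MvPolynomial (Fin 2 ⊕ Fin 2) K) F =
      (aeval (lineCoord u w) F).eval 1 := by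
    clear hF
    induction F using MvPolynomial.induction_on with
    | C c => simp [Polynomial.algebraMap_apply, MvPolynomial.algebraMap_eq]
    | add p q hp hq => rw [map_add, map_add, Polynomial.eval_add, hp, hq]
    | mul_X p i hp =>
      rw [map_mul, map_mul, Polynomial.eval_mul, hp]
      congr 1
      simp only [aeval_X, lineCoord, Polynomial.eval_add, Polynomial.eval_mul, Polynomial.eval_C,
        Polynomial.eval_X, mul_one]
  rw [h1, Polynomial.eval_eq_sum_range' (n := 5)]
  · simp [Finset.sum_range_succ, resCoeff]
  · rw [Nat.lt_succ_iff, Polynomial.natDegree_le_iff_coeff_eq_zero]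
    intro n hn
    rcases bs_good hF u w n with h0 | ⟨m, hm, h0⟩
    · exact h0
    · omega

end aux4

/-- (char ≠ 2) if a nonsingular quartic `X = {F = 0} ⊂ ℙ³` contains
twelve lines `a₁, …, a₁₀, b₁, b₂` forming `K₁₀,₂`, then the branch curve `D` of the
degree-2 morphism `π = π[b₁,b₂] : X → ℙ¹ × ℙ¹` (given by the discriminant
`β² − 4αγ` of the residual conic) splits as `π(b₁) ∪ π(b₂)`, the union of an
irreducible curve `{α = 0}` of bidegree `(3,1)` and an irreducible curve `{γ = 0}` of
bidegree `(1,3)`, meeting transversally at ten points. -/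
theorem branch_curve_splits {k : Type*} [Field k] [IsAlgClosed k]
    (hchar : (2 : k) ≠ 0)
    (F : MvPolynomial (Fin 4) k) (hF : F.IsHomogeneous 4)
    (hsm : ∀ v : Fin 4 → k, v ≠ 0 →
      ¬ (eval v F = 0 ∧ ∀ i, eval v (pderiv i F) = 0))
    (b₁ b₂ : Submodule k (Fin 4 → k))
    (hb₁ : Module.finrank k b₁ = 2) (hb₂ : Module.finrank k b₂ = 2)
    (hb₁X : ∀ v ∈ b₁, eval v F = 0) (hb₂X : ∀ v ∈ b₂, eval v F = 0)
    (hdisj : b₁ ⊓ b₂ = ⊥)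
    (a : Fin 10 → Submodule k (Fin 4 → k))
    (ha2 : ∀ i, Module.finrank k (a i) = 2)
    (haX : ∀ i, ∀ v ∈ a i, eval v F = 0)
    (haa : ∀ i j, i ≠ j → a i ⊓ a j = ⊥)
    (hab₁ : ∀ i, a i ⊓ b₁ ≠ ⊥) (hab₂ : ∀ i, a i ⊓ b₂ ≠ ⊥)
    -- bases of the two lines:
    (u w : Fin 2 → Fin 4 → k)
    (hu : ∀ j, u j ∈ b₂) (hus : Submodule.span k (Set.range u) = b₂)
    (hw : ∀ j, w j ∈ b₁) (hws : Submodule.span k (Set.range w) = b₁) :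
    ∃ c : k, c ≠ 0 ∧
      -- the branch curve splits off the images of the two lines:
      resCoeff F u w 2 ^ 2 - 4 * (resCoeff F u w 3 * resCoeff F u w 1) =
        C c * (resCoeff F u w 3 * resCoeff F u w 1) ∧
      -- `π(b₂) = {α = 0}` has bidegree `(3,1)` and `π(b₁) = {γ = 0}` bidegree `(1,3)`:
      (resCoeff F u w 3).IsWeightedHomogeneous biWeight (3, 1) ∧
      (resCoeff F u w 1).IsWeightedHomogeneous biWeight (1, 3) ∧
      Irreducible (resCoeff F u w 3) ∧ Irreducible (resCoeff F u w 1) ∧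
      -- the two curves meet at exactly ten points of `ℙ¹ × ℙ¹` …
      (interPoints (resCoeff F u w 3) (resCoeff F u w 1)).ncard = 10 ∧
      -- … and transversally: at a common zero, a common tangent vector is radial:
      (∀ av bv : Fin 2 → k, av ≠ 0 → bv ≠ 0 →
        eval (Sum.elim av bv) (resCoeff F u w 3) = 0 →
        eval (Sum.elim av bv) (resCoeff F u w 1) = 0 →
        ∀ v wv : Fin 2 → k,
          dirDeriv (resCoeff F u w 3) av bv v wv = 0 →
          dirDeriv (resCoeff F u w 1) av bv v wv = 0 →
          ∃ s t : k, v = s • av ∧ wv = t • bv) := by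
  have hWH := bs_resCoeff_wh hF u w
  have hα := hWH 3 1 rfl
  have hβ := hWH 2 2 rfl
  have hγ := hWH 1 3 rfl
  have hptu : ∀ x, bsPt u x ∈ b₂ := fun x => b₂.sum_mem fun j _ => b₂.smul_mem _ (hu j)
  have hptw : ∀ x, bsPt w x ∈ b₁ := fun x => b₁.sum_mem fun j _ => b₁.smul_mem _ (hw j)
  have hub : ∀ v ∈ b₂, ∃ x, bsPt u x = v := by
    intro v hv
    rw [← hus] at hv
    exact (Submodule.mem_span_range_iff_exists_fun k).1 hv
  have hwb : ∀ v ∈ b₁, ∃ x, bsPt w x = v := by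
    intro v hv
    rw [← hws] at hv
    exact (Submodule.mem_span_range_iff_exists_fun k).1 hv
  have hui : LinearIndependent k u := by
    rw [linearIndependent_iff_card_eq_finrank_span, Set.finrank, hus, hb₂]; simp
  have hwi : LinearIndependent k w := by
    rw [linearIndependent_iff_card_eq_finrank_span, Set.finrank, hws, hb₁]; simp
  have hu0 : ∀ x, bsPt u x = 0 → x = 0 := fun x hx =>
    funext (Fintype.linearIndependent_iff.1 hui x hx)
  have hw0 : ∀ x, bsPt w x = 0 → x = 0 := fun x hx =>
    funext (Fintype.linearIndependent_iff.1 hwi x hx)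
  have htop : b₁ ⊔ b₂ = ⊤ := by
    apply Submodule.eq_top_of_finrank_eq
    have := Submodule.finrank_sup_add_finrank_inf_eq b₁ b₂
    rw [hdisj, hb₁, hb₂, finrank_bot] at this
    simpa using this
  -- the extreme coefficients vanish
  have hc0 : resCoeff F u w 0 = 0 := by
    apply MvPolynomial.funext
    intro z
    rw [← Sum.elim_comp_inl_inr z, ← bs_pol_coeff, Polynomial.coeff_zero_eq_eval_zero, bs_pol_eval,
      zero_smul, zero_add, map_zero]
    exact hb₁X _ (hptw _)
  have hc4 : resCoeff F u w 4 = 0 := by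
    apply MvPolynomial.funext
    intro z
    rw [← Sum.elim_comp_inl_inr z, map_zero]
    have := bs_scale (hWH 4 0 rfl) 1 0 (z ∘ Sum.inl) (z ∘ Sum.inr)
    rw [one_smul, zero_smul, one_pow, pow_zero, one_mul, one_mul] at this
    rw [← this]
    apply bs_pol_zero
    intro s
    have h0 : bsPt w 0 = 0 := by simp [bsPt]
    rw [h0, add_zero]
    exact hb₂X _ (b₂.smul_mem _ (hptu _))
  have hsum := bs_sum hF u w
  rw [hc0, hc4, zero_add, add_zero] at hsum
  have hs : BSSmooth (resCoeff F u w 3 + resCoeff F u w 2 + resCoeff F u w 1) := by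
    have e : resCoeff F u w 3 + resCoeff F u w 2 + resCoeff F u w 1 =
      resCoeff F u w 1 + resCoeff F u w 2 + resCoeff F u w 3 := by ring
    rw [e, ← hsum]
    intro x y hxy h0 h1
    have hev : ∀ G : MvPolynomial (Fin 4) k, eval (Sum.elim x y) (aeval (fun i =>
        X (Sum.inl 0) * C (u 0 i) + X (Sum.inl 1) * C (u 1 i) +
        (X (Sum.inr 0) * C (w 0 i) + X (Sum.inr 1) * C (w 1 i)) :
        Fin 4 → MvPolynomial (Fin 2 ⊕ Fin 2) k) G) = eval (bsPt u x + bsPt w y) G := by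
      intro G
      induction G using MvPolynomial.induction_on with
      | C c => simp [MvPolynomial.algebraMap_eq]
      | add p q hp hq => rw [map_add, map_add, hp, hq, map_add]
      | mul_X p i hp =>
        rw [map_mul, map_mul, hp, map_mul]
        congr 1
        simp [bsPt, Fin.sum_univ_two]
    rw [hev] at h0
    refine hsm (bsPt u x + bsPt w y) ?_ ⟨h0, ?_⟩
    · intro hz
      have h2 : bsPt u x = - bsPt w y := eq_neg_of_add_eq_zero_left hz
      have h3 : bsPt u x ∈ b₁ ⊓ b₂ :=
        ⟨by rw [h2]; exact b₁.neg_mem (hptw y), hptu x⟩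
      rw [hdisj, Submodule.mem_bot] at h3
      rw [h3, zero_add] at hz
      rcases hxy with h | h
      · exact h (hu0 x h3)
      · exact h (hw0 y hz)
    · have h1' : ∀ i, ∑ l, eval (bsPt u x + bsPt w y) (pderiv l F) *
          eval (Sum.elim x y) (pderiv i (X (Sum.inl 0) * C (u 0 l) + X (Sum.inl 1) * C (u 1 l) +
        (X (Sum.inr 0) * C (w 0 l) + X (Sum.inr 1) * C (w 1 l)) :
        MvPolynomial (Fin 2 ⊕ Fin 2) k)) = 0 := by
        intro i
        have := h1 i
        rw [bs_chain, map_sum] at this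
        rw [← this]
        refine Finset.sum_congr rfl fun l _ => ?_
        rw [map_mul, hev]
      let φ : (Fin 4 → k) →ₗ[k] k :=
        ∑ l, (eval (bsPt u x + bsPt w y) (pderiv l F)) • LinearMap.proj l
      have hφ : ∀ v, φ v = ∑ l, eval (bsPt u x + bsPt w y) (pderiv l F) * v l := by
        intro v; simp [φ]
      have hφu : ∀ j, φ (u j) = 0 := by
        intro j
        rw [hφ, ← h1' (Sum.inl j)]
        refine Finset.sum_congr rfl fun l _ => ?_
        fin_cases j <;> simp [pderiv_X]
      have hφw : ∀ j, φ (w j) = 0 := by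
        intro j
        rw [hφ, ← h1' (Sum.inr j)]
        refine Finset.sum_congr rfl fun l _ => ?_
        fin_cases j <;> simp [pderiv_X]
      have hker : (⊤ : Submodule k (Fin 4 → k)) ≤ LinearMap.ker φ := by
        rw [← htop, ← hus, ← hws]
        apply sup_le
        · rw [Submodule.span_le]; rintro _ ⟨j, rfl⟩; exact hφw j
        · rw [Submodule.span_le]; rintro _ ⟨j, rfl⟩; exact hφu j
      intro l
      have := hker (Submodule.mem_top (x := Pi.single l 1))
      rw [LinearMap.mem_ker, hφ] at this
      simpa [Pi.single_apply] using this
  -- the ten points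
  have hpts : ∀ i, ∃ p q : Fin 2 → k, p ≠ 0 ∧ q ≠ 0 ∧ bsPt u p ∈ a i ∧
      ∀ n, eval (Sum.elim p q) (resCoeff F u w n) = 0 := by
    intro i
    obtain ⟨P, hP, hP0⟩ := Submodule.exists_mem_ne_zero_of_ne_bot (hab₂ i)
    obtain ⟨Q, hQ, hQ0⟩ := Submodule.exists_mem_ne_zero_of_ne_bot (hab₁ i)
    obtain ⟨p, rfl⟩ := hub P hP.2
    obtain ⟨q, rfl⟩ := hwb Q hQ.2
    refine ⟨p, q, ?_, ?_, hP.1, ?_⟩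
    · rintro rfl; exact hP0 (by simp [bsPt])
    · rintro rfl; exact hQ0 (by simp [bsPt])
    · apply bs_pol_zero
      intro s
      exact haX i _ ((a i).add_mem ((a i).smul_mem s hP.1) hQ.1)
  choose p q hp0 hq0 hpa hz using hpts
  have hpp : ∀ i j, i ≠ j → p i 0 * p j 1 - p j 0 * p i 1 ≠ 0 := by
    intro i j hij h
    obtain ⟨s, hs⟩ := bs_par (hp0 j) h
    have h1 : bsPt u (p i) = s • bsPt u (p j) := by
      rw [hs]; simp [bsPt, Fin.sum_univ_two, mul_smul]
    have h2 : bsPt u (p i) ∈ a i ⊓ a j :=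
      ⟨hpa i, by rw [h1]; exact (a j).smul_mem _ (hpa j)⟩
    rw [haa i j hij, Submodule.mem_bot] at h2
    exact hp0 i (hu0 _ h2)
  have hβ0 : resCoeff F u w 2 = 0 :=
    bs_beta_zero hα hβ hγ hs (fun i => p i.castSucc) (fun i => q i.castSucc) (fun i => hq0 _)
      (fun i j hij => hpp _ _ (fun h => hij (Fin.castSucc_injective _ h)))
      (fun i => hz _ 3) (fun i => hz _ 2)
  have hs' : BSSmooth (resCoeff F u w 3 + resCoeff F u w 1) := by
    rwa [hβ0, add_zero] at hs
  refine ⟨-4, ?_, ?_, hα, hγ, bs_irreducible hα hβ hγ hs, bs_irreducible' hα hβ hγ hs, ?_, ?_⟩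
  · intro h
    have : (2 : k) * 2 = 0 := by linear_combination -h
    exact hchar (by simpa using this)
  · rw [hβ0]
    have : (C (-4 : k) : MvPolynomial (Fin 2 ⊕ Fin 2) k) = -4 := by
      rw [map_neg]; exact congrArg Neg.neg (map_ofNat C 4)
    rw [this]
    ring
  · exact bs_inter hα hγ hs' p q hp0 hq0 hpp (fun i => hz i 3) (fun i => hz i 1)
  · intro av bv hav hbv h0 h1 v wv d0 d1
    exact bs_transversal hα hγ hs' av bv hav hbv h0 h1 v wv d0 d1

end
end
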